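/- arXiv:1805.06732 — 4 statements merged into one kernel-verified Lean document; each statement's English description precedes it below -/
import Mathlib

section
/- If X = Y × Z is the product of a σ-compact separable metrizable space Y and an analytic zero-dimensional space Z, then F₀(X) is Π¹₁ (co-analytic) in F(X). -/
open Set Filter Topology TopologicalSpace

/-- `DimLE X n` : the topological (covering) dimension of `X` is at most `n`, i.e. every
finite open cover of `X` admits an open shrinking (refinement) of order at most `n + 1`. -/
def DimLE (X : Type*) [TopologicalSpace X] (n : ℕ) : Prop :=
  ∀ (k : ℕ) (U : Fin k → Set X), (∀ i, IsOpen (U i)) → (⋃ i, U i) = Set.univ →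
    ∃ V : Fin k → Set X, (∀ i, IsOpen (V i)) ∧ (∀ i, V i ⊆ U i) ∧ (⋃ i, V i) = Set.univ ∧
      ∀ x : X, ({i | x ∈ V i}).ncard ≤ n + 1

/-- The collection `F(X)` of closed subsets of `X`. -/
abbrev Cl (X : Type*) [TopologicalSpace X] : Type _ := {F : Set X // IsClosed F}

/-- `F₀(X)` : the set of all closed zero-dimensional subsets of `X`. -/
def F0 (X : Type*) [TopologicalSpace X] : Set (Cl X) := {F | DimLE (↥F.1) 0}

/-- The Vietoris topology on subsets of `Y`. -/
def vietoris (Y : Type*) [TopologicalSpace Y] : TopologicalSpace (Set Y) :=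
  TopologicalSpace.generateFrom
    ({S | ∃ U : Set Y, IsOpen U ∧ S = {A : Set Y | A ⊆ U}} ∪
     {S | ∃ U : Set Y, IsOpen U ∧ S = {A : Set Y | (A ∩ U).Nonempty}})

/-- A topology `τ` on `F(X)` is admissible if it is induced, via `F ↦ closure (e '' F)`,
by the Vietoris topology on some metrizable compactification `Y` of `X` (with embedding `e`). -/
def IsAdmissible (X : Type*) [tX : TopologicalSpace X] (τ : TopologicalSpace (Cl X)) : Prop :=
  ∃ (Y : Type) (tY : TopologicalSpace Y) (_ : @CompactSpace Y tY)
    (_ : @TopologicalSpace.MetrizableSpace Y tY) (e : X → Y),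
      @Topology.IsEmbedding X Y tX tY e ∧
      τ = (@vietoris Y tY).induced (fun F : Cl X => @closure Y tY (e '' F.1))

/-- An analytic space: a separable metrizable space which is empty or a continuous image
of the Baire space `ℕ → ℕ`. -/
def IsAnalyticSpace (X : Type*) [TopologicalSpace X] : Prop :=
  TopologicalSpace.MetrizableSpace X ∧ TopologicalSpace.SeparableSpace X ∧
    (IsEmpty X ∨ ∃ f : (ℕ → ℕ) → X, Continuous f ∧ Function.Surjective f)

/-- `Σ¹₂` subsets of a topological space: projections of co-analytic sets. -/
def IsSigma12 {W : Type*} [TopologicalSpace W] (s : Set W) : Prop :=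
  ∃ B : Set (W × (ℕ → ℕ)), MeasureTheory.AnalyticSet Bᶜ ∧ s = {w | ∃ y, (w, y) ∈ B}

/-- `Σ¹₂`-hardness (with Cantor space `2^ω = ℕ → Bool` as source). -/
def Sigma12Hard {W : Type*} [TopologicalSpace W] (A : Set W) : Prop :=
  ∀ A' : Set (ℕ → Bool), IsSigma12 A' →
    ∃ φ : (ℕ → Bool) → W, Continuous φ ∧ A' = φ ⁻¹' A

/-- `Π¹₁`-hardness. -/
def Pi11Hard {W : Type*} [TopologicalSpace W] (A : Set W) : Prop :=
  ∀ A' : Set (ℕ → Bool), MeasureTheory.AnalyticSet A'ᶜ →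
    ∃ φ : (ℕ → Bool) → W, Continuous φ ∧ A' = φ ⁻¹' A

/-- The additive Borel classes `Σ⁰ξ` : `Σ⁰₁` consists of the open sets, and for `ξ > 1`,
`Σ⁰ξ` consists of countable unions of sets whose complements are in some `Σ⁰η`, `η < ξ`. -/
inductive SigmaOrd {W : Type*} [TopologicalSpace W] : Ordinal.{0} → Set W → Prop
  | basic (s : Set W) : IsOpen s → SigmaOrd 1 s
  | union (ξ : Ordinal.{0}) (η : ℕ → Ordinal.{0}) (f : ℕ → Set W) (hξ : 1 < ξ)
      (hη : ∀ n, η n < ξ) (h : ∀ n, SigmaOrd (η n) (f n)ᶜ) : SigmaOrd ξ (⋃ n, f n)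

/-- The run produced when player I follows the strategy `σ` and player II plays `β`. -/
def playI (σ : List ℕ → ℕ) (β : ℕ → ℕ) : ℕ → ℕ := fun n =>
  if n % 2 = 0 then σ (List.ofFn fun i : Fin (n / 2) => β i) else β (n / 2)

/-- Player I has a winning strategy in the game `G_A`. -/
def PlayerIWins (A : Set (ℕ → ℕ)) : Prop :=
  ∃ σ : List ℕ → ℕ, ∀ β : ℕ → ℕ, playI σ β ∈ A

/-- The game operator `Game B` applied to `B ⊆ W × ω^ω`. -/
def GameOp {W : Type*} (B : Set (W × (ℕ → ℕ))) : Set W :=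
  {w | PlayerIWins {γ | (w, γ) ∈ B}}

/-- `Game Σ⁰ξ`-hardness. -/
def GameSigmaHard (ξ : Ordinal.{0}) {W : Type*} [TopologicalSpace W] (A : Set W) : Prop :=
  ∀ A' : Set (ℕ → Bool),
    (∃ B : Set ((ℕ → Bool) × (ℕ → ℕ)), SigmaOrd ξ B ∧ A' = GameOp B) →
    ∃ φ : (ℕ → Bool) → W, Continuous φ ∧ A' = φ ⁻¹' A

open MeasureTheory

section ZeroDimensional

theorem DimLE.exists_isClopen {T : Type*} [TopologicalSpace T] [T1Space T] (h : DimLE T 0)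
    {O : Set T} (hO : IsOpen O) {p : T} (hp : p ∈ O) :
    ∃ V : Set T, IsClopen V ∧ p ∈ V ∧ V ⊆ O := by
  obtain ⟨V, hVo, hVU, hV, hcard⟩ := h 2 ![O, {p}ᶜ]
    (by
      intro i
      fin_cases i
      · exact hO
      · exact isOpen_compl_singleton)
    (by
      refine eq_univ_of_forall fun x => mem_iUnion.2 ?_
      by_cases hx : x = p
      · exact ⟨0, by simpa [hx] using hp⟩
      · exact ⟨1, by simpa using hx⟩)
  have hcover : ∀ x, x ∈ V 0 ∨ x ∈ V 1 := by
    intro x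
    obtain ⟨i, hi⟩ := mem_iUnion.1 (hV ▸ mem_univ x)
    fin_cases i
    · exact Or.inl hi
    · exact Or.inr hi
  have hdisj : ∀ x, x ∈ V 0 → x ∉ V 1 := by
    intro x h0 h1
    have := (Set.ncard_le_one (toFinite _)).1 (hcard x) 0 h0 1 h1
    exact absurd this (by decide)
  have hcompl : (V 0)ᶜ = V 1 := by
    ext x
    exact ⟨fun hx => (hcover x).resolve_left hx, fun h1 h0 => hdisj x h0 h1⟩
  refine ⟨V 0, ⟨isOpen_compl_iff.1 (hcompl ▸ hVo 1), hVo 0⟩, ?_, hVU 0⟩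
  refine (hcover p).resolve_right fun h1 => ?_
  have := hVU 1 h1
  simp at this

theorem DimLE.subsingleton_of_isPreconnected {T : Type*} [TopologicalSpace T] [T1Space T]
    (h : DimLE T 0) {t : Set T} (ht : IsPreconnected t) : t.Subsingleton := by
  intro p hp q hq
  by_contra hpq
  obtain ⟨V, hV, hpV, hVq⟩ := h.exists_isClopen (isOpen_compl_singleton (x := q)) (p := p) hpq
  exact hVq (ht.subset_isClopen hV ⟨p, hp, hpV⟩ hq) rfl

theorem dimLE_zero_of_forall_exists_isClopen {T : Type*} [TopologicalSpace T] [NormalSpace T]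
    (h : ∀ A B : Set T, IsClosed A → IsClosed B → Disjoint A B →
      ∃ C : Set T, IsClopen C ∧ A ⊆ C ∧ Disjoint C B) : DimLE T 0 := by
  intro k U hU hUc
  obtain ⟨A, hA, hAc, hAU⟩ := exists_iUnion_eq_closed_subset hU (fun _ => toFinite _) hUc
  choose C hC hAC hCU using fun i => h (A i) (U i)ᶜ (hAc i) (hU i).isClosed_compl
    (disjoint_compl_right_iff_subset.2 (hAU i))
  refine ⟨disjointed C, fun i => ?_, fun i => ?_, ?_, fun x => ?_⟩
  · refine (disjointedRec (f := C) (p := IsClopen) (fun _ _ hs => hs.diff (hC _)) (hC i)).isOpen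
  · exact (disjointed_subset C i).trans (disjoint_compl_right_iff_subset.1 (hCU i))
  · rw [iUnion_disjointed]
    exact eq_univ_of_subset (iUnion_mono hAC) hA
  · rw [zero_add, Set.ncard_le_one (toFinite _)]
    intro i hi j hj
    by_contra hij
    exact disjoint_left.1 (disjoint_disjointed C hij) hi hj

theorem exists_open_nhds_disjoint_closure_of_isClosed {T : Type*} [TopologicalSpace T]
    [NormalSpace T] {A B : Set T} (hA : IsClosed A) (hB : IsClosed B) (hAB : Disjoint A B) :
    ∃ U V : Set T, IsOpen U ∧ IsOpen V ∧ A ⊆ U ∧ B ⊆ V ∧ Disjoint (closure U) (closure V) := by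
  obtain ⟨U, hU, hAU, hUB⟩ := normal_exists_closure_subset hA hB.isOpen_compl
    (disjoint_left.1 hAB)
  obtain ⟨V, hV, hBV, hVU⟩ := normal_exists_closure_subset hB isClosed_closure.isOpen_compl
    (disjoint_right.1 (disjoint_left.2 hUB))
  exact ⟨U, V, hU, hV, hAU, hBV, disjoint_right.2 hVU⟩

/-- Disjoint closed subsets of the ambient space are separated by disjoint open sets
covering `S`. -/
def ClopenSeparates {T : Type*} [TopologicalSpace T] (S : Set T) : Prop :=
  ∀ A B : Set T, IsClosed A → IsClosed B → Disjoint A B →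
    ∃ O P : Set T, IsOpen O ∧ IsOpen P ∧ Disjoint O P ∧ S ⊆ O ∪ P ∧ A ⊆ O ∧ B ⊆ P

theorem ClopenSeparates.exists_disjoint_closure {T : Type*} [TopologicalSpace T] [NormalSpace T]
    {S : Set T} (hS : ClopenSeparates S) (hSc : IsClosed S) {A B : Set T} (hA : IsClosed A)
    (hB : IsClosed B) (hAB : Disjoint A B) :
    ∃ U V : Set T, IsOpen U ∧ IsOpen V ∧ A ⊆ U ∧ B ⊆ V ∧ Disjoint (closure U) (closure V) ∧
      S ⊆ U ∪ V := by
  obtain ⟨O, P, hO, hP, hOP, hSOP, hAO, hBP⟩ := hS A B hA hB hAB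
  have h1 : A ∪ S \ P ⊆ O := union_subset hAO fun x hx => (hSOP hx.1).resolve_right hx.2
  have h2 : B ∪ S \ O ⊆ P := union_subset hBP fun x hx => (hSOP hx.1).resolve_left hx.2
  obtain ⟨U, V, hU, hV, hAU, hBV, hUV⟩ := exists_open_nhds_disjoint_closure_of_isClosed
    (hA.union (hSc.sdiff hP)) (hB.union (hSc.sdiff hO)) (hOP.mono h1 h2)
  refine ⟨U, V, hU, hV, subset_union_left.trans hAU, subset_union_left.trans hBV, hUV, ?_⟩
  intro x hx
  by_cases hxP : x ∈ P
  · exact Or.inr (hBV (Or.inr ⟨hx, fun hxO => disjoint_left.1 hOP hxO hxP⟩))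
  · exact Or.inl (hAU (Or.inr ⟨hx, hxP⟩))

/-- The countable closed sum theorem in dimension zero. -/
theorem dimLE_zero_of_iUnion_eq_univ {T : Type*} [TopologicalSpace T] [NormalSpace T]
    (S : ℕ → Set T) (hSc : ∀ n, IsClosed (S n)) (hS : ⋃ n, S n = univ)
    (hsep : ∀ n, ClopenSeparates (S n)) : DimLE T 0 := by
  refine dimLE_zero_of_forall_exists_isClopen fun A B hA hB hAB => ?_
  obtain ⟨U₀, V₀, -, -, hAU, hBV, hUV⟩ :=
    exists_open_nhds_disjoint_closure_of_isClosed hA hB hAB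
  let σ := {p : Set T × Set T // Disjoint (closure p.1) (closure p.2)}
  have step : ∀ (n : ℕ) (p : σ), ∃ q : σ, IsOpen q.1.1 ∧ IsOpen q.1.2 ∧ p.1.1 ⊆ q.1.1 ∧
      p.1.2 ⊆ q.1.2 ∧ S n ⊆ q.1.1 ∪ q.1.2 := by
    intro n p
    obtain ⟨U, V, hU, hV, h1, h2, h3, h4⟩ := (hsep n).exists_disjoint_closure (hSc n)
      isClosed_closure isClosed_closure p.2
    exact ⟨⟨(U, V), h3⟩, hU, hV, subset_closure.trans h1, subset_closure.trans h2, h4⟩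
  choose next hnU hnV hmU hmV hcov using step
  let s : ℕ → σ := fun n => Nat.rec ⟨(U₀, V₀), hUV⟩ next n
  have hsU : Monotone fun n => (s n).1.1 := monotone_nat_of_le_succ fun n => hmU n (s n)
  have hsV : Monotone fun n => (s n).1.2 := monotone_nat_of_le_succ fun n => hmV n (s n)
  have hdisj : ∀ m n x, x ∈ (s m).1.1 → x ∉ (s n).1.2 := by
    intro m n x hx hx'
    exact disjoint_left.1 (s (max m n)).2 (subset_closure (hsU (le_max_left m n) hx))
      (subset_closure (hsV (le_max_right m n) hx'))
  have hcompl : (⋃ n, (s (n + 1)).1.1)ᶜ = ⋃ n, (s (n + 1)).1.2 := by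
    ext x
    simp only [mem_compl_iff, mem_iUnion, not_exists]
    constructor
    · intro hx
      obtain ⟨n, hn⟩ := mem_iUnion.1 (hS ▸ mem_univ x)
      exact ⟨n, (hcov n (s n) hn).resolve_left (hx n)⟩
    · rintro ⟨n, hn⟩ m hm
      exact hdisj (m + 1) (n + 1) x hm hn
  refine ⟨⋃ n, (s (n + 1)).1.1, ⟨?_, isOpen_iUnion fun n => hnU n (s n)⟩, ?_, ?_⟩
  · rw [← isOpen_compl_iff, hcompl]
    exact isOpen_iUnion fun n => hnV n (s n)
  · exact fun x hx => mem_iUnion.2 ⟨0, hmU 0 (s 0) (hAU hx)⟩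
  · rw [disjoint_left]
    intro x hx hxB
    obtain ⟨n, hn⟩ := mem_iUnion.1 hx
    exact hdisj (n + 1) 0 x hn (hBV hxB)

/-- A closed map on `S` to a zero-dimensional space with compact totally disconnected fibres. -/
theorem clopenSeparates_of_fibers {T Z : Type*} [TopologicalSpace T] [NormalSpace T] [T2Space T]
    [TopologicalSpace Z] [T1Space Z] [SecondCountableTopology Z] (hZ : DimLE Z 0) {p : T → Z}
    (hp : Continuous p) {S : Set T}
    (hmap : ∀ A, IsClosed A → IsClosed (p '' (A ∩ S)))
    (hcomp : ∀ z, IsCompact (S ∩ p ⁻¹' {z}))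
    (htd : ∀ z, IsTotallyDisconnected (S ∩ p ⁻¹' {z})) : ClopenSeparates S := by
  intro A B hA hB hAB
  have key : ∀ z, ∃ (W : Set Z) (U V : Set T), IsClopen W ∧ z ∈ W ∧ IsOpen U ∧ IsOpen V ∧
      Disjoint U V ∧ A ⊆ U ∧ B ⊆ V ∧ S ∩ p ⁻¹' W ⊆ U ∪ V := by
    intro z
    set Φ := S ∩ p ⁻¹' {z} with hΦ
    have : CompactSpace Φ := isCompact_iff_compactSpace.1 (hcomp z)
    have : TotallyDisconnectedSpace Φ := totallyDisconnectedSpace_subtype_iff.2 (htd z)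
    have hΦc : IsClosed Φ := (hcomp z).isClosed
    obtain ⟨C, hC, hAC, hCB⟩ := exists_clopen_of_closed_subset_open
      (hA.preimage (continuous_subtype_val (p := (· ∈ Φ))))
      (hB.preimage (continuous_subtype_val (p := (· ∈ Φ)))).isOpen_compl
      (fun x hx hx' => disjoint_left.1 hAB hx hx')
    have hC1 : IsClosed (Subtype.val '' C : Set T) :=
      hΦc.isClosedEmbedding_subtypeVal.isClosedMap _ hC.isClosed
    have hC2 : IsClosed (Subtype.val '' Cᶜ : Set T) :=
      hΦc.isClosedEmbedding_subtypeVal.isClosedMap _ hC.compl.isClosed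
    obtain ⟨U, V, hU, hV, hAU, hBV, hUV⟩ := normal_separation (hA.union hC1) (hB.union hC2) (by
      rw [disjoint_left]
      rintro x (hx | ⟨x, hx, rfl⟩) (hx' | ⟨y, hy, hyx⟩)
      · exact disjoint_left.1 hAB hx hx'
      · exact hy (hAC (by simpa [hyx] using hx))
      · exact hCB hx hx'
      · exact hy (Subtype.ext hyx ▸ hx))
    have hcl := hmap _ (hU.union hV).isClosed_compl
    obtain ⟨W, hW, hzW, hWsub⟩ := hZ.exists_isClopen hcl.isOpen_compl (p := z) (by
      rintro ⟨x, ⟨hx, hxS⟩, hxz⟩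
      have hxΦ : x ∈ Φ := ⟨hxS, hxz⟩
      by_cases hxC : (⟨x, hxΦ⟩ : Φ) ∈ C
      · exact hx (Or.inl (hAU (Or.inr ⟨_, hxC, rfl⟩)))
      · exact hx (Or.inr (hBV (Or.inr ⟨_, hxC, rfl⟩))))
    refine ⟨W, U, V, hW, hzW, hU, hV, hUV, subset_union_left.trans hAU,
      subset_union_left.trans hBV, ?_⟩
    rintro x ⟨hxS, hxW⟩
    by_contra hx
    exact hWsub hxW ⟨x, ⟨hx, hxS⟩, rfl⟩
  choose W U V hW hzW hU hV hUV hAU hBV hcov using key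
  rcases isEmpty_or_nonempty Z with hE | hN
  · have : IsEmpty T := p.isEmpty
    exact ⟨∅, ∅, isOpen_empty, isOpen_empty, disjoint_empty _, fun x => isEmptyElim x,
      fun x => isEmptyElim x, fun x => isEmptyElim x⟩
  obtain ⟨s, hs, hsW⟩ := TopologicalSpace.countable_cover_nhds fun z => (hW z).isOpen.mem_nhds (hzW z)
  have hsne : s.Nonempty := by
    obtain ⟨z⟩ := hN
    obtain ⟨y, hy, -⟩ := mem_iUnion₂.1 (hsW ▸ mem_univ z)
    exact ⟨y, hy⟩
  obtain ⟨f, rfl⟩ := hs.exists_eq_range hsne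
  set D := disjointed fun n => W (f n) with hD
  have hDo : ∀ n, IsClopen (D n) := fun n =>
    disjointedRec (p := IsClopen) (fun _ _ ht => ht.diff (hW _)) (hW (f n))
  have hDcov : ∀ x, ∃ n, p x ∈ D n := by
    intro x
    rw [← mem_iUnion, hD, iUnion_disjointed]
    have := hsW ▸ mem_univ (p x)
    simpa using this
  refine ⟨⋃ n, p ⁻¹' D n ∩ U (f n), ⋃ n, p ⁻¹' D n ∩ V (f n),
    isOpen_iUnion fun n => ((hDo n).isOpen.preimage hp).inter (hU _),
    isOpen_iUnion fun n => ((hDo n).isOpen.preimage hp).inter (hV _), ?_, ?_, ?_, ?_⟩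
  · rw [disjoint_left]
    intro x hx hx'
    obtain ⟨n, hn, hnU⟩ := mem_iUnion.1 hx
    obtain ⟨m, hm, hmV⟩ := mem_iUnion.1 hx'
    obtain rfl : n = m := by
      by_contra hnm
      exact disjoint_left.1 (disjoint_disjointed (fun k => W (f k)) hnm) hn hm
    exact disjoint_left.1 (hUV _) hnU hmV
  · intro x hx
    obtain ⟨n, hn⟩ := hDcov x
    refine (hcov (f n) ⟨hx, disjointed_subset _ n hn⟩).imp (fun h => ?_) fun h => ?_
    · exact mem_iUnion.2 ⟨n, hn, h⟩
    · exact mem_iUnion.2 ⟨n, hn, h⟩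
  · intro x hx
    obtain ⟨n, hn⟩ := hDcov x
    exact mem_iUnion.2 ⟨n, hn, hAU _ hx⟩
  · intro x hx
    obtain ⟨n, hn⟩ := hDcov x
    exact mem_iUnion.2 ⟨n, hn, hBV _ hx⟩

/-- A closed subset of `Y × Z` with totally disconnected fibres over `Z` is zero-dimensional. -/
theorem dimLE_zero_of_fibers {Y Z : Type*} [TopologicalSpace Y] [MetrizableSpace Y]
    [SigmaCompactSpace Y] [TopologicalSpace Z] [MetrizableSpace Z] [SecondCountableTopology Z]
    (hZ : DimLE Z 0) {F : Set (Y × Z)} (hF : IsClosed F)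
    (h : ∀ (n : ℕ) (z : Z) (t : Set (compactCovering Y n)), IsPreconnected t →
      (∀ y ∈ t, ((y : Y), z) ∈ F) → t.Subsingleton) : DimLE F 0 := by
  let K := compactCovering Y
  have hK : ∀ n, IsCompact (K n) := isCompact_compactCovering Y
  let S : ℕ → Set F := fun n => {x | x.1.1 ∈ K n}
  have hSc : ∀ n, IsClosed (S n) := fun n => (hK n).isClosed.preimage (by fun_prop)
  have hp : Continuous fun x : F => x.1.2 := by fun_prop
  refine dimLE_zero_of_iUnion_eq_univ S hSc ?_ fun n =>
    clopenSeparates_of_fibers hZ hp ?_ ?_ ?_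
  · exact eq_univ_of_forall fun x => mem_iUnion.2 (exists_mem_compactCovering x.1.1)
  · intro A hA
    have : CompactSpace (K n) := isCompact_iff_compactSpace.1 (hK n)
    have hA' : IsClosed (Subtype.val '' A : Set (Y × Z)) :=
      hF.isClosedEmbedding_subtypeVal.isClosedMap _ hA
    have := isClosedMap_snd_of_compactSpace (X := K n) (Y := Z) _
      (hA'.preimage (f := fun q : K n × Z => ((q.1 : Y), q.2)) (by fun_prop))
    convert this using 1
    ext z
    constructor
    · rintro ⟨x, ⟨hxA, hxS⟩, rfl⟩
      exact ⟨(⟨x.1.1, hxS⟩, x.1.2), ⟨x, hxA, rfl⟩, rfl⟩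
    · rintro ⟨⟨y, z⟩, ⟨x, hxA, hx⟩, rfl⟩
      refine ⟨x, ⟨hxA, ?_⟩, by simp [hx]⟩
      change x.1.1 ∈ K n
      rw [hx]
      exact y.2
  · intro z
    rw [IsEmbedding.subtypeVal.isCompact_iff]
    have : Subtype.val '' (S n ∩ (fun x : F => x.1.2) ⁻¹' {z}) = K n ×ˢ {z} ∩ F := by
      ext x
      constructor
      · rintro ⟨x, ⟨h1, h2⟩, rfl⟩
        exact ⟨⟨h1, h2⟩, x.2⟩
      · rintro ⟨⟨h1, h2⟩, h3⟩
        exact ⟨⟨x, h3⟩, ⟨h1, h2⟩, rfl⟩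
    rw [this]
    exact ((hK n).prod isCompact_singleton).inter_right hF
  · intro z t hts ht
    have ht' : IsPreconnected (Subtype.val ⁻¹' ((fun x : F => x.1.1) '' t) : Set (K n)) := by
      rw [← IsInducing.subtypeVal.isPreconnected_image, image_preimage_eq_of_subset]
      · exact ht.image _ (by fun_prop)
      · rintro _ ⟨x, hx, rfl⟩
        exact Subtype.range_val ▸ (hts hx).1
    have := h n z _ ht' (by
      rintro y ⟨x, hx, hxy⟩
      have : ((y : Y), z) = x.1 := Prod.ext hxy.symm (hts hx).2.symm
      rw [this]
      exact x.2)
    intro a ha b hb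
    have hab := this (x := ⟨a.1.1, (hts ha).1⟩) ⟨a, ha, rfl⟩ (y := ⟨b.1.1, (hts hb).1⟩) ⟨b, hb, rfl⟩
    exact Subtype.ext (Prod.ext (congrArg Subtype.val hab) ((hts ha).2.trans (hts hb).2.symm))

end ZeroDimensional

section Hyperspace

theorem exists_seq_isOpen_of_isCompact_subset (Q : Type*) [TopologicalSpace Q]
    [SecondCountableTopology Q] :
    ∃ B : ℕ → Set Q, (∀ n, IsOpen (B n)) ∧
      ∀ C U, IsCompact C → IsOpen U → C ⊆ U → ∃ n, C ⊆ B n ∧ B n ⊆ U := by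
  obtain ⟨b, hb⟩ := ((countable_ofPred_finite_subset (countable_countableBasis Q)).image
    sUnion).exists_eq_range ⟨_, ∅, ⟨finite_empty, empty_subset _⟩, rfl⟩
  have hmem : ∀ n, ∃ t, (t.Finite ∧ t ⊆ countableBasis Q) ∧ ⋃₀ t = b n := fun n =>
    (hb ▸ mem_range_self n : b n ∈ sUnion '' {t | t.Finite ∧ t ⊆ countableBasis Q})
  refine ⟨b, fun n => ?_, fun C U hC hU hCU => ?_⟩
  · obtain ⟨t, ht, htn⟩ := hmem n
    rw [← htn]
    exact isOpen_sUnion fun s hs => isOpen_of_mem_countableBasis (ht.2 hs)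
  · obtain ⟨t, hts, htf, hCt⟩ := hC.elim_finite_subcover_image
      (b := {s | s ∈ countableBasis Q ∧ s ⊆ U}) (c := id)
      (fun s hs => isOpen_of_mem_countableBasis hs.1) (fun x hx => by
        obtain ⟨s, hs, hxs, hsU⟩ :=
          (isBasis_countableBasis Q).exists_subset_of_mem_open (hCU hx) hU
        exact mem_iUnion₂.2 ⟨s, ⟨hs, hsU⟩, hxs⟩)
    simp only [id_eq, ← sUnion_eq_biUnion] at hCt
    have : ⋃₀ t ∈ range b := hb ▸ ⟨t, ⟨htf, fun s hs => (hts hs).1⟩, rfl⟩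
    obtain ⟨n, hn⟩ := this
    exact ⟨n, hn ▸ hCt, hn ▸ sUnion_subset fun s hs => (hts hs).2⟩

section Measurability

variable {P Q ι : Type*} [TopologicalSpace P] [MeasurableSpace P] [OpensMeasurableSpace P]
  [TopologicalSpace Q] [Countable ι] {w : P → ι → Q}

theorem measurableSet_closure_range_inter_nonempty (hw : ∀ i, Continuous fun p => w p i)
    {U : Set Q} (hU : IsOpen U) :
    MeasurableSet {p | (closure (range (w p)) ∩ U).Nonempty} := by
  have : {p | (closure (range (w p)) ∩ U).Nonempty} = ⋃ i, (fun p => w p i) ⁻¹' U := by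
    ext p
    rw [mem_ofPred_eq, closure_inter_open_nonempty_iff hU]
    simp [Set.Nonempty]
  rw [this]
  exact MeasurableSet.iUnion fun i => (hU.preimage (hw i)).measurableSet

theorem measurableSet_closure_range_subset [CompactSpace Q] [T2Space Q]
    [SecondCountableTopology Q] (hw : ∀ i, Continuous fun p => w p i)
    {U : Set Q} (hU : IsOpen U) : MeasurableSet {p | closure (range (w p)) ⊆ U} := by
  obtain ⟨B, hBo, hB⟩ := exists_seq_isOpen_of_isCompact_subset Q
  have : {p | closure (range (w p)) ⊆ U} =
      ⋃ n, ⋃ (_ : closure (B n) ⊆ U), ⋂ i, (fun p => w p i) ⁻¹' closure (B n) := by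
    ext p
    simp only [mem_ofPred_eq, mem_iUnion, mem_iInter, mem_preimage, exists_prop]
    constructor
    · intro h
      obtain ⟨V, hV, hCV, hVU⟩ := normal_exists_closure_subset isClosed_closure hU h
      obtain ⟨n, hn, hnV⟩ := hB _ V isClosed_closure.isCompact hV hCV
      exact ⟨n, (closure_mono hnV).trans hVU,
        fun i => subset_closure (hn (subset_closure (mem_range_self i)))⟩
    · rintro ⟨n, hn, h⟩
      exact (closure_minimal (range_subset_iff.2 h) isClosed_closure).trans hn
  rw [this]
  exact MeasurableSet.iUnion fun n => MeasurableSet.iUnion fun _ => MeasurableSet.iInter fun i =>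
    (isClosed_closure.preimage (hw i)).measurableSet

theorem measurableSet_isPreconnected_closure_range [CompactSpace Q] [T2Space Q]
    [SecondCountableTopology Q] (hw : ∀ i, Continuous fun p => w p i) :
    MeasurableSet {p | IsPreconnected (closure (range (w p)))} := by
  obtain ⟨B, hBo, hB⟩ := exists_seq_isOpen_of_isCompact_subset Q
  have : {p | IsPreconnected (closure (range (w p)))} = ⋂ n, ⋂ m, ⋂ (_ : Disjoint (B n) (B m)),
      ({p | closure (range (w p)) ⊆ B n ∪ B m} ∩ {p | (closure (range (w p)) ∩ B n).Nonempty} ∩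
        {p | (closure (range (w p)) ∩ B m).Nonempty})ᶜ := by
    ext p
    simp only [mem_ofPred_eq, mem_iInter, mem_compl_iff, mem_inter_iff]
    constructor
    · rintro h n m hnm ⟨⟨h1, h2⟩, h3⟩
      obtain ⟨x, -, hx⟩ := h _ _ (hBo n) (hBo m) h1 h2 h3
      exact disjoint_left.1 hnm hx.1 hx.2
    · intro h
      rw [isPreconnected_closed_iff]
      intro A A' hA hA' hsub hne hne'
      by_contra hdis
      have hdisj : Disjoint (closure (range (w p)) ∩ A) (closure (range (w p)) ∩ A') :=
        disjoint_left.2 fun x hx hx' => hdis ⟨x, hx.1, hx.2, hx'.2⟩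
      have hc := isClosed_closure.inter hA (X := Q) (s₁ := closure (range (w p)))
      have hc' := isClosed_closure.inter hA' (X := Q) (s₁ := closure (range (w p)))
      obtain ⟨U, V, hU, hV, hAU, hAV, hUV⟩ := normal_separation hc hc' hdisj
      obtain ⟨n, hn, hnU⟩ := hB _ _ hc.isCompact hU hAU
      obtain ⟨m, hm, hmV⟩ := hB _ _ hc'.isCompact hV hAV
      refine h n m (hUV.mono hnU hmV) ⟨⟨fun x hx => ?_, ?_⟩, ?_⟩
      · exact (hsub hx).imp (fun hxA => hn ⟨hx, hxA⟩) fun hxA => hm ⟨hx, hxA⟩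
      · exact hne.mono fun x hx => ⟨hx.1, hn hx⟩
      · exact hne'.mono fun x hx => ⟨hx.1, hm hx⟩
  rw [this]
  exact MeasurableSet.iInter fun n => MeasurableSet.iInter fun m => MeasurableSet.iInter fun _ =>
    (((measurableSet_closure_range_subset hw ((hBo n).union (hBo m))).inter
      (measurableSet_closure_range_inter_nonempty hw (hBo n))).inter
      (measurableSet_closure_range_inter_nonempty hw (hBo m))).compl

end Measurability

/-- On closed subsets of a compact space with a countable base, the Vietoris topology has a
countable subbase. -/
theorem exists_induced_vietoris_eq_generateFrom {α Q : Type*} [TopologicalSpace Q]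
    [CompactSpace Q] [SecondCountableTopology Q] (f : α → Set Q)
    (hf : ∀ a, IsClosed (f a)) :
    ∃ B : ℕ → Set Q, (∀ n, IsOpen (B n)) ∧ (_root_.vietoris Q).induced f =
      generateFrom (range (fun n => {a | f a ⊆ B n}) ∪
        range fun n => {a | (f a ∩ B n).Nonempty}) := by
  obtain ⟨B, hBo, hB⟩ := exists_seq_isOpen_of_isCompact_subset Q
  refine ⟨B, hBo, le_antisymm ?_ ?_⟩
  · refine le_generateFrom ?_
    rintro _ (⟨n, rfl⟩ | ⟨n, rfl⟩)
    · exact ⟨_, GenerateOpen.basic _ (Or.inl ⟨B n, hBo n, rfl⟩), rfl⟩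
    · exact ⟨_, GenerateOpen.basic _ (Or.inr ⟨B n, hBo n, rfl⟩), rfl⟩
  · rw [_root_.vietoris, induced_generateFrom_eq]
    refine le_generateFrom ?_
    rintro _ ⟨_, ⟨U, hU, rfl⟩ | ⟨U, hU, rfl⟩, rfl⟩
    · have : f ⁻¹' {A | A ⊆ U} = ⋃ n, ⋃ (_ : B n ⊆ U), {a | f a ⊆ B n} := by
        ext a
        simp only [mem_preimage, mem_ofPred_eq, mem_iUnion, exists_prop]
        constructor
        · intro h
          obtain ⟨n, h1, h2⟩ := hB _ U (hf a).isCompact hU h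
          exact ⟨n, h2, h1⟩
        · rintro ⟨n, h1, h2⟩
          exact h2.trans h1
      rw [this]
      exact @isOpen_iUnion _ _ (_) _ fun n => @isOpen_iUnion _ _ (_) _ fun _ =>
        GenerateOpen.basic _ (Or.inl ⟨n, rfl⟩)
    · have : f ⁻¹' {A | (A ∩ U).Nonempty} =
          ⋃ n, ⋃ (_ : B n ⊆ U), {a | (f a ∩ B n).Nonempty} := by
        ext a
        simp only [mem_preimage, mem_ofPred_eq, mem_iUnion, exists_prop]
        constructor
        · rintro ⟨x, hx, hxU⟩
          obtain ⟨n, h1, h2⟩ := hB {x} U isCompact_singleton hU (singleton_subset_iff.2 hxU)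
          exact ⟨n, h2, x, hx, h1 rfl⟩
        · rintro ⟨n, h1, x, hx, hxn⟩
          exact ⟨x, hx, h1 hxn⟩
      rw [this]
      exact @isOpen_iUnion _ _ (_) _ fun n => @isOpen_iUnion _ _ (_) _ fun _ =>
        GenerateOpen.basic _ (Or.inr ⟨n, rfl⟩)

/-- For an admissible topology, a Borel family of continuously parametrized sequences
has an analytic set of closures. -/
theorem IsAdmissible.analyticSet_image_closure_range {X P ι : Type*} [TopologicalSpace X]
    {τ : TopologicalSpace (Cl X)} (hτ : IsAdmissible X τ) [Countable ι]
    [TopologicalSpace P] [PolishSpace P] [MeasurableSpace P] [BorelSpace P]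
    {w : P → ι → X} (hw : ∀ i, Continuous fun p => w p i) {s : Set P} (hs : MeasurableSet s) :
    AnalyticSet ((fun p => (⟨closure (range (w p)), isClosed_closure⟩ : Cl X)) '' s) := by
  obtain ⟨Q, tQ, hQc, hQm, e, he, rfl⟩ := hτ
  have : SecondCountableTopology Q := by
    let := metrizableSpaceMetric Q
    infer_instance
  set f : Cl X → Set Q := fun F => closure (e '' F.1) with hf
  obtain ⟨B, hBo, hB⟩ := exists_induced_vietoris_eq_generateFrom f fun _ => isClosed_closure
  let τ := (_root_.vietoris Q).induced f
  have : SecondCountableTopology (Cl X) :=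
    ⟨_, (countable_range _).union (countable_range _), hB⟩
  let : MeasurableSpace (Cl X) := borel _
  have : BorelSpace (Cl X) := ⟨rfl⟩
  refine hs.analyticSet_image ?_
  have hborel := borel_eq_generateFrom_of_subbasis hB
  have hfw : ∀ p, f ⟨closure (range (w p)), isClosed_closure⟩ =
      closure (range fun i => e (w p i)) := by
    intro p
    change closure (e '' closure (range (w p))) = _
    rw [closure_image_closure he.continuous, ← range_comp]
    rfl
  have hew : ∀ i, Continuous fun p => e (w p i) := fun i => he.continuous.comp (hw i)
  change Measurable[_, borel (Cl X)] _
  rw [hborel]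
  refine measurable_generateFrom ?_
  rintro _ (⟨n, rfl⟩ | ⟨n, rfl⟩)
  · simp only [preimage_ofPred_eq, hfw]
    exact measurableSet_closure_range_subset hew (hBo n)
  · simp only [preimage_ofPred_eq, hfw]
    exact measurableSet_closure_range_inter_nonempty hew (hBo n)

end Hyperspace

theorem exists_seq_subset_closure_range {X : Type*} [TopologicalSpace X]
    [SecondCountableTopology X] {F : Set X} (hF : F.Nonempty) :
    ∃ x : ℕ → X, (∀ k, x k ∈ F) ∧ F ⊆ closure (range x) := by
  have := hF.to_subtype
  obtain ⟨u, hu⟩ := exists_dense_seq F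
  refine ⟨fun k => u k, fun k => (u k).2, fun y hy => ?_⟩
  have := image_closure_subset_closure_image continuous_subtype_val
    (mem_image_of_mem Subtype.val (hu ⟨y, hy⟩))
  rwa [← range_comp] at this

/-- A sequence in the `n`-th compact piece of `Y`, a sequence of codes of points of `Y × Z`,
and a code of a point of `Z`. -/
abbrev SequenceCodes (Y : Type*) [TopologicalSpace Y] [SigmaCompactSpace Y] (n : ℕ) :=
  (ℕ → compactCovering Y n) × (ℕ → (Σ m, compactCovering Y m) × (ℕ → ℕ)) × (ℕ → ℕ)

/-- If `X = Y × Z` is the product of a `σ`-compact separable metrizable space `Y` and an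
analytic zero-dimensional space `Z`, then `F₀(X)` is `Π¹₁` (co-analytic) in `F(X)`. -/
theorem F0_coanalytic_of_sigmaCompact_prod_zeroDim {Y Z : Type*}
    [TopologicalSpace Y] [TopologicalSpace.MetrizableSpace Y]
    [TopologicalSpace.SeparableSpace Y] [SigmaCompactSpace Y]
    [TopologicalSpace Z] (hZ : IsAnalyticSpace Z) (hZ0 : DimLE Z 0) :
    ∀ τ : TopologicalSpace (Cl (Y × Z)), IsAdmissible (Y × Z) τ →
      @MeasureTheory.AnalyticSet _ τ ((F0 (Y × Z))ᶜ) := by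
  intro τ hτ
  obtain ⟨hZm, hZs, hZa⟩ := hZ
  have : SecondCountableTopology Y := by
    let := metrizableSpaceMetric Y
    exact UniformSpace.secondCountable_of_separable Y
  have : SecondCountableTopology Z := by
    let := metrizableSpaceMetric Z
    exact UniformSpace.secondCountable_of_separable Z
  rcases hZa with hZe | ⟨g, hg, hgs⟩
  · have : (F0 (Y × Z))ᶜ = ∅ := by
      refine eq_empty_of_forall_notMem fun F hF => hF ?_
      exact dimLE_zero_of_fibers hZ0 F.2 fun _ z => isEmptyElim z
    rw [this]
    exact analyticSet_empty
  have hKc : ∀ n, CompactSpace (compactCovering Y n) := fun n =>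
    isCompact_iff_compactSpace.1 (isCompact_compactCovering Y n)
  have hKp : ∀ n, PolishSpace (compactCovering Y n) := fun n => by
    let := metrizableSpaceMetric (compactCovering Y n)
    infer_instance
  have hKs : PolishSpace (Σ m, compactCovering Y m) := {}
  have hPp : ∀ n, PolishSpace (SequenceCodes Y n) := fun n => {}
  let w : ∀ n, SequenceCodes Y n → ℕ ⊕ ℕ → Y × Z := fun n p =>
    Sum.elim (fun k => ((p.1 k : Y), g p.2.2)) fun k => (((p.2.1 k).1.2 : Y), g (p.2.1 k).2)
  have hval : Continuous fun y : (Σ m, compactCovering Y m) => (y.2 : Y) :=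
    continuous_sigma fun m => continuous_subtype_val
  have hw : ∀ n i, Continuous fun p => w n p i := by
    rintro n (k | k)
    · exact Continuous.prodMk (by fun_prop) (hg.comp (by fun_prop))
    · exact Continuous.prodMk (hval.comp (by fun_prop)) (hg.comp (by fun_prop))
  let s : ∀ n, Set (SequenceCodes Y n) := fun n =>
    {p | IsPreconnected (closure (range p.1))} ∩ ⋃ i, ⋃ j, {p | p.1 i ≠ p.1 j}
  let : ∀ n, MeasurableSpace (SequenceCodes Y n) := fun n => borel _
  have : ∀ n, BorelSpace (SequenceCodes Y n) := fun n => ⟨rfl⟩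
  have hs : ∀ n, MeasurableSet (s n) := by
    intro n
    have hc : ∀ i, Continuous fun p : SequenceCodes Y n => p.1 i := fun i => by fun_prop
    refine (measurableSet_isPreconnected_closure_range hc).inter ?_
    exact (isOpen_iUnion fun i => isOpen_iUnion fun j =>
      isOpen_ne_fun (hc i) (hc j)).measurableSet
  have heq : (F0 (Y × Z))ᶜ = ⋃ n,
      (fun p => (⟨closure (range (w n p)), isClosed_closure⟩ : Cl (Y × Z))) '' s n := by
    ext F
    rw [mem_iUnion]
    constructor
    · intro hF
      by_contra hcon
      refine hF (dimLE_zero_of_fibers hZ0 F.2 fun n z t ht htF => ?_)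
      by_contra htn
      rw [not_subsingleton_iff] at htn
      obtain ⟨c, hct, htc⟩ := exists_seq_subset_closure_range htn.nonempty
      obtain ⟨y₀, hy₀⟩ := htn.nonempty
      obtain ⟨x, hxF, hFx⟩ := exists_seq_subset_closure_range ⟨_, htF y₀ hy₀⟩
      obtain ⟨ζ, rfl⟩ := hgs z
      choose m hm using fun k => exists_mem_compactCovering (x k).1
      choose ξ hξ using fun k => hgs (x k).2
      refine hcon ⟨n, (c, (fun k => (⟨m k, (x k).1, hm k⟩, ξ k)), ζ), ⟨?_, ?_⟩, ?_⟩
      · have : closure (range c) = closure t := Subset.antisymm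
          (closure_mono (range_subset_iff.2 hct)) (closure_minimal htc isClosed_closure)
        rw [mem_ofPred_eq, this]
        exact ht.closure
      · by_contra hne
        simp only [mem_iUnion, mem_ofPred_eq, not_exists, not_not] at hne
        have hsub : (range c).Subsingleton := by
          rintro _ ⟨i, rfl⟩ _ ⟨j, rfl⟩
          exact hne i j
        exact htn.not_subsingleton (hsub.closure.anti htc)
      · refine Subtype.ext (Subset.antisymm (closure_minimal ?_ F.2) ?_)
        · rintro _ ⟨k | k, rfl⟩
          · exact htF _ (hct k)
          · simpa [w, hξ] using hxF k
        · refine hFx.trans (closure_mono ?_)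
          rintro _ ⟨k, rfl⟩
          exact ⟨Sum.inr k, by simp [w, hξ]⟩
    · rintro ⟨n, p, ⟨hpre, hne⟩, rfl⟩ hF
      simp only [mem_iUnion, mem_ofPred_eq] at hne
      obtain ⟨i, j, hij⟩ := hne
      let φ : compactCovering Y n → Y × Z := fun y => ((y : Y), g p.2.2)
      have hφ : Continuous φ := by fun_prop
      have hsub : φ '' closure (range p.1) ⊆ closure (range (w n p)) := by
        refine (image_closure_subset_closure_image hφ).trans (closure_mono ?_)
        rintro _ ⟨_, ⟨k, rfl⟩, rfl⟩
        exact ⟨Sum.inl k, rfl⟩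
      have hpre' : IsPreconnected
          (Subtype.val ⁻¹' (φ '' closure (range p.1)) : Set (closure (range (w n p)))) := by
        rw [← IsInducing.subtypeVal.isPreconnected_image, image_preimage_eq_of_subset]
        · exact hpre.image _ hφ.continuousOn
        · simpa using hsub
      have hmem : ∀ k, φ (p.1 k) ∈ φ '' closure (range p.1) := fun k =>
        ⟨_, subset_closure (mem_range_self k), rfl⟩
      have hF' : DimLE (closure (range (w n p))) 0 := hF
      have := hF'.subsingleton_of_isPreconnected hpre'
        (x := ⟨φ (p.1 i), hsub (hmem i)⟩) (hmem i) (y := ⟨φ (p.1 j), hsub (hmem j)⟩) (hmem j)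
      exact hij (Subtype.ext (congrArg Prod.fst (congrArg Subtype.val this)))
  rw [heq]
  exact AnalyticSet.iUnion fun n => hτ.analyticSet_image_closure_range (hw n) (hs n)
end

section
/- If X = Y × Z is the product of a non-zero-dimensional analytic space Y and a zero-dimensional non-σ-compact analytic space Z, then F₀(X) is Π¹₁-hard. -/
open Set Filter Topology TopologicalSpace

/-- A discrete space has dimension at most `0`. -/
theorem DimLE.of_discrete (X : Type*) [TopologicalSpace X] [DiscreteTopology X] : DimLE X 0 := by
  intro k U _ hcov
  have hx : ∀ x, ∃ i, x ∈ U i := fun x => by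
    have : x ∈ ⋃ i, U i := hcov ▸ mem_univ x
    simpa using this
  choose c hc using hx
  refine ⟨fun i => c ⁻¹' {i}, fun i => isOpen_discrete _, ?_, ?_, ?_⟩
  · rintro i x rfl
    exact hc x
  · ext x
    simp
  · intro x
    have : {i | x ∈ c ⁻¹' {i}} = {c x} := by
      ext i
      simp [eq_comm]
    rw [this, ncard_singleton]

/-- The dimension of a retract is at most the dimension of the whole space. -/
theorem DimLE.of_retract {X Y : Type*} [TopologicalSpace X] [TopologicalSpace Y] {n : ℕ}
    (h : DimLE X n) {i : Y → X} {r : X → Y} (hi : Continuous i) (hr : Continuous r)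
    (hri : ∀ y, r (i y) = y) : DimLE Y n := by
  intro k U hU hcov
  obtain ⟨V, hVo, hVU, hVc, hVn⟩ := h k (fun j => r ⁻¹' U j) (fun j => (hU j).preimage hr)
    (by rw [← preimage_iUnion, hcov, preimage_univ])
  refine ⟨fun j => i ⁻¹' V j, fun j => (hVo j).preimage hi, fun j y hy => ?_, ?_,
    fun y => hVn (i y)⟩
  · simpa [hri] using hVU j hy
  · rw [← preimage_iUnion, hVc, preimage_univ]

/-- A nonempty set all of whose nonempty relatively open subsets have images with non-compact
closure. -/
def Fat {W Z : Type*} [TopologicalSpace W] [TopologicalSpace Z] (f : W → Z) (V : Set W) : Prop :=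
  V.Nonempty ∧ ∀ O, IsOpen O → (V ∩ O).Nonempty → ¬ IsCompact (closure (f '' (V ∩ O)))

theorem Fat.inter {W Z : Type*} [TopologicalSpace W] [TopologicalSpace Z] {f : W → Z} {V O : Set W}
    (h : Fat f V) (hO : IsOpen O) (hne : (V ∩ O).Nonempty) : Fat f (V ∩ O) := by
  refine ⟨hne, fun O' hO' hne' => ?_⟩
  rw [inter_assoc] at hne' ⊢
  exact h.2 _ (hO.inter hO') hne'

theorem exists_fat {W Z : Type*} [TopologicalSpace W] [SecondCountableTopology W]
    [TopologicalSpace Z] {f : W → Z} (hsurj : Function.Surjective f)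
    (hZ : ¬ SigmaCompactSpace Z) : ∃ V, Fat f V := by
  set N : Set W := {x | ∀ U ∈ 𝓝 x, ∀ K, IsSigmaCompact K → ¬ f '' U ⊆ K} with hN
  have hNc : ∃ K, IsSigmaCompact K ∧ f '' Nᶜ ⊆ K := by
    have hx : ∀ x : W, ∃ U ∈ 𝓝 x, ∃ K, IsSigmaCompact K ∧ (x ∈ Nᶜ → f '' U ⊆ K) := by
      intro x
      by_cases hx : x ∈ N
      · exact ⟨univ, univ_mem, ∅, isSigmaCompact_empty, fun h => absurd hx h⟩
      · simp only [hN, mem_ofPred_eq] at hx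
        push Not at hx
        obtain ⟨U, hU, K, hK, h⟩ := hx
        exact ⟨U, hU, K, hK, fun _ => h⟩
    choose U hU K hK hUK using hx
    obtain ⟨t, htN, htc, htcov⟩ := TopologicalSpace.countable_cover_nhdsWithin (s := Nᶜ)
      (f := U) (fun x _ => mem_nhdsWithin_of_mem_nhds (hU x))
    refine ⟨⋃ x ∈ t, K x, isSigmaCompact_biUnion htc fun x _ => hK x, ?_⟩
    rintro _ ⟨w, hw, rfl⟩
    obtain ⟨x, hxt, hwx⟩ := mem_iUnion₂.1 (htcov hw)
    exact mem_iUnion₂.2 ⟨x, hxt, hUK x (htN hxt) ⟨w, hwx, rfl⟩⟩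
  obtain ⟨K, hK, hNK⟩ := hNc
  refine ⟨N, ?_, ?_⟩
  · by_contra hne
    rw [not_nonempty_iff_eq_empty] at hne
    rw [hne, compl_empty, image_univ, hsurj.range_eq, univ_subset_iff] at hNK
    exact hZ (isSigmaCompact_univ_iff.1 (hNK ▸ hK))
  · rintro O hO ⟨x, hxN, hxO⟩ hcomp
    refine hxN O (hO.mem_nhds hxO) (⋃ b : Bool, cond b (closure (f '' (N ∩ O))) K)
      (isSigmaCompact_iUnion _ ?_) ?_
    · rintro (_ | _)
      · exact hK
      · exact hcomp.isSigmaCompact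
    · rintro _ ⟨w, hw, rfl⟩
      by_cases hwN : w ∈ N
      · exact mem_iUnion.2 ⟨true, subset_closure ⟨w, ⟨hwN, hw⟩, rfl⟩⟩
      · exact mem_iUnion.2 ⟨false, hNK ⟨w, hwN, rfl⟩⟩

theorem Fat.exists_locallyFinite {W Z : Type*} [TopologicalSpace W] [TopologicalSpace Z]
    [MetrizableSpace Z] {f : W → Z} (hf : Continuous f) {V : Set W} (hV : Fat f V) :
    ∃ S : ℕ → Set W, (∀ m, Fat f (S m)) ∧ (∀ m, S m ⊆ V) ∧ LocallyFinite fun m => f '' S m := by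
  let := metrizableSpaceMetric Z
  have hnc : ¬ IsSeqCompact (closure (f '' V)) := by
    rw [← isCompact_iff_isSeqCompact]
    simpa using hV.2 univ isOpen_univ (by simpa using hV.1)
  simp only [IsSeqCompact] at hnc
  push Not at hnc
  obtain ⟨u, hu, hlim⟩ := hnc
  have hpos : ∀ m : ℕ, (0 : ℝ) < 1 / (m + 1) := fun m => Nat.one_div_pos_of_nat
  refine ⟨fun m => V ∩ f ⁻¹' Metric.ball (u m) (1 / (m + 1)), fun m => ?_,
    fun m => inter_subset_left, fun z => ?_⟩
  · refine hV.inter (Metric.isOpen_ball.preimage hf) ?_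
    obtain ⟨_, ⟨w, hw, rfl⟩, hd⟩ := Metric.mem_closure_iff.1 (hu m) _ (hpos m)
    exact ⟨w, hw, by rwa [mem_preimage, Metric.mem_ball, dist_comm]⟩
  · have hcl : ¬ MapClusterPt z atTop u := fun h => by
      obtain ⟨ψ, hψ, ht⟩ := MapClusterPt.tendsto_subseq h
      exact hlim z (isClosed_closure.mem_of_tendsto ht (.of_forall fun n => hu _)) ψ hψ ht
    rw [Metric.nhds_basis_ball.mapClusterPt_iff_frequently] at hcl
    push Not at hcl
    obtain ⟨r, hr, hfr⟩ := hcl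
    obtain ⟨m₁, h₁⟩ := eventually_atTop.1 hfr
    obtain ⟨m₂, h₂⟩ := exists_nat_one_div_lt (half_pos hr)
    refine ⟨Metric.ball z (r / 2), Metric.ball_mem_nhds _ (half_pos hr),
      (finite_lt_nat (max m₁ m₂)).subset ?_⟩
    rintro m ⟨_, ⟨w, ⟨_, hw⟩, rfl⟩, hwz⟩
    by_contra hm
    simp only [mem_ofPred_eq, not_lt, max_le_iff] at hm
    refine h₁ m hm.1 ?_
    have h3 : (1 : ℝ) / (m + 1) ≤ 1 / (m₂ + 1) := Nat.one_div_le_one_div hm.2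
    rw [mem_preimage, Metric.mem_ball, dist_comm] at hw
    rw [Metric.mem_ball] at hwz ⊢
    linarith [dist_triangle (u m) (f w) z]

theorem Fat.exists_net {Y Z K : Type*} [TopologicalSpace Y] [TopologicalSpace Z]
    [PseudoMetricSpace K] [CompactSpace K] {f : (ℕ → ℕ) → Z} (hf : Continuous f)
    {e : Y × Z → K} (he : Continuous e) (E : ℕ → Y) (V : {V // Fat f V}) (n : ℕ) :
    ∃ (V' : {V // Fat f V}) (x : ℕ → ℕ) (D : Set Y), V'.1 ⊆ V.1 ∧ x ∈ V'.1 ∧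
      (∀ v ∈ V'.1, ∀ i < n, v i = x i) ∧ D.Finite ∧ (∀ i ≤ n, E i ∈ D) ∧
      ∀ w ∈ V'.1, ∀ y, ∃ d ∈ D, dist (e (y, f w)) (e (d, f x)) < 1 / (n + 1) := by
  classical
  obtain ⟨V, hV⟩ := V
  have hε : (0 : ℝ) < 1 / (n + 1) / 2 := half_pos Nat.one_div_pos_of_nat
  obtain ⟨t, -, htf, ht⟩ := (isCompact_univ (X := K)).finite_cover_balls hε
  set S : (ℕ → ℕ) → Set K := fun w => {j ∈ t | ∃ y, dist (e (y, f w)) j < 1 / (n + 1) / 2}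
  have hfin : (S '' V).Finite :=
    htf.finite_subsets.subset (by rintro _ ⟨w, -, rfl⟩; exact fun j hj => hj.1)
  obtain ⟨_, ⟨⟨x, hx, rfl⟩, hmax⟩⟩ := hfin.exists_maximal (hV.1.image S)
  have hy : ∀ j : S x, ∃ y, dist (e (y, f x)) j < 1 / (n + 1) / 2 := fun j => j.2.2
  choose y hy using hy
  have : Finite (S x) := (htf.subset fun j hj => hj.1).to_subtype
  set O : Set (ℕ → ℕ) := (⋂ j : S x, {w | dist (e (y j, f w)) j < 1 / (n + 1) / 2}) ∩
    ⋂ i : Fin n, {w | w i = x i}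
  have hO : IsOpen O := by
    refine (isOpen_iInter_of_finite fun j => isOpen_lt (by fun_prop) continuous_const).inter
      (isOpen_iInter_of_finite fun i => ?_)
    exact (isOpen_discrete {x (i : ℕ)}).preimage (f := fun w : ℕ → ℕ => w i) (continuous_apply _)
  have hxO : x ∈ O := ⟨mem_iInter.2 hy, mem_iInter.2 fun i => rfl⟩
  refine ⟨⟨V ∩ O, hV.inter hO ⟨x, hx, hxO⟩⟩, x, range y ∪ E '' Iic n, inter_subset_left,
    ⟨hx, hxO⟩, fun v hv i hi => mem_iInter.1 hv.2.2 ⟨i, hi⟩,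
    (finite_range y).union ((finite_Iic n).image E), fun i hi => .inr ⟨i, hi, rfl⟩, ?_⟩
  intro w hw y₀
  obtain ⟨j, hjt, hj⟩ := mem_iUnion₂.1 (ht (mem_univ (e (y₀, f w))))
  have hle : S x ⊆ S w := fun k hk => ⟨hk.1, y ⟨k, hk⟩, mem_iInter.1 hw.2.1 ⟨k, hk⟩⟩
  have hjx : j ∈ S x := hmax ⟨w, hw.1, rfl⟩ hle ⟨hjt, y₀, hj⟩
  refine ⟨y ⟨j, hjx⟩, .inl ⟨_, rfl⟩, ?_⟩
  rw [Metric.mem_ball] at hj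
  linarith [hy ⟨j, hjx⟩, dist_triangle_right (e (y₀, f w)) (e (y ⟨j, hjx⟩, f x)) j]

/-- A tree of subsets `V s` of Baire space with points `x s ∈ V s` and finite subsets `D s` of `Y`;
the node `m :: s` is the `m`-th child of `s`. -/
structure Scheme {Y Z K : Type*} [TopologicalSpace Z] [PseudoMetricSpace K]
    (f : (ℕ → ℕ) → Z) (e : Y × Z → K) (E : ℕ → Y) where
  V : List ℕ → Set (ℕ → ℕ)
  x : List ℕ → ℕ → ℕ
  D : List ℕ → Set Y
  mem : ∀ s, x s ∈ V s
  cons_subset : ∀ m s, V (m :: s) ⊆ V s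
  locallyFinite : ∀ s, LocallyFinite fun m => f '' V (m :: s)
  agree : ∀ s, ∀ v ∈ V s, ∀ i < s.length, v i = x s i
  finite : ∀ s, (D s).Finite
  dense_mem : ∀ s, ∀ i ≤ s.length, E i ∈ D s
  net : ∀ s, ∀ w ∈ V s, ∀ y, ∃ d ∈ D s,
    dist (e (y, f w)) (e (d, f (x s))) < 1 / ((Encodable.encode s : ℝ) + 1)

theorem Scheme.exists {Y Z K : Type*} [TopologicalSpace Y] [TopologicalSpace Z]
    [MetrizableSpace Z] [PseudoMetricSpace K] [CompactSpace K] {f : (ℕ → ℕ) → Z}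
    (hf : Continuous f) (hsurj : Function.Surjective f) (hZ : ¬ SigmaCompactSpace Z)
    {e : Y × Z → K} (he : Continuous e) (E : ℕ → Y) : Nonempty (Scheme f e E) := by
  obtain ⟨V₀, hV₀⟩ := exists_fat hsurj hZ
  choose A x D hA hx hagree hD hE hnet using Fat.exists_net hf he E
  choose B hBfat hB hlf using fun V : {V // Fat f V} => V.2.exists_locallyFinite hf
  let n : List ℕ → ℕ := fun s => s.length + Encodable.encode s
  let W : List ℕ → {V // Fat f V} := fun s =>
    List.rec ⟨V₀, hV₀⟩ (fun m t V => ⟨B (A V (n t)) m, hBfat _ _⟩) s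
  refine ⟨⟨fun s => (A (W s) (n s)).1, fun s => x (W s) (n s), fun s => D (W s) (n s),
    fun s => hx _ _, fun m s => (hA _ _).trans (hB _ _), fun s => ?_, fun s v hv i hi => ?_,
    fun s => hD _ _, fun s i hi => hE _ _ _ (hi.trans (Nat.le_add_right _ _)),
    fun s w hw y => ?_⟩⟩
  · exact (hlf (A (W s) (n s))).subset fun m => image_mono (hA _ _)
  · exact hagree _ _ v hv i (hi.trans_le (Nat.le_add_right _ _))
  · obtain ⟨d, hd, h⟩ := hnet _ _ w hw y
    exact ⟨d, hd, h.trans_le (Nat.one_div_le_one_div (Nat.le_add_left _ _))⟩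

/-- The first `n` values of a sequence, in reverse order. -/
def revInit (β : ℕ → ℕ) : ℕ → List ℕ
  | 0 => []
  | n + 1 => β n :: revInit β n

@[simp] theorem length_revInit (β : ℕ → ℕ) (n : ℕ) : (revInit β n).length = n := by
  induction n with
  | zero => rfl
  | succ n ih => simp [revInit, ih]

theorem revInit_eq_iff {β γ : ℕ → ℕ} {n : ℕ} :
    revInit β n = revInit γ n ↔ ∀ i < n, β i = γ i := by
  induction n with
  | zero => simp [revInit]
  | succ n ih => rw [revInit, revInit, List.cons.injEq, ih, Nat.forall_lt_succ_right, and_comm]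

/-- The tree of attempts to find a preimage of `α` under `g`. -/
def PreimageTree (g : (ℕ → ℕ) → ℕ → Bool) (α : ℕ → Bool) (s : List ℕ) : Prop :=
  ∃ x, revInit x s.length = s ∧ ∀ i < s.length, g x i = α i

section PreimageTree

variable {g : (ℕ → ℕ) → ℕ → Bool} {α : ℕ → Bool}

theorem PreimageTree.nil : PreimageTree g α [] := ⟨0, rfl, by simp⟩

theorem PreimageTree.tail {s : List ℕ} (h : PreimageTree g α s) : PreimageTree g α s.tail := by
  cases s with
  | nil => exact h
  | cons m s =>
    obtain ⟨x, hx, hg⟩ := h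
    simp only [List.length_cons, revInit, List.cons.injEq] at hx
    exact ⟨x, hx.2, fun i hi => hg i (by simp at hi ⊢; lia)⟩

theorem PreimageTree.of_suffix {s t : List ℕ} (hst : s <:+ t) (h : PreimageTree g α t) :
    PreimageTree g α s := by
  induction t with
  | nil => rwa [List.suffix_nil.1 hst]
  | cons m t ih =>
    rcases List.suffix_cons_iff.1 hst with rfl | hst
    · exact h
    · exact ih hst h.tail

theorem eventually_preimageTree_iff (s : List ℕ) :
    ∀ᶠ α' in 𝓝 α, (PreimageTree g α' s ↔ PreimageTree g α s) := by
  have : ∀ᶠ α' in 𝓝 α, ∀ i ∈ Iio s.length, α' i = α i :=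
    (eventually_all_finite (finite_Iio _)).2 fun i _ =>
      (continuous_apply i).continuousAt.eventually
        (show ∀ᶠ b in 𝓝 (α i), b = α i from (isOpen_discrete {α i}).mem_nhds rfl)
  filter_upwards [this] with α' h
  simp only [PreimageTree]
  refine exists_congr fun x => and_congr_right fun _ => forall₂_congr fun i hi => ?_
  rw [h i hi]

theorem PreimageTree.eq_of_branch (hg : Continuous g) {β : ℕ → ℕ}
    (h : ∀ n, PreimageTree g α (revInit β n)) : g β = α := by
  choose x hx hgx using h
  simp only [length_revInit] at hx hgx
  have hlim : Tendsto x atTop (𝓝 β) := tendsto_pi_nhds.2 fun i =>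
    tendsto_const_nhds.congr' <| (eventually_gt_atTop i).mono fun n hn =>
      (revInit_eq_iff.1 (hx n) i hn).symm
  refine tendsto_nhds_unique ((hg.tendsto β).comp hlim) (tendsto_pi_nhds.2 fun i => ?_)
  exact tendsto_const_nhds.congr' <| (eventually_gt_atTop i).mono fun n hn => (hgx n i hn).symm

theorem preimageTree_revInit {β : ℕ → ℕ} (h : g β = α) (n : ℕ) :
    PreimageTree g α (revInit β n) :=
  ⟨β, by simp, fun i _ => by rw [h]⟩

/-- A node whose parent lies in the tree of `α'` has an ancestor whose parent lies in the tree
of `α`, and which witnesses a difference of the two trees if it is a proper ancestor. -/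
theorem PreimageTree.exists_suffix {α' : ℕ → Bool} (v : List ℕ) (h : PreimageTree g α' v.tail) :
    ∃ s, s <:+ v ∧ PreimageTree g α s.tail ∧
      (s = v ∨ (PreimageTree g α' s ∧ ¬ PreimageTree g α s)) := by
  induction v with
  | nil => exact ⟨[], List.suffix_rfl, .nil, .inl rfl⟩
  | cons m t ih =>
    by_cases ht : PreimageTree g α t
    · exact ⟨m :: t, List.suffix_rfl, ht, .inl rfl⟩
    · obtain ⟨s, hst, hs, h'⟩ := ih (PreimageTree.tail h)
      refine ⟨s, hst.trans (List.suffix_cons m t), hs, .inr ?_⟩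
      rcases h' with rfl | h'
      · exact ⟨h, ht⟩
      · exact h'

end PreimageTree

namespace Scheme

variable {Y Z K : Type*} [TopologicalSpace Z] [PseudoMetricSpace K]
  {f : (ℕ → ℕ) → Z} {e : Y × Z → K} {E : ℕ → Y} (S : Scheme f e E)
  {g : (ℕ → ℕ) → ℕ → Bool} {α : ℕ → Bool}

theorem subset_of_suffix {s t : List ℕ} (h : s <:+ t) : S.V t ⊆ S.V s := by
  induction t with
  | nil => rw [List.suffix_nil.1 h]
  | cons m t ih =>
    rcases List.suffix_cons_iff.1 h with rfl | h
    · exact subset_rfl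
    · exact (S.cons_subset m t).trans (ih h)

/-- The points of `Y × Z` attached to the nodes whose parent lies in the tree of `α`. -/
def points (g : (ℕ → ℕ) → ℕ → Bool) (α : ℕ → Bool) : Set (Y × Z) :=
  {p | ∃ s, PreimageTree g α s.tail ∧ p.1 ∈ S.D s ∧ p.2 = f (S.x s)}

theorem exists_nhds_finite (hg : Continuous g) (hα : ∀ β, g β ≠ α) (z : Z) :
    ∃ N ∈ 𝓝 z, {s | PreimageTree g α s.tail ∧ f (S.x s) ∈ N}.Finite := by
  set bad : List ℕ → Prop := fun s =>
    ∀ N ∈ 𝓝 z, {v | s <:+ v ∧ PreimageTree g α v.tail ∧ f (S.x v) ∈ N}.Infinite with hbad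
  have hstep : ∀ s, bad s → ∃ m, bad (m :: s) := by
    intro s hs
    by_contra! hc
    simp only [hbad, not_forall, exists_prop, not_infinite] at hc
    choose N hN hfin using hc
    obtain ⟨N₀, hN₀, hfin₀⟩ := S.locallyFinite s z
    refine hs (N₀ ∩ ⋂ m ∈ {m | (f '' S.V (m :: s) ∩ N₀).Nonempty}, N m)
      (inter_mem hN₀ ((biInter_mem hfin₀).2 fun m _ => hN m)) ?_
    refine ((finite_singleton s).union (hfin₀.biUnion fun m _ => hfin m)).subset ?_
    rintro v ⟨hsv, hv, hvN₀, hvN⟩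
    obtain ⟨l, rfl⟩ := hsv
    rcases l.eq_nil_or_concat' with rfl | ⟨l, m, rfl⟩
    · exact .inl rfl
    · have hsuf : m :: s <:+ l ++ [m] ++ s := ⟨l, by simp⟩
      have hm : m ∈ {m | (f '' S.V (m :: s) ∩ N₀).Nonempty} :=
        ⟨_, ⟨_, S.subset_of_suffix hsuf (S.mem _), rfl⟩, hvN₀⟩
      exact .inr (mem_iUnion₂.2 ⟨m, hm, hsuf, hv, mem_iInter₂.1 hvN m hm⟩)
  have htree : ∀ s, bad s → PreimageTree g α s := by
    intro s hs
    obtain ⟨v, ⟨hsv, hv, -⟩, hne⟩ := (hs univ univ_mem).exists_notMem_finite (finite_singleton s)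
    cases v with
    | nil => exact absurd (List.suffix_nil.1 hsv).symm hne
    | cons m v =>
      rcases List.suffix_cons_iff.1 hsv with h | h
      · exact absurd h.symm hne
      · exact PreimageTree.of_suffix h hv
  by_contra! hc
  have hnil : bad [] := fun N hN => by simpa using hc N hN
  choose! next hnext using hstep
  let node : ℕ → List ℕ := fun n => Nat.rec [] (fun _ t => next t :: t) n
  have hnode : ∀ n, bad (node n) := fun n => by
    induction n with
    | zero => exact hnil
    | succ n ih => exact hnext _ ih
  have hrev : ∀ n, revInit (fun n => next (node n)) n = node n := fun n => by
    induction n with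
    | zero => rfl
    | succ n ih => rw [revInit, ih]
  exact hα _ (PreimageTree.eq_of_branch hg fun n => (hrev n).symm ▸ htree _ (hnode n))

theorem eventually_image_points_subset_thickening {ε : ℝ} (hε : 0 < ε) :
    ∀ᶠ α' in 𝓝 α, e '' S.points g α' ⊆ Metric.thickening ε (e '' S.points g α) := by
  obtain ⟨n, hn⟩ := exists_nat_one_div_lt hε
  have hfin : {s : List ℕ | Encodable.encode s < n}.Finite :=
    (finite_lt_nat n).preimage Encodable.encode_injective.injOn
  filter_upwards [(eventually_all_finite hfin).2 fun s _ => eventually_preimageTree_iff s]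
    with α' hα'
  rintro _ ⟨⟨y, _⟩, ⟨v, hv, hy, rfl⟩, rfl⟩
  obtain ⟨s, hsv, hs, rfl | ⟨h₁, h₂⟩⟩ := hv.exists_suffix (α := α)
  · exact Metric.self_subset_thickening hε _ ⟨_, ⟨s, hs, hy, rfl⟩, rfl⟩
  · have hns : n ≤ Encodable.encode s := by
      by_contra! hlt
      exact h₂ ((hα' s hlt).1 h₁)
    obtain ⟨d, hd, hdist⟩ := S.net s _ (S.subset_of_suffix hsv (S.mem v)) y
    exact Metric.mem_thickening_iff.2 ⟨_, ⟨(d, f (S.x s)), ⟨s, hs, hd, rfl⟩, rfl⟩,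
      (hdist.trans_le (Nat.one_div_le_one_div hns)).trans hn⟩

variable [TopologicalSpace Y]

theorem isClosed_of_subset_points [T1Space Y] [T1Space Z] (hg : Continuous g)
    (hα : ∀ β, g β ≠ α) {A : Set (Y × Z)} (hA : A ⊆ S.points g α) : IsClosed A := by
  set F : List ℕ → Set (Y × Z) := fun s =>
    {p ∈ A | PreimageTree g α s.tail ∧ p.1 ∈ S.D s ∧ p.2 = f (S.x s)}
  have hAF : A = ⋃ s, F s := by
    ext p
    refine ⟨fun hp => ?_, fun hp => ?_⟩
    · obtain ⟨s, hs⟩ := hA hp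
      exact mem_iUnion.2 ⟨s, hp, hs⟩
    · obtain ⟨s, hs⟩ := mem_iUnion.1 hp
      exact hs.1
  rw [hAF]
  refine LocallyFinite.isClosed_iUnion (fun p => ?_) fun s => ?_
  · obtain ⟨N, hN, hfin⟩ := S.exists_nhds_finite hg hα p.2
    refine ⟨Prod.snd ⁻¹' N, continuous_snd.continuousAt hN, hfin.subset ?_⟩
    rintro s ⟨q, ⟨-, hs, -, hq⟩, hqN⟩
    exact ⟨hs, hq ▸ hqN⟩
  · refine (((S.finite s).prod (finite_singleton (f (S.x s)))).subset ?_).isClosed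
    rintro p ⟨-, -, h⟩
    exact h

theorem dimLE_closure_points [T1Space Y] [T1Space Z] (hg : Continuous g) (hα : ∀ β, g β ≠ α) :
    DimLE (closure (S.points g α)) 0 := by
  rw [(S.isClosed_of_subset_points hg hα subset_rfl).closure_eq]
  have : DiscreteTopology (S.points g α) := discreteTopology_iff_forall_isClosed.2 fun A =>
    isClosed_induced_iff.2 ⟨Subtype.val '' A,
      S.isClosed_of_subset_points hg hα (by rintro _ ⟨p, -, rfl⟩; exact p.2),
      preimage_image_eq _ Subtype.val_injective⟩
  exact .of_discrete _

theorem exists_slice_subset_closure (hf : Continuous f) (hE : DenseRange E) {β : ℕ → ℕ}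
    (hβ : g β = α) : ∃ z, ∀ y, (y, z) ∈ closure (S.points g α) := by
  set w : ℕ → ℕ := fun i => S.x (revInit β (i + 1)) i
  have hsuf : ∀ {m n}, m ≤ n → revInit β m <:+ revInit β n := fun {m n} h => by
    induction n, h using Nat.le_induction with
    | base => exact List.suffix_rfl
    | succ n _ ih => exact ih.trans (List.suffix_cons _ _)
  have hlim : Tendsto (fun n => S.x (revInit β n)) atTop (𝓝 w) := tendsto_pi_nhds.2 fun i =>
    tendsto_const_nhds.congr' <| (eventually_gt_atTop i).mono fun n hn =>
      (S.agree (revInit β (i + 1)) _ (S.subset_of_suffix (hsuf hn) (S.mem _)) i (by simp)).symm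
  have hflim := (hf.tendsto w).comp hlim
  refine ⟨f w, fun y => ?_⟩
  have hclosed : IsClosed {y | (y, f w) ∈ closure (S.points g α)} :=
    isClosed_closure.preimage (by fun_prop)
  have hmem : ∀ i, E i ∈ {y | (y, f w) ∈ closure (S.points g α)} := fun i =>
    mem_closure_of_tendsto (tendsto_const_nhds.prodMk_nhds hflim) <|
      (eventually_ge_atTop i).mono fun n hn =>
        ⟨revInit β n, (preimageTree_revInit hβ n).tail, S.dense_mem _ i (by simpa using hn), rfl⟩
  exact hclosed.closure_subset_iff.2 (range_subset_iff.2 hmem) (hE y)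

theorem dimLE_of_closure_points (hf : Continuous f) (hE : DenseRange E) {β : ℕ → ℕ}
    (hβ : g β = α) (h : DimLE (closure (S.points g α)) 0) : DimLE Y 0 := by
  obtain ⟨z, hz⟩ := S.exists_slice_subset_closure hf hE hβ
  exact h.of_retract (i := fun y => ⟨(y, z), hz y⟩) (r := fun p => p.1.1) (by fun_prop)
    (by fun_prop) fun _ => rfl

theorem continuous_closure_points [CompactSpace K] (he : Continuous e) :
    Continuous[_, vietoris K] fun α => closure (e '' closure (S.points g α)) := by
  simp only [closure_image_closure he]
  refine continuous_generateFrom_iff.2 ?_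
  rintro _ (⟨U, hU, rfl⟩ | ⟨U, hU, rfl⟩)
  · refine isOpen_iff_eventually.2 fun α (hα : closure _ ⊆ U) => ?_
    obtain ⟨ε, hε, hεU⟩ := isClosed_closure.isCompact.exists_thickening_subset_open hU hα
    rw [Metric.thickening_closure] at hεU
    filter_upwards [S.eventually_image_points_subset_thickening (half_pos hε)] with α' hα'
    refine (closure_mono hα').trans (Subset.trans ?_ hεU)
    exact (Metric.closure_thickening_subset_cthickening _ _).trans
      (Metric.cthickening_subset_thickening' hε (half_lt_self hε) _)
  · refine isOpen_iff_eventually.2 fun α (hα : (closure _ ∩ U).Nonempty) => ?_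
    rw [closure_inter_open_nonempty_iff hU] at hα
    obtain ⟨_, ⟨p, ⟨s, hs, hp⟩, rfl⟩, hpU⟩ := hα
    filter_upwards [eventually_preimageTree_iff (g := g) (α := α) s.tail] with α' hα'
    exact ⟨e p, subset_closure ⟨p, ⟨s, hα'.2 hs, hp⟩, rfl⟩, hpU⟩

end Scheme

/-- If `X = Y × Z` is the product of a non-zero-dimensional analytic space `Y` and a
zero-dimensional non-`σ`-compact analytic space `Z`, then `F₀(X)` is `Π¹₁`-hard. -/
theorem F0_pi11_hard_of_prod {Y Z : Type*}
    [TopologicalSpace Y] (hY : IsAnalyticSpace Y) (hY0 : ¬ DimLE Y 0)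
    [TopologicalSpace Z] (hZ : IsAnalyticSpace Z) (hZ0 : DimLE Z 0)
    (hZc : ¬ SigmaCompactSpace Z) :
    ∀ τ : TopologicalSpace (Cl (Y × Z)), IsAdmissible (Y × Z) τ →
      @Pi11Hard _ τ (F0 (Y × Z)) := by
  rintro τ ⟨K, tK, hKc, hKm, e, he, rfl⟩ A' hA'
  obtain ⟨hYm, hYs, -⟩ := hY
  obtain ⟨hZm, -, hZe | ⟨f, hf, hsurj⟩⟩ := hZ
  · exact absurd (inferInstanceAs (SigmaCompactSpace Z)) hZc
  have hYne : Nonempty Y := by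
    by_contra h
    have := not_nonempty_iff.1 h
    exact hY0 (.of_discrete Y)
  rw [MeasureTheory.AnalyticSet] at hA'
  rcases hA' with hA' | ⟨g, hg, hA'⟩
  · have hempty : (⟨∅, isClosed_empty⟩ : Cl (Y × Z)) ∈ F0 (Y × Z) :=
      DimLE.of_discrete (∅ : Set (Y × Z))
    refine ⟨fun _ => ⟨∅, isClosed_empty⟩, @continuous_const _ _ _ (_) _, ?_⟩
    rw [compl_empty_iff.1 hA']
    exact (eq_univ_of_forall fun _ => hempty).symm
  let := metrizableSpaceMetric K
  obtain ⟨S⟩ := Scheme.exists hf hsurj hZc he.continuous (denseSeq Y)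
  refine ⟨fun α => ⟨closure (S.points g α), isClosed_closure⟩,
    continuous_induced_rng.2 (S.continuous_closure_points he.continuous), ?_⟩
  ext α
  have hα : α ∈ A' ↔ ∀ β, g β ≠ α := by
    rw [← notMem_compl_iff, ← hA']
    simp
  refine hα.trans ⟨fun h => S.dimLE_closure_points hg h, fun h β hβ => ?_⟩
  exact hY0 (S.dimLE_of_closure_points hf (denseRange_denseSeq Y) hβ h)
end

section
/- If X = Y × Z is the product of a σ-compact non-zero-dimensional separable metrizable space Y and an analytic zero-dimensional non-σ-compact space Z, then F₀(X) is Π¹₁-complete. (In particular F₀([0,1] × ℙ) is Π¹₁-complete, where ℙ is the space of irrational numbers.) -/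
open Set Filter Topology TopologicalSpace

/-- Large inductive dimension zero of a subset, phrased with closed sets of the ambient space:
disjoint closed sets are separated by a partition of `S` into two closed sets. -/
def Sep0 {X : Type*} [TopologicalSpace X] (S : Set X) : Prop :=
  ∀ A B : Set X, IsClosed A → IsClosed B → Disjoint A B →
    ∃ C D : Set X, IsClosed C ∧ IsClosed D ∧ Disjoint C D ∧ C ∪ D = S ∧ A ∩ S ⊆ C ∧ B ∩ S ⊆ D

theorem DimLE.sep0_univ {X : Type*} [TopologicalSpace X] (h : DimLE X 0) :
    Sep0 (univ : Set X) := by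
  intro A B hA hB hAB
  obtain ⟨V, hVo, hVU, hV, hc⟩ := h 2 ![Aᶜ, Bᶜ]
    (by intro i; fin_cases i <;> simp [hA.isOpen_compl, hB.isOpen_compl])
    (by
      rw [eq_univ_iff_forall]
      intro x
      by_cases hx : x ∈ A
      · exact mem_iUnion.2 ⟨1, fun hB' => hAB.le_bot ⟨hx, hB'⟩⟩
      · exact mem_iUnion.2 ⟨0, hx⟩)
  have h0 : V 0 ⊆ Aᶜ := hVU 0
  have h1 : V 1 ⊆ Bᶜ := hVU 1
  have hcov : ∀ x, x ∈ V 0 ∨ x ∈ V 1 := by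
    intro x
    obtain ⟨i, hi⟩ := mem_iUnion.1 (hV ▸ mem_univ x : x ∈ ⋃ i, V i)
    fin_cases i
    · exact Or.inl hi
    · exact Or.inr hi
  have hdis : ∀ x, x ∈ V 0 → x ∈ V 1 → False := by
    intro x hx0 hx1
    have := (Set.ncard_le_one (toFinite _)).1 (hc x) 0 hx0 1 hx1
    exact absurd this (by decide)
  refine ⟨(V 0)ᶜ, (V 1)ᶜ, (hVo 0).isClosed_compl, (hVo 1).isClosed_compl, ?_, ?_, ?_, ?_⟩
  · rw [Set.disjoint_left]
    intro x hx hx'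
    rcases hcov x with h | h
    · exact hx h
    · exact hx' h
  · rw [eq_univ_iff_forall]
    intro x
    by_cases hx : x ∈ V 0
    · exact Or.inr fun h => hdis x hx h
    · exact Or.inl hx
  · rintro x ⟨hx, -⟩ hx0
    exact h0 hx0 hx
  · rintro x ⟨hx, -⟩ hx0
    exact h1 hx0 hx

theorem Sep0.dimLE_zero {X : Type*} [TopologicalSpace X] [NormalSpace X]
    (h : Sep0 (univ : Set X)) : DimLE X 0 := by
  intro k U hU hcov
  obtain ⟨A, hAU, hA, hAsub⟩ := exists_iUnion_eq_closed_subset hU (fun x => toFinite _) hcov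
  have hsep : ∀ i, ∃ C : Set X, IsClopen C ∧ A i ⊆ C ∧ C ⊆ U i := by
    intro i
    obtain ⟨C, D, hC, hD, hCD, hun, hAC, hBD⟩ := h (A i) (U i)ᶜ (hA i) (hU i).isClosed_compl
      (disjoint_compl_right_iff_subset.2 (hAsub i))
    have hCc : C = Dᶜ := (IsCompl.of_eq (disjoint_iff.1 hCD) hun).eq_compl
    refine ⟨C, ⟨hC, hCc ▸ hD.isOpen_compl⟩, fun x hx => hAC ⟨hx, trivial⟩, fun x hx => ?_⟩
    by_contra hxU
    exact hCD.le_bot ⟨hx, hBD ⟨hxU, trivial⟩⟩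
  choose C hCo hAC hCU using hsep
  refine ⟨fun i => C i \ ⋃ j : Fin k, ⋃ _ : j < i, C j, fun i => ?_, fun i => ?_, ?_, fun x => ?_⟩
  · refine (hCo i).2.sdiff (isClosed_iUnion_of_finite fun j =>
      isClosed_iUnion_of_finite fun _ => (hCo j).1)
  · exact fun x hx => hCU i hx.1
  · rw [eq_univ_iff_forall]
    intro x
    have hne : ({i | x ∈ C i} : Set (Fin k)).Nonempty := by
      obtain ⟨i, hi⟩ := mem_iUnion.1 (hAU ▸ mem_univ x : x ∈ ⋃ i, A i)
      exact ⟨i, hAC i hi⟩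
    obtain ⟨i, hi, hmin⟩ := WellFounded.has_min (wellFounded_lt (α := Fin k)) _ hne
    refine mem_iUnion.2 ⟨i, hi, ?_⟩
    simp only [mem_iUnion, not_exists]
    exact fun j hj hx => hmin j hx hj
  · rw [zero_add, Set.ncard_le_one (toFinite _)]
    rintro i ⟨hi, hi'⟩ j ⟨hj, hj'⟩
    simp only [mem_iUnion, not_exists] at hi' hj'
    rcases lt_trichotomy i j with h | h | h
    · exact absurd hi (hj' i h)
    · exact h
    · exact absurd hj (hi' j h)

theorem IsClosed.dimLE_zero_iff {X : Type*} [TopologicalSpace X] [NormalSpace X] {S : Set X}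
    (hS : IsClosed S) : DimLE ↥S 0 ↔ Sep0 S := by
  have hemb := hS.isClosedEmbedding_subtypeVal
  constructor
  · intro h A B hA hB hAB
    obtain ⟨C, D, hC, hD, hCD, hun, hAC, hBD⟩ := h.sep0_univ (Subtype.val ⁻¹' A)
      (Subtype.val ⁻¹' B) (hA.preimage continuous_subtype_val)
      (hB.preimage continuous_subtype_val) (hAB.preimage _)
    refine ⟨Subtype.val '' C, Subtype.val '' D, hemb.isClosedMap _ hC, hemb.isClosedMap _ hD,
      (disjoint_image_iff Subtype.val_injective).2 hCD, ?_, ?_, ?_⟩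
    · rw [← image_union, hun, image_univ, Subtype.range_coe]
    · rintro x ⟨hx, hxS⟩
      exact ⟨⟨x, hxS⟩, hAC ⟨hx, trivial⟩, rfl⟩
    · rintro x ⟨hx, hxS⟩
      exact ⟨⟨x, hxS⟩, hBD ⟨hx, trivial⟩, rfl⟩
  · intro h
    have : NormalSpace ↥S := hemb.normalSpace
    apply Sep0.dimLE_zero
    intro A B hA hB hAB
    obtain ⟨C, D, hC, hD, hCD, hun, hAC, hBD⟩ := h (Subtype.val '' A)
      (Subtype.val '' B) (hemb.isClosedMap _ hA) (hemb.isClosedMap _ hB)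
      ((disjoint_image_iff Subtype.val_injective).2 hAB)
    refine ⟨Subtype.val ⁻¹' C, Subtype.val ⁻¹' D, hC.preimage continuous_subtype_val,
      hD.preimage continuous_subtype_val, hCD.preimage _, ?_, ?_, ?_⟩
    · rw [← preimage_union, hun, Subtype.coe_preimage_self]
    · rintro x ⟨hx, -⟩
      exact hAC ⟨⟨x, hx, rfl⟩, x.2⟩
    · rintro x ⟨hx, -⟩
      exact hBD ⟨⟨x, hx, rfl⟩, x.2⟩

/-- Countable sum theorem in dimension zero. -/
theorem sep0_of_iUnion {X : Type*} [TopologicalSpace X] [NormalSpace X] {S : ℕ → Set X}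
    (hU : IsClosed (⋃ n, S n)) (h : ∀ n, Sep0 (S n)) :
    Sep0 (⋃ n, S n) := by
  intro A B hA hB hAB
  have step : ∀ n (p : {p : Set X × Set X // IsClosed p.1 ∧ IsClosed p.2 ∧ Disjoint p.1 p.2}),
      ∃ q : {p : Set X × Set X // IsClosed p.1 ∧ IsClosed p.2 ∧ Disjoint p.1 p.2},
        p.1.1 ⊆ interior q.1.1 ∧ p.1.2 ⊆ interior q.1.2 ∧
        S n ⊆ interior q.1.1 ∪ interior q.1.2 := by
    rintro n ⟨⟨A, B⟩, hA, hB, hAB⟩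
    obtain ⟨C, D, hC, hD, hCD, hun, hAC, hBD⟩ := h n A B hA hB hAB
    have hdis : Disjoint (A ∪ C) (B ∪ D) := by
      rw [Set.disjoint_left]
      rintro x (hx | hx) (hx' | hx')
      · exact hAB.le_bot ⟨hx, hx'⟩
      · exact hCD.le_bot ⟨hAC ⟨hx, hun ▸ Or.inr hx'⟩, hx'⟩
      · exact hCD.le_bot ⟨hx, hBD ⟨hx', hun ▸ Or.inl hx⟩⟩
      · exact hCD.le_bot ⟨hx, hx'⟩
    obtain ⟨U, V, hUo, hVo, hAU, hBV, hUV⟩ :=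
      normal_separation (hA.union hC) (hB.union hD) hdis
    obtain ⟨U', hU'o, hAU', hU'U⟩ := normal_exists_closure_subset (hA.union hC) hUo hAU
    obtain ⟨V', hV'o, hBV', hV'V⟩ := normal_exists_closure_subset (hB.union hD) hVo hBV
    have h1 : A ∪ C ⊆ interior (closure U') :=
      hAU'.trans (interior_maximal subset_closure hU'o)
    have h2 : B ∪ D ⊆ interior (closure V') :=
      hBV'.trans (interior_maximal subset_closure hV'o)
    refine ⟨⟨(closure U', closure V'), isClosed_closure, isClosed_closure,
      hUV.mono hU'U hV'V⟩, subset_union_left.trans h1, subset_union_left.trans h2, ?_⟩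
    rw [← hun]
    exact union_subset_union (subset_union_right.trans h1) (subset_union_right.trans h2)
  choose g hg1 hg2 hg3 using step
  let p : ℕ → {p : Set X × Set X // IsClosed p.1 ∧ IsClosed p.2 ∧ Disjoint p.1 p.2} :=
    fun n => Nat.rec ⟨(A, B), hA, hB, hAB⟩ g n
  have hp : ∀ n, p (n + 1) = g n (p n) := fun n => rfl
  have m1 : Monotone fun n => (p n).1.1 :=
    monotone_nat_of_le_succ fun n => (hg1 n (p n)).trans interior_subset
  have m2 : Monotone fun n => (p n).1.2 :=
    monotone_nat_of_le_succ fun n => (hg2 n (p n)).trans interior_subset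
  set O := ⋃ n, interior (p n).1.1
  set O' := ⋃ n, interior (p n).1.2
  have hO : IsOpen O := isOpen_iUnion fun n => isOpen_interior
  have hO' : IsOpen O' := isOpen_iUnion fun n => isOpen_interior
  have hOO : ∀ x, x ∈ O → x ∈ O' → False := by
    intro x hx hx'
    obtain ⟨n, hn⟩ := mem_iUnion.1 hx
    obtain ⟨m, hm⟩ := mem_iUnion.1 hx'
    exact (p (max n m)).2.2.2.le_bot ⟨m1 (le_max_left n m) (interior_subset hn),
      m2 (le_max_right n m) (interior_subset hm)⟩
  have hcov : ∀ x, x ∈ (⋃ n, S n) → x ∈ O ∨ x ∈ O' := by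
    intro x hx
    obtain ⟨n, hn⟩ := mem_iUnion.1 hx
    rcases hg3 n (p n) hn with h | h
    · exact Or.inl (mem_iUnion.2 ⟨n + 1, h⟩)
    · exact Or.inr (mem_iUnion.2 ⟨n + 1, h⟩)
  have hAO : A ⊆ O := fun x hx => mem_iUnion.2 ⟨1, hg1 0 (p 0) hx⟩
  have hBO : B ⊆ O' := fun x hx => mem_iUnion.2 ⟨1, hg2 0 (p 0) hx⟩
  refine ⟨(⋃ n, S n) \ O', (⋃ n, S n) \ O, hU.sdiff hO', hU.sdiff hO, ?_, ?_, ?_, ?_⟩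
  · rw [Set.disjoint_left]
    rintro x ⟨hx, h1⟩ ⟨-, h2⟩
    exact (hcov x hx).elim h2 h1
  · ext x
    constructor
    · rintro (h | h) <;> exact h.1
    · intro hx
      rcases hcov x hx with h | h
      · exact Or.inl ⟨hx, fun h' => hOO x h h'⟩
      · exact Or.inr ⟨hx, fun h' => hOO x h' h⟩
  · exact fun x hx => ⟨hx.2, fun h' => hOO x (hAO hx.1) h'⟩
  · exact fun x hx => ⟨hx.2, fun h' => hOO x h' (hBO hx.1)⟩

theorem sep0_empty {X : Type*} [TopologicalSpace X] : Sep0 (∅ : Set X) :=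
  fun _ _ _ _ _ => ⟨∅, ∅, isClosed_empty, isClosed_empty, disjoint_bot_left, by simp, by simp,
    by simp⟩

theorem sep0_singleton {X : Type*} [TopologicalSpace X] [T1Space X] (x : X) :
    Sep0 ({x} : Set X) := by
  intro A B _ _ hAB
  by_cases hx : x ∈ A
  · refine ⟨{x}, ∅, isClosed_singleton, isClosed_empty, disjoint_bot_right, by simp, by simp, ?_⟩
    rintro y ⟨hy, rfl⟩
    exact hAB.le_bot ⟨hx, hy⟩
  · refine ⟨∅, {x}, isClosed_empty, isClosed_singleton, disjoint_bot_left, by simp, ?_, by simp⟩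
    rintro y ⟨hy, rfl⟩
    exact hx hy

theorem Set.Countable.sep0 {X : Type*} [TopologicalSpace X] [T1Space X] [NormalSpace X]
    {S : Set X} (hS : S.Countable) (hc : IsClosed S) : Sep0 S := by
  rcases S.eq_empty_or_nonempty with rfl | hne
  · exact sep0_empty
  · obtain ⟨f, rfl⟩ := hS.exists_eq_range hne
    rw [← iUnion_singleton_eq_range] at hc ⊢
    exact sep0_of_iUnion hc fun n => sep0_singleton _

theorem Sep0.exists_open {X : Type*} [TopologicalSpace X] [NormalSpace X] {S A B : Set X}
    (h : Sep0 S) (hA : IsClosed A) (hB : IsClosed B) (hAB : Disjoint A B) :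
    ∃ U V : Set X, IsOpen U ∧ IsOpen V ∧ Disjoint U V ∧ S ⊆ U ∪ V ∧ A ∩ S ⊆ U ∧ B ∩ S ⊆ V := by
  obtain ⟨C, D, hC, hD, hCD, hun, hAC, hBD⟩ := h A B hA hB hAB
  obtain ⟨U, V, hU, hV, hCU, hDV, hUV⟩ := normal_separation hC hD hCD
  exact ⟨U, V, hU, hV, hUV, hun ▸ union_subset_union hCU hDV, hAC.trans hCU, hBD.trans hDV⟩

theorem IsClosed.sep0_of_exists_open {X : Type*} [TopologicalSpace X] {S : Set X}
    (hS : IsClosed S)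
    (h : ∀ A B : Set X, IsClosed A → IsClosed B → Disjoint A B → ∃ U V : Set X, IsOpen U ∧
      IsOpen V ∧ Disjoint (U ∩ S) V ∧ S ⊆ U ∪ V ∧ A ∩ S ⊆ U ∧ B ∩ S ⊆ V) : Sep0 S := by
  intro A B hA hB hAB
  obtain ⟨U, V, hU, hV, hUV, hS', hAU, hBV⟩ := h A B hA hB hAB
  refine ⟨S \ V, S \ U, hS.sdiff hV, hS.sdiff hU, ?_, ?_, ?_, ?_⟩
  · rw [Set.disjoint_left]
    rintro x ⟨hx, h1⟩ ⟨-, h2⟩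
    exact (hS' hx).elim h2 h1
  · ext x
    constructor
    · rintro (h | h) <;> exact h.1
    · intro hx
      rcases hS' hx with h | h
      · exact Or.inl ⟨hx, fun h' => hUV.le_bot ⟨⟨h, hx⟩, h'⟩⟩
      · exact Or.inr ⟨hx, fun h' => hUV.le_bot ⟨⟨h', hx⟩, h⟩⟩
  · exact fun x hx => ⟨hx.2, fun h' => hUV.le_bot ⟨⟨hAU hx, hx.2⟩, h'⟩⟩
  · exact fun x hx => ⟨hx.2, fun h' => hUV.le_bot ⟨⟨h', hx.2⟩, hBV hx⟩⟩

/-- A compact set in which distinct points are separated by partitions is zero-dimensional. -/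
theorem IsCompact.sep0 {X : Type*} [TopologicalSpace X] [T2Space X] {L : Set X}
    (hL : IsCompact L)
    (h : ∀ a ∈ L, ∀ b ∈ L, a ≠ b →
      ∃ U V : Set X, IsOpen U ∧ IsOpen V ∧ Disjoint U V ∧ L ⊆ U ∪ V ∧ a ∈ U ∧ b ∈ V) :
    Sep0 L := by
  refine hL.isClosed.sep0_of_exists_open fun A B hA hB hAB => ?_
  have key : ∃ U V : Set X, IsOpen U ∧ IsOpen V ∧ Disjoint U V ∧ L ⊆ U ∪ V ∧
      A ∩ L ⊆ U ∧ B ∩ L ⊆ V := by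
    refine IsCompact.induction_on (p := fun s => ∃ U V : Set X, IsOpen U ∧ IsOpen V ∧
      Disjoint U V ∧ L ⊆ U ∪ V ∧ s ⊆ U ∧ B ∩ L ⊆ V) (hL.inter_left hA) ?_ ?_ ?_ ?_
    · exact ⟨∅, univ, isOpen_empty, isOpen_univ, disjoint_bot_left, by simp, by simp, by simp⟩
    · rintro s t hst ⟨U, V, hU, hV, hUV, hLU, ht, hB⟩
      exact ⟨U, V, hU, hV, hUV, hLU, hst.trans ht, hB⟩
    · rintro s t ⟨U, V, hU, hV, hUV, hLU, hs, hB⟩ ⟨U', V', hU', hV', hUV', hLU', ht, hB'⟩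
      refine ⟨U ∪ U', V ∩ V', hU.union hU', hV.inter hV', ?_, ?_,
        union_subset_union hs ht, subset_inter hB hB'⟩
      · exact Disjoint.union_left (hUV.mono_right inter_subset_left)
          (hUV'.mono_right inter_subset_right)
      · intro x hx
        have h1 := hLU hx
        have h2 := hLU' hx
        simp only [mem_union, mem_inter_iff] at h1 h2 ⊢
        tauto
    · rintro a ⟨haA, haL⟩
      have key : ∃ U V : Set X, IsOpen U ∧ IsOpen V ∧ Disjoint U V ∧ L ⊆ U ∪ V ∧
          a ∈ U ∧ B ∩ L ⊆ V := by
        refine IsCompact.induction_on (p := fun s => ∃ U V : Set X, IsOpen U ∧ IsOpen V ∧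
          Disjoint U V ∧ L ⊆ U ∪ V ∧ a ∈ U ∧ s ⊆ V) (hL.inter_left hB) ?_ ?_ ?_ ?_
        · exact ⟨univ, ∅, isOpen_univ, isOpen_empty, disjoint_bot_right, by simp, by simp,
            by simp⟩
        · rintro s t hst ⟨U, V, hU, hV, hUV, hLU, ha, ht⟩
          exact ⟨U, V, hU, hV, hUV, hLU, ha, hst.trans ht⟩
        · rintro s t ⟨U, V, hU, hV, hUV, hLU, ha, hs⟩ ⟨U', V', hU', hV', hUV', hLU', ha', ht⟩
          refine ⟨U ∩ U', V ∪ V', hU.inter hU', hV.union hV', ?_, ?_,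
            ⟨ha, ha'⟩, union_subset_union hs ht⟩
          · exact Disjoint.union_right (hUV.mono_left inter_subset_left)
              (hUV'.mono_left inter_subset_right)
          · intro x hx
            have h1 := hLU hx
            have h2 := hLU' hx
            simp only [mem_union, mem_inter_iff] at h1 h2 ⊢
            tauto
        · rintro b ⟨hbB, hbL⟩
          obtain ⟨U, V, hU, hV, hUV, hLU, ha, hb⟩ := h a haL b hbL
            (fun hab => hAB.le_bot ⟨haA, hab ▸ hbB⟩)
          exact ⟨V, mem_nhdsWithin_of_mem_nhds (hV.mem_nhds hb), U, V, hU, hV, hUV, hLU, ha,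
            subset_rfl⟩
      obtain ⟨U, V, hU, hV, hUV, hLU, ha, hb⟩ := key
      exact ⟨U, mem_nhdsWithin_of_mem_nhds (hU.mem_nhds ha), U, V, hU, hV, hUV, hLU,
        subset_rfl, hb⟩
  obtain ⟨U, V, hU, hV, hUV, hLU, ha, hb⟩ := key
  exact ⟨U, V, hU, hV, hUV.mono_left inter_subset_left, hLU, ha, hb⟩

theorem Sep0.exists_isClopen {Z : Type*} [TopologicalSpace Z] [T1Space Z]
    (h : Sep0 (univ : Set Z)) {z : Z} {W : Set Z} (hW : IsOpen W) (hz : z ∈ W) :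
    ∃ O : Set Z, IsClopen O ∧ z ∈ O ∧ O ⊆ W := by
  obtain ⟨C, D, hC, hD, hCD, hun, hAC, hBD⟩ := h {z} Wᶜ isClosed_singleton hW.isClosed_compl
    (by simpa using hz)
  have hCc : C = Dᶜ := (IsCompl.of_eq (disjoint_iff.1 hCD) hun).eq_compl
  refine ⟨C, ⟨hC, hCc ▸ hD.isOpen_compl⟩, hAC ⟨rfl, trivial⟩, fun x hx => ?_⟩
  by_contra hxU
  exact hCD.le_bot ⟨hx, hBD ⟨hxU, trivial⟩⟩

theorem isClosed_setOf_exists_of_compact {A T : Type*} [TopologicalSpace A] [TopologicalSpace T]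
    {K : Set T} (hK : IsCompact K) {S : Set (A × T)} (hS : IsClosed S) :
    IsClosed {a | ∃ t ∈ K, (a, t) ∈ S} := by
  have : CompactSpace K := isCompact_iff_compactSpace.1 hK
  have h := isClosedMap_fst_of_compactSpace (X := A) (Y := K) _
    (hS.preimage (continuous_fst.prodMk (continuous_subtype_val.comp continuous_snd)))
  convert h using 1
  ext a
  simp

/-- A closed subset of `K × Z`, with `K` compact and `Z` zero-dimensional, all of whose fibres
over `Z` are zero-dimensional is zero-dimensional. -/
theorem sep0_of_fibers {Y Z : Type*} [TopologicalSpace Y] [T4Space Y] [TopologicalSpace Z]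
    [T1Space Z] [SecondCountableTopology Z] (hZ : Sep0 (univ : Set Z)) {K : Set Y}
    (hK : IsCompact K) {F : Set (Y × Z)} (hF : IsClosed F)
    (h : ∀ z, Sep0 {y | y ∈ K ∧ (y, z) ∈ F}) : Sep0 (F ∩ Prod.fst ⁻¹' K) := by
  refine (hF.inter (hK.isClosed.preimage continuous_fst)).sep0_of_exists_open
    fun A B hA hB hAB => ?_
  have local_sep : ∀ z, ∃ (U V : Set Y) (O : Set Z), IsOpen U ∧ IsOpen V ∧ Disjoint U V ∧
      IsClopen O ∧ z ∈ O ∧ ∀ y ∈ K, ∀ z' ∈ O, (y, z') ∈ F →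
        (y ∈ U ∧ (y, z') ∉ B) ∨ (y ∈ V ∧ (y, z') ∉ A) := by
    intro z
    have hsl : Continuous fun y : Y => (y, z) := by fun_prop
    obtain ⟨U, V, hU, hV, hUV, hLU, hAU, hBV⟩ := (h z).exists_open (hA.preimage hsl)
      (hB.preimage hsl) (hAB.preimage _)
    let G : Set (Y × Z) := (Prod.fst ⁻¹' U ∩ Bᶜ) ∪ (Prod.fst ⁻¹' V ∩ Aᶜ)
    have hG : IsOpen G := ((hU.preimage continuous_fst).inter hB.isOpen_compl).union
      ((hV.preimage continuous_fst).inter hA.isOpen_compl)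
    have hbad := isClosed_setOf_exists_of_compact hK
      ((hF.sdiff hG).preimage (continuous_swap : Continuous (Prod.swap : Z × Y → Y × Z)))
    obtain ⟨O, hO, hzO, hOsub⟩ := hZ.exists_isClopen hbad.isOpen_compl (z := z) (by
      rintro ⟨y, hyK, hyF, hyG⟩
      apply hyG
      rcases hLU ⟨hyK, hyF⟩ with hyU | hyV
      · exact Or.inl ⟨hyU, fun hyB => hUV.le_bot ⟨hyU, hBV ⟨hyB, hyK, hyF⟩⟩⟩
      · exact Or.inr ⟨hyV, fun hyA => hUV.le_bot ⟨hAU ⟨hyA, hyK, hyF⟩, hyV⟩⟩)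
    refine ⟨U, V, O, hU, hV, hUV, hO, hzO, fun y hy z' hz' hyF => ?_⟩
    by_contra hcon
    exact hOsub hz' ⟨y, hy, hyF, hcon⟩
  choose U V O hU hV hUV hO hzO hgood using local_sep
  obtain ⟨T, hTc, hT⟩ := isOpen_iUnion_countable O fun z => (hO z).2
  have hTu : ∀ z, ∃ t ∈ T, z ∈ O t := by
    intro z
    have : z ∈ ⋃ t ∈ T, O t := hT ▸ mem_iUnion.2 ⟨z, hzO z⟩
    simpa using this
  rcases isEmpty_or_nonempty Z with hZe | ⟨⟨z0⟩⟩
  · exact ⟨∅, ∅, isOpen_empty, isOpen_empty, disjoint_bot_right, fun x _ => isEmptyElim x.2,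
      fun x _ => isEmptyElim x.2, fun x _ => isEmptyElim x.2⟩
  have hTne : T.Nonempty := let ⟨t, ht, _⟩ := hTu z0; ⟨t, ht⟩
  obtain ⟨f, rfl⟩ := hTc.exists_eq_range hTne
  have hcov : ∀ z, ∃ n, z ∈ O (f n) := by simpa using hTu
  let O' : ℕ → Set Z := fun n => {z | z ∈ O (f n) ∧ ∀ m < n, z ∉ O (f m)}
  have hO' : ∀ n, IsOpen (O' n) := by
    intro n
    have : O' n = O (f n) ∩ ⋂ m : Fin n, (O (f m))ᶜ := by
      ext z
      simp only [O', mem_ofPred_eq, mem_inter_iff, mem_iInter, mem_compl_iff]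
      exact and_congr_right fun _ => ⟨fun h m => h m m.2, fun h m hm => h ⟨m, hm⟩⟩
    rw [this]
    exact (hO _).2.inter (isOpen_iInter_of_finite fun m => (hO _).1.isOpen_compl)
  have hO'cov : ∀ z, ∃ n, z ∈ O' n := by
    classical
    intro z
    exact ⟨Nat.find (hcov z), Nat.find_spec (hcov z), fun m hm => Nat.find_min (hcov z) hm⟩
  have hO'dis : ∀ z n m, z ∈ O' n → z ∈ O' m → n = m := by
    intro z n m hn hm
    rcases lt_trichotomy n m with h | h | h
    · exact absurd hn.1 (hm.2 n h)
    · exact h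
    · exact absurd hm.1 (hn.2 m h)
  refine ⟨⋃ n, U (f n) ×ˢ O' n, ⋃ n, V (f n) ×ˢ O' n, isOpen_iUnion fun n => (hU _).prod (hO' n),
    isOpen_iUnion fun n => (hV _).prod (hO' n), ?_, ?_, ?_, ?_⟩
  · rw [Set.disjoint_left]
    rintro ⟨y, z⟩ ⟨hx, -⟩ hx'
    obtain ⟨n, hn, hnO⟩ := mem_iUnion.1 hx
    obtain ⟨m, hm, hmO⟩ := mem_iUnion.1 hx'
    obtain rfl := hO'dis z n m hnO hmO
    exact (hUV _).le_bot ⟨hn, hm⟩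
  · rintro ⟨y, z⟩ ⟨hyF, hyK⟩
    obtain ⟨n, hn⟩ := hO'cov z
    rcases hgood (f n) y hyK z hn.1 hyF with h | h
    · exact Or.inl (mem_iUnion.2 ⟨n, h.1, hn⟩)
    · exact Or.inr (mem_iUnion.2 ⟨n, h.1, hn⟩)
  · rintro ⟨y, z⟩ ⟨hyA, hyF, hyK⟩
    obtain ⟨n, hn⟩ := hO'cov z
    rcases hgood (f n) y hyK z hn.1 hyF with h | h
    · exact mem_iUnion.2 ⟨n, h.1, hn⟩
    · exact absurd hyA h.2
  · rintro ⟨y, z⟩ ⟨hyB, hyF, hyK⟩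
    obtain ⟨n, hn⟩ := hO'cov z
    rcases hgood (f n) y hyK z hn.1 hyF with h | h
    · exact absurd hyB h.2
    · exact mem_iUnion.2 ⟨n, h.1, hn⟩

/-- A fusion argument: the continuous image of a complete space, no piece of which has its closure
inside `A`, yields a map of the Cantor space sending exactly the sequences with infinitely many
`true` into `A`. -/
theorem exists_cantor_map_of_closure_not_subset {P M : Type*} [MetricSpace P] [CompleteSpace P]
    [Nonempty P] [MetricSpace M] [CompleteSpace M] {A : Set M} {f : P → M} (hf : Continuous f)
    (hfA : ∀ x, f x ∈ A)
    (h : ∀ V : Set P, IsOpen V → V.Nonempty → ∃ p ∈ closure (f '' V), p ∉ A) :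
    ∃ H : (ℕ → Bool) → M, Continuous H ∧ ∀ β, H β ∈ A ↔ ∀ n, ∃ m ≥ n, β m = true := by
  classical
  let St := {s : Set P × M // IsOpen s.1 ∧ s.1.Nonempty ∧ s.2 ∈ closure (f '' s.1) ∧ s.2 ∉ A}
  have step : ∀ (n : ℕ) (s : St), ∃ t : St, t.1.1 ⊆ s.1.1 ∧
      (∀ x ∈ t.1.1, ∀ y ∈ t.1.1, dist x y ≤ (1 / 2 : ℝ) ^ n) ∧
      dist s.1.2 t.1.2 ≤ 1 * (1 / 2 : ℝ) ^ n := by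
    rintro n ⟨⟨V, p⟩, hV, hne, hp, hpA⟩
    have hpos : (0 : ℝ) < (1 / 2) ^ n := by positivity
    obtain ⟨_, ⟨x, hxV, rfl⟩, hx⟩ := Metric.mem_closure_iff.1 hp _ hpos
    let V' : Set P := V ∩ f ⁻¹' Metric.ball p ((1 / 2) ^ n) ∩ Metric.ball x ((1 / 2) ^ n / 2)
    have hV' : IsOpen V' := (hV.inter (Metric.isOpen_ball.preimage hf)).inter Metric.isOpen_ball
    have hxV' : x ∈ V' := ⟨⟨hxV, by simpa [dist_comm] using hx⟩, by simp⟩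
    obtain ⟨p', hp', hp'A⟩ := h V' hV' ⟨x, hxV'⟩
    refine ⟨⟨(V', p'), hV', ⟨x, hxV'⟩, hp', hp'A⟩, fun y hy => hy.1.1, ?_, ?_⟩
    · intro y hy z hz
      have h1 := Metric.mem_ball.1 hy.2
      have h2 := Metric.mem_ball.1 hz.2
      linarith [dist_triangle_right y z x]
    · have : closure (f '' V') ⊆ Metric.closedBall p ((1 / 2) ^ n) := by
        refine closure_minimal ?_ Metric.isClosed_closedBall
        rintro _ ⟨y, hy, rfl⟩
        exact Metric.ball_subset_closedBall hy.1.2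
      simpa [dist_comm] using this hp'
  choose g hg1 hg2 hg3 using step
  obtain ⟨p0, hp0, hp0A⟩ := h univ isOpen_univ univ_nonempty
  let run : ℕ → (ℕ → Bool) → St := fun n β =>
    Nat.rec ⟨(univ, p0), isOpen_univ, univ_nonempty, hp0, hp0A⟩
      (fun n s => if β n = true then g n s else s) n
  have run_succ : ∀ n β, run (n + 1) β = if β n = true then g n (run n β) else run n β :=
    fun _ _ => rfl
  have run_lc : ∀ n, IsLocallyConstant (run n) := by
    intro n
    induction n with
    | zero => exact IsLocallyConstant.const _
    | succ n ih =>
      have hev : IsLocallyConstant fun β : ℕ → Bool => β n :=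
        (IsLocallyConstant.iff_continuous _).2 (continuous_apply n)
      exact (hev.prodMk ih).comp fun q : Bool × St => if q.1 = true then g n q.2 else q.2
  have hd : ∀ β n, dist (run n β).1.2 (run (n + 1) β).1.2 ≤ 1 * (1 / 2 : ℝ) ^ n := by
    intro β n
    rw [run_succ]
    split_ifs
    · exact hg3 n _
    · rw [dist_self]; positivity
  have hsub : ∀ β, Antitone fun n => (run n β).1.1 := by
    intro β
    refine antitone_nat_of_succ_le fun n => ?_
    rw [run_succ]
    split_ifs
    · exact hg1 n _
    · exact le_rfl
  have hlim : ∀ β, ∃ x, Tendsto (fun n => (run n β).1.2) atTop (𝓝 x) := fun β =>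
    cauchySeq_tendsto_of_complete (cauchySeq_of_le_geometric _ _ (by norm_num) (hd β))
  choose H hH using hlim
  have hunif : TendstoUniformly (fun n β => (run n β).1.2) H atTop := by
    rw [Metric.tendstoUniformly_iff]
    intro ε hε
    have h0 : Tendsto (fun n : ℕ => 1 * (1 / 2 : ℝ) ^ n / (1 - 1 / 2)) atTop (𝓝 0) := by
      simpa using ((tendsto_pow_atTop_nhds_zero_of_lt_one (r := (1 / 2 : ℝ)) (by norm_num)
        (by norm_num)).const_mul 1).div_const (1 - 1 / 2)
    filter_upwards [h0.eventually (gt_mem_nhds hε)] with n hn β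
    rw [dist_comm]
    exact (dist_le_of_le_geometric_of_tendsto _ _ (by norm_num) (hd β) (hH β) n).trans_lt hn
  refine ⟨H, hunif.continuous (Frequently.of_forall fun n =>
    ((run_lc n).comp fun s => s.1.2).continuous), fun β => ⟨fun hβ => ?_, fun hβ => ?_⟩⟩
  · by_contra! hcon
    obtain ⟨N, hN⟩ := hcon
    have hconst : ∀ k, run (N + k) β = run N β := by
      intro k
      induction k with
      | zero => rfl
      | succ k ih => rw [← add_assoc, run_succ, if_neg (hN _ (by omega)), ih]
    have : Tendsto (fun n => (run n β).1.2) atTop (𝓝 (run N β).1.2) := by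
      refine tendsto_const_nhds.congr' ?_
      filter_upwards [eventually_ge_atTop N] with n hn
      obtain ⟨k, rfl⟩ := Nat.exists_eq_add_of_le hn
      rw [hconst]
    rw [tendsto_nhds_unique (hH β) this] at hβ
    exact (run N β).2.2.2.2 hβ
  · have hsmall : ∀ ε > 0, ∃ N, ∀ x ∈ (run N β).1.1, ∀ y ∈ (run N β).1.1, dist x y < ε := by
      intro ε hε
      obtain ⟨n, hn⟩ := exists_pow_lt_of_lt_one hε (by norm_num : (1 / 2 : ℝ) < 1)
      obtain ⟨m, hm, hβm⟩ := hβ n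
      refine ⟨m + 1, fun x hx y hy => ?_⟩
      rw [run_succ, if_pos hβm] at hx hy
      exact ((hg2 m _ x hx y hy).trans
        (pow_le_pow_of_le_one (by norm_num) (by norm_num) hm)).trans_lt hn
    choose v hv using fun n => (run n β).2.2.1
    have hvmem : ∀ N, ∀ n ≥ N, v n ∈ (run N β).1.1 := fun N n hn => hsub β hn (hv n)
    have hcau : CauchySeq v := by
      rw [Metric.cauchySeq_iff]
      intro ε hε
      obtain ⟨N, hN⟩ := hsmall ε hε
      exact ⟨N, fun m hm n hn => hN _ (hvmem N m hm) _ (hvmem N n hn)⟩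
    obtain ⟨w, hw⟩ := cauchySeq_tendsto_of_complete hcau
    have hlim' : Tendsto (fun n => (run n β).1.2) atTop (𝓝 (f w)) := by
      rw [Metric.tendsto_atTop]
      intro ε hε
      obtain ⟨δ, hδ, hfδ⟩ := Metric.continuous_iff.1 hf w (ε / 2) (by positivity)
      obtain ⟨N, hN⟩ := hsmall (δ / 2) (by positivity)
      refine ⟨N, fun n hn => ?_⟩
      have hsubset : closure (f '' (run n β).1.1) ⊆ Metric.closedBall (f w) (ε / 2) := by
        refine closure_minimal ?_ Metric.isClosed_closedBall
        rintro _ ⟨y, hy, rfl⟩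
        have hyN := hsub β hn hy
        have : dist w y ≤ δ / 2 := by
          refine le_of_tendsto (hw.dist tendsto_const_nhds) ?_
          filter_upwards [eventually_ge_atTop N] with k hk
          exact (hN _ (hvmem N k hk) _ hyN).le
        exact (hfδ y (by rw [dist_comm]; linarith)).le
      have := Metric.mem_closedBall.1 (hsubset (run n β).2.2.2.1)
      linarith
    rw [tendsto_nhds_unique (hH β) hlim']
    exact hfA w

/-- A form of Hurewicz's theorem: for an analytic set `A` which is not `σ`-compact there is a map of
the Cantor space for which the preimage of `A` is the set of sequences with infinitely many
`true`. -/
theorem exists_cantor_map_of_not_isSigmaCompact {M : Type*} [MetricSpace M] [CompactSpace M]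
    {A : Set M} (hA : MeasureTheory.AnalyticSet A) (hnA : ¬ IsSigmaCompact A) :
    ∃ H : (ℕ → Bool) → M, Continuous H ∧ ∀ β, H β ∈ A ↔ ∀ n, ∃ m ≥ n, β m = true := by
  rw [MeasureTheory.AnalyticSet] at hA
  rcases hA with rfl | ⟨f, hf, rfl⟩
  · exact absurd isSigmaCompact_empty hnA
  let small : Set (ℕ → ℕ) → Prop := fun V => ∃ B ⊆ range f, IsSigmaCompact B ∧ f '' V ⊆ B
  have small_union : ∀ V V', small V → small V' → small (V ∪ V') := by
    rintro V V' ⟨B, hB, hBs, hV⟩ ⟨B', hB', hBs', hV'⟩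
    refine ⟨B ∪ B', union_subset hB hB', ?_, ?_⟩
    · rw [union_eq_iUnion]
      exact isSigmaCompact_iUnion _ (by rintro (_ | _) <;> assumption)
    · rw [image_union]
      exact union_subset_union hV hV'
  let b := countableBasis (ℕ → ℕ)
  let O : Set (ℕ → ℕ) := ⋃ V : {V : Set (ℕ → ℕ) // V ∈ b ∧ small V}, V.1
  have hOo : IsOpen O := isOpen_iUnion fun V => (isBasis_countableBasis _).isOpen V.2.1
  have hOs : small O := by
    have : Countable {V : Set (ℕ → ℕ) // V ∈ b ∧ small V} :=
      ((countable_countableBasis _).mono fun V hV => hV.1 : ({V | V ∈ b ∧ small V}).Countable)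
    choose B hB hBs hVB using fun V : {V : Set (ℕ → ℕ) // V ∈ b ∧ small V} => V.2.2
    refine ⟨⋃ V, B V, iUnion_subset hB, isSigmaCompact_iUnion _ hBs, ?_⟩
    rw [image_iUnion]
    exact iUnion_mono hVB
  have hWne : Nonempty ↥Oᶜ := by
    by_contra hcon
    rw [nonempty_subtype] at hcon
    push Not at hcon
    obtain ⟨B, hB, hBs, hOB⟩ := hOs
    have : B = range f := by
      refine hB.antisymm ?_
      rintro _ ⟨x, rfl⟩
      exact hOB ⟨x, not_not.1 (hcon x), rfl⟩
    exact hnA (this ▸ hBs)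
  have : PolishSpace ↥Oᶜ := hOo.isClosed_compl.polishSpace
  let _ := upgradeIsCompletelyMetrizable ↥Oᶜ
  refine exists_cantor_map_of_closure_not_subset (P := ↥Oᶜ)
    (f := fun x : ↥Oᶜ => f x.1) (hf.comp continuous_subtype_val)
    (fun x => mem_range_self _) fun V hV ⟨w, hw⟩ => ?_
  by_contra! hcon
  obtain ⟨V0, hV0, rfl⟩ := isOpen_induced_iff.1 hV
  obtain ⟨U, hUb, hwU, hUV⟩ := (isBasis_countableBasis (ℕ → ℕ)).exists_subset_of_mem_open
    (show w.1 ∈ V0 from hw) hV0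
  refine w.2 (mem_iUnion.2 ⟨⟨U, hUb, ?_⟩, hwU⟩)
  have hsm : small (V0 ∩ Oᶜ) := by
    refine ⟨_, hcon, isClosed_closure.isCompact.isSigmaCompact, image_subset_iff.2 fun x hx => ?_⟩
    exact subset_closure ⟨⟨x, hx.2⟩, hx.1, rfl⟩
  obtain ⟨B, hB, hBs, hOB⟩ := small_union _ _ hOs hsm
  refine ⟨B, hB, hBs, (image_mono fun x hx => ?_).trans hOB⟩
  by_cases hxO : x ∈ O
  · exact Or.inl hxO
  · exact Or.inr ⟨hUV hx, hxO⟩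

theorem eventually_nhds_eq_of_lt (β : ℕ → Bool) (n : ℕ) :
    ∀ᶠ β' in 𝓝 β, ∀ i < n, β' i = β i := by
  have : ∀ i ∈ Iio n, ∀ᶠ β' in 𝓝 β, β' i = β i := fun i _ =>
    (continuous_apply (A := fun _ : ℕ => Bool) i).continuousAt.eventually
      ((isOpen_discrete {β i}).mem_nhds rfl)
  exact (eventually_all_finite (finite_Iio n)).2 this

/-- The Baire space is a continuous image of the space of binary sequences with infinitely many
`true`. -/
theorem exists_continuousOn_surjOn_baire :
    ∃ u : (ℕ → Bool) → ℕ → ℕ, (∀ β, (∀ n, ∃ m ≥ n, β m = true) → ContinuousAt u β) ∧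
      ∀ g, ∃ β, (∀ n, ∃ m ≥ n, β m = true) ∧ u β = g := by
  classical
  refine ⟨fun β n => (Nat.unpair (Nat.nth (fun k => β k = true) n)).1, fun β hβ => ?_,
    fun g => ?_⟩
  · have hinf : (Set.ofPred fun k => β k = true).Infinite := by
      rw [Set.infinite_iff_exists_gt]
      intro a
      obtain ⟨m, hm, h⟩ := hβ (a + 1)
      exact ⟨m, h, hm⟩
    rw [continuousAt_pi]
    intro n
    have hmem := Nat.nth_mem_of_infinite hinf n
    have hcount := Nat.count_nth_of_infinite hinf n
    set m := Nat.nth (fun k => β k = true) n with hm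
    refine (continuousAt_const (y := (Nat.unpair m).1)).congr ?_
    filter_upwards [eventually_nhds_eq_of_lt β (m + 1)] with β' hβ'
    have h1 : Nat.count (fun k => β' k = true) m = n := by
      rw [← hcount, Nat.count_eq_card_filter_range, Nat.count_eq_card_filter_range]
      congr 1
      refine Finset.filter_congr fun k hk => ?_
      rw [hβ' k ((Finset.mem_range.1 hk).trans (Nat.lt_succ_self m))]
    have h2 : (fun k => β' k = true) m := by
      show β' m = true
      rw [hβ' m (Nat.lt_succ_self m)]
      exact hmem
    have h3 := Nat.nth_count (p := fun k => β' k = true) h2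
    rw [h1] at h3
    rw [h3]
  · let h : ℕ → ℕ := fun n =>
      Nat.rec (Nat.pair (g 0) 0) (fun n r => Nat.pair (g (n + 1)) (r + 1)) n
    have hs : ∀ n, h (n + 1) = Nat.pair (g (n + 1)) (h n + 1) := fun _ => rfl
    have hmono : StrictMono h := strictMono_nat_of_lt_succ fun n => by
      rw [hs]
      exact (Nat.lt_succ_self _).trans_le (Nat.right_le_pair _ _)
    have hinf : (range h).Infinite := infinite_range_of_injective hmono.injective
    refine ⟨fun k => decide (k ∈ range h), fun n => ⟨h n, hmono.id_le n, by simp⟩, ?_⟩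
    have heq : Nat.nth (fun k => decide (k ∈ range h) = true) = h := by
      have hinf' : (Set.ofPred fun k => decide (k ∈ range h) = true).Infinite := by
        convert hinf using 1
        ext k
        simp
      rw [← (Nat.nth_strictMono hinf').range_inj hmono, Nat.range_nth_of_infinite hinf']
      ext k
      simp
    funext n
    show (Nat.unpair (Nat.nth (fun k => decide (k ∈ range h) = true) n)).1 = g n
    rw [heq]
    cases n with
    | zero => exact congrArg Prod.fst (Nat.unpair_pair _ _)
    | succ n => rw [hs]; exact congrArg Prod.fst (Nat.unpair_pair _ _)

theorem exists_closed_rel_of_graph {G : Set ((ℕ → Bool) × (ℕ → Bool))}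
    (hG : ∀ p ∈ closure G, (∀ n, ∃ m ≥ n, p.2 m = true) → p ∈ G) :
    ∃ R : Set ((ℕ → Bool) × (ℕ → Bool)), IsClosed R ∧
      (∀ q : ℕ → Bool, (¬ ∀ n, ∃ m ≥ n, q m = true) → IsOpen {α | (α, q) ∈ R} ∧
        IsClosed {α | (α, q) ∈ R}) ∧
      (∀ α β, (α, β) ∈ R → β ∈ closure {q | (α, q) ∈ R ∧ ¬ ∀ n, ∃ m ≥ n, q m = true}) ∧
      ∀ α β, (∀ n, ∃ m ≥ n, β m = true) → ((α, β) ∈ R ↔ (α, β) ∈ G) := by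
  let r : ∀ n, (ℕ → Bool) × (ℕ → Bool) → (Fin (n + 1) → Bool) × (Fin (n + 1) → Bool) :=
    fun n p => (fun i => p.1 i, fun i => p.2 i)
  have hr : ∀ n, Continuous (r n) := fun n => by fun_prop
  let S : ∀ n, Set ((Fin (n + 1) → Bool) × (Fin (n + 1) → Bool)) :=
    fun n => {s | s.2 (Fin.last n) = true → ∃ p ∈ G, r n p = s}
  have hS : ∀ n, IsClopen (r n ⁻¹' S n) := fun n => (isClopen_discrete _).preimage (hr n)
  refine ⟨⋂ n, r n ⁻¹' S n, isClosed_iInter fun n => (hS n).1, fun q hq => ⟨?_, ?_⟩, ?_, ?_⟩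
  · push Not at hq
    obtain ⟨N, hN⟩ := hq
    have : {α | (α, q) ∈ ⋂ n, r n ⁻¹' S n} =
        ⋂ n ∈ Iio N, (fun α : ℕ → Bool => (α, q)) ⁻¹' (r n ⁻¹' S n) := by
      ext α
      simp only [mem_ofPred_eq, mem_iInter, mem_Iio, mem_preimage]
      refine ⟨fun h n _ => h n, fun h n => ?_⟩
      rcases lt_or_ge n N with hn | hn
      · exact h n hn
      · intro hcon
        exact absurd hcon (hN n hn)
    rw [this]
    exact (finite_Iio N).isOpen_biInter fun n _ => (hS n).2.preimage (by fun_prop)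
  · exact (isClosed_iInter fun n => (hS n).1).preimage (f := fun α : ℕ → Bool => (α, q))
      (by fun_prop)
  · intro α β hαβ
    by_cases hβ : ∀ n, ∃ m ≥ n, β m = true
    · let q : ℕ → ℕ → Bool := fun n i => if i < n then β i else false
      have hq : Tendsto q atTop (𝓝 β) := by
        rw [tendsto_pi_nhds]
        intro i
        refine tendsto_const_nhds.congr' ?_
        filter_upwards [eventually_gt_atTop i] with n hn
        simp [q, hn]
      refine mem_closure_of_tendsto hq (Eventually.of_forall fun n => ⟨?_, ?_⟩)
      · rw [mem_iInter] at hαβ ⊢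
        intro m hm
        have hmn : m < n := by
          by_contra hcon
          simp [r, q, hcon] at hm
        have hqβ : ∀ i : Fin (m + 1), q n i = β i := fun i => by
          simp [q, show (i : ℕ) < n by omega]
        have heq : r m (α, q n) = r m (α, β) := by
          simp only [r, Prod.mk.injEq, true_and]
          exact funext hqβ
        rw [heq] at hm ⊢
        exact hαβ m hm
      · push Not
        exact ⟨n, fun m hm => by simp [q, hm]⟩
    · exact subset_closure ⟨hαβ, hβ⟩
  · intro α β hβ
    constructor
    · intro h
      rw [mem_iInter] at h
      refine hG _ ?_ hβ
      choose m hm hmβ using hβ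
      choose p hpG hp using fun n => h (m n) (hmβ n)
      refine mem_closure_of_tendsto (f := p) ?_ (Eventually.of_forall hpG) (b := atTop)
      rw [Prod.tendsto_iff, tendsto_pi_nhds, tendsto_pi_nhds]
      have hp1 : ∀ n i, i ≤ n → (p n).1 i = α i := fun n i hi =>
        congrFun (congrArg Prod.fst (hp n)) ⟨i, by have := hm n; omega⟩
      have hp2 : ∀ n i, i ≤ n → (p n).2 i = β i := fun n i hi =>
        congrFun (congrArg Prod.snd (hp n)) ⟨i, by have := hm n; omega⟩
      refine ⟨fun i => tendsto_const_nhds.congr' ?_, fun i => tendsto_const_nhds.congr' ?_⟩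
      · filter_upwards [eventually_ge_atTop i] with n hn using (hp1 n i hn).symm
      · filter_upwards [eventually_ge_atTop i] with n hn using (hp2 n i hn).symm
    · intro h
      exact mem_iInter.2 fun n _ => ⟨_, h, rfl⟩

/-- A co-analytic set of binary sequences is presented by a closed relation whose sections meet the
countable set of eventually vanishing sequences in a clopen and dense way. -/
theorem exists_closed_rel {A' : Set (ℕ → Bool)} (hA : MeasureTheory.AnalyticSet A'ᶜ) :
    ∃ R : Set ((ℕ → Bool) × (ℕ → Bool)), IsClosed R ∧
      (∀ q : ℕ → Bool, (¬ ∀ n, ∃ m ≥ n, q m = true) → IsOpen {α | (α, q) ∈ R} ∧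
        IsClosed {α | (α, q) ∈ R}) ∧
      (∀ α β, (α, β) ∈ R → β ∈ closure {q | (α, q) ∈ R ∧ ¬ ∀ n, ∃ m ≥ n, q m = true}) ∧
      ∀ α, α ∈ A' ↔ ∀ β, (α, β) ∈ R → ¬ ∀ n, ∃ m ≥ n, β m = true := by
  have key : ∃ G : Set ((ℕ → Bool) × (ℕ → Bool)),
      (∀ p ∈ closure G, (∀ n, ∃ m ≥ n, p.2 m = true) → p ∈ G) ∧
      ∀ α, α ∈ A'ᶜ ↔ ∃ β, (α, β) ∈ G ∧ ∀ n, ∃ m ≥ n, β m = true := by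
    rw [MeasureTheory.AnalyticSet] at hA
    rcases hA with hA | ⟨f, hf, hfA⟩
    · exact ⟨∅, by simp, by simp [hA]⟩
    · obtain ⟨u, hu, hsurj⟩ := exists_continuousOn_surjOn_baire
      refine ⟨{p | p.1 = f (u p.2)}, ?_, fun α => ?_⟩
      · intro p hp hinf
        by_contra hne
        have hc : ContinuousAt (fun p : (ℕ → Bool) × (ℕ → Bool) => f (u p.2)) p :=
          hf.continuousAt.comp (ContinuousAt.comp (f := Prod.snd) (hu _ hinf) continuousAt_snd)
        have hev : ∀ᶠ p' in 𝓝 p, p'.1 ≠ f (u p'.2) :=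
          (ContinuousAt.ne_iff_eventually_ne continuousAt_fst hc).1 hne
        obtain ⟨p', h1, h2⟩ := mem_closure_iff_nhds.1 hp _ hev
        exact h1 h2
      · rw [← hfA]
        constructor
        · rintro ⟨x, rfl⟩
          obtain ⟨β, hβ, rfl⟩ := hsurj x
          exact ⟨β, rfl, hβ⟩
        · rintro ⟨β, h, -⟩
          exact ⟨_, h.symm⟩
  obtain ⟨G, hG, hGA⟩ := key
  obtain ⟨R, hR, hq, hd, hRG⟩ := exists_closed_rel_of_graph hG
  refine ⟨R, hR, hq, hd, fun α => ?_⟩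
  rw [← not_iff_not, ← mem_compl_iff, hGA]
  push Not
  exact ⟨fun ⟨β, h, hβ⟩ => ⟨β, (hRG α β hβ).2 h, hβ⟩,
    fun ⟨β, h, hβ⟩ => ⟨β, (hRG α β hβ).1 h, hβ⟩⟩

theorem countable_setOf_not_frequently_true :
    {q : ℕ → Bool | ¬ ∀ n, ∃ m ≥ n, q m = true}.Countable := by
  refine (countable_range fun (s : Finset ℕ) (n : ℕ) => decide (n ∈ s)).mono fun q hq => ?_
  have hq' : ¬ ∀ n, ∃ m ≥ n, q m = true := hq
  push Not at hq'
  obtain ⟨n, hn⟩ := hq'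
  refine ⟨(Finset.range n).filter fun i => q i = true, funext fun i => ?_⟩
  by_cases hi : i < n
  · simp [hi]
  · simpa [hi] using (hn i (not_lt.1 hi)).symm

theorem mem_closure_frequently_true (q : ℕ → Bool) :
    q ∈ closure {β : ℕ → Bool | ∀ n, ∃ m ≥ n, β m = true} := by
  refine mem_closure_of_tendsto (b := atTop)
    (f := fun (n i : ℕ) => if i < n then q i else true) ?_ (Eventually.of_forall fun n k => ?_)
  · refine tendsto_pi_nhds.2 fun i => tendsto_const_nhds.congr' ?_
    filter_upwards [eventually_gt_atTop i] with n hn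
    simp [hn]
  · exact ⟨max n k, le_max_right _ _, by simp⟩

set_option maxHeartbeats 1000000 in
theorem exists_family_of_approximation {W : Type*} [MetricSpace W] [CompactSpace W]
    {H : (ℕ → Bool) → NonemptyCompacts W} (hH : Continuous H)
    {R : Set ((ℕ → Bool) × (ℕ → Bool))} (hR : IsClosed R)
    (hRc : ∀ q : ℕ → Bool, (¬ ∀ n, ∃ m ≥ n, q m = true) →
      IsOpen {α | (α, q) ∈ R} ∧ IsClosed {α | (α, q) ∈ R})
    (hRd : ∀ α β, (α, β) ∈ R →
      β ∈ closure {q | (α, q) ∈ R ∧ ¬ ∀ n, ∃ m ≥ n, q m = true})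
    {E : Set W}
    (hE : ∀ q : ℕ → Bool, (¬ ∀ n, ∃ m ≥ n, q m = true) → ∀ ε > 0, ∃ D : Set W, D.Finite ∧ D ⊆ E ∧
      (∀ x ∈ D, Metric.infDist x (H q : Set W) ≤ ε) ∧
      ∀ x ∈ (H q : Set W), ∃ d ∈ D, dist x d < ε) :
    ∃ P : (ℕ → Bool) → Set W, (∀ α, P α ⊆ E) ∧ (∀ α, (P α).Countable) ∧
      (∀ α, ∀ x ∈ closure (P α), x ∈ P α ∨ ∃ θ, (α, θ) ∈ R ∧ x ∈ (H θ : Set W)) ∧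
      (∀ α θ, (α, θ) ∈ R → (H θ : Set W) ⊆ closure (P α)) ∧
      (∀ U, IsOpen U → IsOpen {α | (P α ∩ U).Nonempty}) ∧
      ∀ U, IsOpen U → IsOpen {α | closure (P α) ⊆ U} := by
  obtain ⟨enum, henum⟩ := countable_setOf_not_frequently_true.exists_eq_range
    ⟨fun _ => false, by simp⟩
  have hQ : ∀ k, ¬ ∀ n, ∃ m ≥ n, enum k m = true := fun k => by
    have : enum k ∈ {q : ℕ → Bool | ¬ ∀ n, ∃ m ≥ n, q m = true} := henum ▸ mem_range_self k
    exact this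
  let q : ℕ → ℕ → Bool := fun m => enum m.unpair.1
  have hq : ∀ m, ¬ ∀ n, ∃ k ≥ n, q m k = true := fun m => hQ _
  have hqs : ∀ p : ℕ → Bool, (¬ ∀ n, ∃ m ≥ n, p m = true) → ∀ n, ∃ m ≥ n, q m = p := by
    intro p hp n
    have : p ∈ range enum := henum ▸ hp
    obtain ⟨k, rfl⟩ := this
    exact ⟨Nat.pair k n, Nat.right_le_pair _ _, by simp [q]⟩
  choose D hDf hDE hDH hHD using fun m : ℕ => hE (q m) (hq m) (1 / (m + 1)) Nat.one_div_pos_of_nat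
  have hcont : Continuous fun p : W × (ℕ → Bool) => Metric.infDist p.1 (H p.2 : Set W) :=
    Metric.lipschitz_infDist.continuous.comp
      (continuous_fst.prodMk (hH.comp continuous_snd))
  let P : (ℕ → Bool) → Set W := fun α => {x | ∃ m, (α, q m) ∈ R ∧ x ∈ D m}
  let thick : ℕ → Set ((ℕ → Bool) × W) := fun n =>
    {p | ∃ θ ∈ (univ : Set (ℕ → Bool)), (p, θ) ∈ {s : ((ℕ → Bool) × W) × (ℕ → Bool) |
      (s.1.1, s.2) ∈ R ∧ Metric.infDist s.1.2 (H s.2 : Set W) ≤ 1 / ((n : ℝ) + 1)}}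
  have hthick : ∀ n, IsClosed (thick n) := by
    intro n
    refine isClosed_setOf_exists_of_compact isCompact_univ ?_
    refine IsClosed.inter (hR.preimage (f := fun s : ((ℕ → Bool) × W) × (ℕ → Bool) =>
      (s.1.1, s.2)) (by fun_prop)) ?_
    exact isClosed_le (hcont.comp (f := fun s : ((ℕ → Bool) × W) × (ℕ → Bool) =>
      (s.1.2, s.2)) (by fun_prop)) continuous_const
  let fin : ℕ → Set ((ℕ → Bool) × W) := fun n =>
    ⋃ m ∈ Finset.range n, {α | (α, q m) ∈ R} ×ˢ D m
  have hfin : ∀ n, IsClosed (fin n) := fun n =>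
    isClosed_biUnion_finset fun m _ => (hRc _ (hq m)).2.prod (hDf m).isClosed
  have hG : ∀ α x, (∀ n, (α, x) ∈ thick n ∪ fin n) ↔
      (x ∈ P α ∨ ∃ θ, (α, θ) ∈ R ∧ x ∈ (H θ : Set W)) := by
    intro α x
    constructor
    · intro h
      by_cases hx : x ∈ P α
      · exact Or.inl hx
      right
      have h' : ∀ n : ℕ, ∃ θ, (α, θ) ∈ R ∧
          Metric.infDist x (H θ : Set W) ≤ 1 / ((n : ℝ) + 1) := by
        intro n
        rcases h n with ⟨θ, -, h1⟩ | h1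
        · exact ⟨θ, h1⟩
        · simp only [fin, mem_iUnion, Finset.mem_range] at h1
          obtain ⟨m, -, hm⟩ := h1
          exact absurd ⟨m, hm.1, hm.2⟩ hx
      have hRα : IsClosed {θ | (α, θ) ∈ R} := hR.preimage (by fun_prop)
      obtain ⟨θ, hθ, hmin⟩ := hRα.isCompact.exists_isMinOn ⟨_, (h' 0).choose_spec.1⟩
        (hcont.comp (f := fun θ : ℕ → Bool => (x, θ)) (by fun_prop)).continuousOn
      refine ⟨θ, hθ, ?_⟩
      rw [(H θ).isCompact.isClosed.mem_iff_infDist_zero (H θ).nonempty]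
      refine le_antisymm (le_of_forall_pos_lt_add fun ε hε => ?_) Metric.infDist_nonneg
      obtain ⟨n, hn⟩ := exists_nat_one_div_lt hε
      obtain ⟨θ', hθ', hd⟩ := h' n
      have := hmin hθ'
      simp only [Function.comp_apply, mem_ofPred_eq] at this
      linarith
    · rintro (⟨m, hm, hx⟩ | ⟨θ, hθ, hx⟩) n
      · by_cases hmn : m < n
        · right
          simp only [fin, mem_iUnion, Finset.mem_range]
          exact ⟨m, hmn, hm, hx⟩
        · left
          refine ⟨q m, mem_univ _, hm, (hDH m x hx).trans ?_⟩
          exact Nat.one_div_le_one_div (not_lt.1 hmn)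
      · left
        refine ⟨θ, mem_univ _, hθ, ?_⟩
        simp only [Metric.infDist_zero_of_mem hx]
        positivity
  have hGc : IsClosed {p : (ℕ → Bool) × W |
      p.2 ∈ P p.1 ∨ ∃ θ, (p.1, θ) ∈ R ∧ p.2 ∈ (H θ : Set W)} := by
    have : {p : (ℕ → Bool) × W | p.2 ∈ P p.1 ∨ ∃ θ, (p.1, θ) ∈ R ∧ p.2 ∈ (H θ : Set W)} =
        ⋂ n, (thick n ∪ fin n) := by
      ext ⟨α, x⟩
      rw [mem_iInter]
      exact (hG α x).symm
    rw [this]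
    exact isClosed_iInter fun n => (hthick n).union (hfin n)
  have hsub : ∀ α, ∀ x ∈ closure (P α), x ∈ P α ∨ ∃ θ, (α, θ) ∈ R ∧ x ∈ (H θ : Set W) := by
    intro α x hx
    have hc := hGc.preimage (f := fun x : W => (α, x)) (by fun_prop)
    exact closure_minimal (fun y hy => Or.inl hy) hc hx
  have hHcl : ∀ α θ, (α, θ) ∈ R → (H θ : Set W) ⊆ closure (P α) := by
    intro α θ hθ x hx
    rw [Metric.mem_closure_iff]
    intro ε hε
    have hev : ∀ᶠ p in 𝓝 θ, Metric.infDist x (H p : Set W) < ε / 2 := by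
      refine (hcont.comp (f := fun θ : ℕ → Bool => (x, θ)) (by fun_prop)).continuousAt.eventually_lt
        continuousAt_const ?_
      simpa [Metric.infDist_zero_of_mem hx] using hε
    obtain ⟨p, hp, hpR, hpQ⟩ := mem_closure_iff_nhds.1 (hRd α θ hθ) _ hev
    obtain ⟨y, hy, hxy⟩ := (Metric.infDist_lt_iff (H p).nonempty).1 hp
    obtain ⟨n, hn⟩ := exists_nat_one_div_lt (half_pos hε)
    obtain ⟨m, hm, rfl⟩ := hqs p hpQ n
    obtain ⟨d, hd, hyd⟩ := hHD m y hy
    refine ⟨d, ⟨m, hpR, hd⟩, ?_⟩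
    have h1 := dist_triangle x y d
    have h2 : 1 / ((m : ℝ) + 1) ≤ 1 / ((n : ℝ) + 1) := Nat.one_div_le_one_div hm
    linarith
  refine ⟨P, ?_, ?_, hsub, hHcl, ?_, ?_⟩
  · rintro α x ⟨m, -, hx⟩
    exact hDE m hx
  · intro α
    refine (countable_iUnion fun m => (hDf m).countable).mono ?_
    rintro x ⟨m, -, hx⟩
    exact mem_iUnion.2 ⟨m, hx⟩
  · intro U hU
    have : {α | (P α ∩ U).Nonempty} = ⋃ m, ⋃ (_ : (D m ∩ U).Nonempty), {α | (α, q m) ∈ R} := by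
      ext α
      simp only [mem_iUnion, exists_prop]
      constructor
      · rintro ⟨x, ⟨m, hm, hx⟩, hxU⟩
        exact ⟨m, ⟨x, hx, hxU⟩, hm⟩
      · rintro ⟨m, ⟨x, hx, hxU⟩, hm⟩
        exact ⟨x, ⟨m, hm, hx⟩, hxU⟩
    rw [this]
    exact isOpen_iUnion fun m => isOpen_iUnion fun _ => (hRc _ (hq m)).1
  · intro U hU
    have h := isClosed_setOf_exists_of_compact hU.isClosed_compl.isCompact hGc
    rw [← isClosed_compl_iff]
    convert h using 1
    ext α
    constructor
    · intro hα
      obtain ⟨x, hx, hxU⟩ := not_subset.1 hα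
      exact ⟨x, hxU, hsub α x hx⟩
    · rintro ⟨x, hxU, hx | ⟨θ, hθ, hx⟩⟩ hα
      · exact hxU (hα (subset_closure hx))
      · exact hxU (hα (hHcl α θ hθ hx))

theorem Sep0.of_prodMk {Y Z : Type*} [TopologicalSpace Y] [TopologicalSpace Z] {F : Set (Y × Z)}
    (hF : Sep0 F) {K : Set Y} (hK : IsClosed K) {z : Z} (h : ∀ y ∈ K, (y, z) ∈ F) : Sep0 K := by
  intro A B hA hB hAB
  obtain ⟨C, D, hC, hD, hCD, hun, hAC, hBD⟩ := hF (Prod.fst ⁻¹' A) (Prod.fst ⁻¹' B)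
    (hA.preimage continuous_fst) (hB.preimage continuous_fst) (hAB.preimage _)
  have hc : Continuous fun y : Y => (y, z) := by fun_prop
  refine ⟨K ∩ (fun y => (y, z)) ⁻¹' C, K ∩ (fun y => (y, z)) ⁻¹' D, hK.inter (hC.preimage hc),
    hK.inter (hD.preimage hc), ?_, ?_, ?_, ?_⟩
  · exact (hCD.preimage _).mono inter_subset_right inter_subset_right
  · rw [← inter_union_distrib_left, ← preimage_union, hun]
    exact inter_eq_left.2 h
  · exact fun y hy => ⟨hy.2, hAC ⟨hy.1, h y hy.2⟩⟩
  · exact fun y hy => ⟨hy.2, hBD ⟨hy.1, h y hy.2⟩⟩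

theorem exists_isCompact_not_sep0 {Y : Type*} [TopologicalSpace Y] [MetrizableSpace Y]
    [SigmaCompactSpace Y] (h : ¬ DimLE Y 0) : ∃ K : Set Y, IsCompact K ∧ ¬ Sep0 K := by
  by_contra! hc
  refine h (Sep0.dimLE_zero ?_)
  rw [← iUnion_compactCovering]
  exact sep0_of_iUnion (by rw [iUnion_compactCovering]; exact isClosed_univ)
    fun n => hc _ (isCompact_compactCovering Y n)

section Slice

variable {Y Z W : Type*} [TopologicalSpace Y] [TopologicalSpace Z] [MetricSpace W]
  {e : Y × Z → W}

/-- The compact set `e '' (K ×ˢ {z})`. -/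
noncomputable def sliceImage (he : Continuous e) (K : NonemptyCompacts Y) (z : Z) :
    NonemptyCompacts W :=
  K.map (fun y => e (y, z)) (he.comp (by fun_prop))

theorem continuous_sliceImage (he : Continuous e) (K : NonemptyCompacts Y) :
    Continuous (sliceImage he K) :=
  Continuous.nonemptyCompacts_map' (f := fun _ => K) (g := fun z y => e (y, z))
    continuous_const (he.comp continuous_swap)

theorem exists_isOpen_of_isOpen (he : IsEmbedding e) {V : Set Z} (hV : IsOpen V) :
    ∃ O : Set W, IsOpen O ∧ ∀ y z, e (y, z) ∈ O ↔ z ∈ V := by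
  obtain ⟨O, hO, hOV⟩ := he.isInducing.isOpen_iff.1 (hV.preimage (continuous_snd (X := Y)))
  exact ⟨O, hO, fun y z => (Set.ext_iff.1 hOV (y, z))⟩

theorem isEmbedding_sliceImage [T0Space Z] (he : IsEmbedding e) (K : NonemptyCompacts Y) :
    IsEmbedding (sliceImage he.continuous K) := by
  refine IsInducing.isEmbedding (isInducing_iff_nhds.2 fun z => le_antisymm
    (continuous_sliceImage he.continuous K).continuousAt.le_comap ?_)
  intro V hV
  obtain ⟨V', hVV, hVo, hz⟩ := mem_nhds_iff.1 hV
  obtain ⟨O, hO, hOV⟩ := exists_isOpen_of_isOpen he hVo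
  refine ⟨{L | (L : Set W) ⊆ O}, (NonemptyCompacts.isOpen_subsets_of_isOpen hO).mem_nhds ?_, ?_⟩
  · rintro _ ⟨y, -, rfl⟩
    exact (hOV y z).2 hz
  · intro z' hz'
    obtain ⟨y, hy⟩ := K.nonempty
    exact hVV ((hOV y z').1 (hz' ⟨y, hy, rfl⟩))

theorem eq_sliceImage_of_mem_closure (he : IsEmbedding e) (K : NonemptyCompacts Y)
    {L : NonemptyCompacts W} (hL : L ∈ closure (range (sliceImage he.continuous K)))
    {y : Y} {z : Z} (hyz : e (y, z) ∈ (L : Set W)) : L = sliceImage he.continuous K z := by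
  by_contra hne
  obtain ⟨O₁, O₂, hO₁, hO₂, hL₁, hz₂, hd⟩ := t2_separation hne
  obtain ⟨O, hO, hOV⟩ := exists_isOpen_of_isOpen he
    (hO₂.preimage (continuous_sliceImage he.continuous K))
  obtain ⟨_, ⟨h1, x, hx, hxO⟩, z', rfl⟩ := mem_closure_iff.1 hL
    (O₁ ∩ {L | ((L : Set W) ∩ O).Nonempty})
    (hO₁.inter (NonemptyCompacts.isOpen_inter_nonempty_of_isOpen hO))
    ⟨hL₁, _, hyz, (hOV y z).2 hz₂⟩
  obtain ⟨y', -, rfl⟩ := hx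
  exact disjoint_left.1 hd h1 ((hOV y' z').1 hxO)

theorem exists_finite_approx [CompactSpace W] (he : IsEmbedding e) (K : NonemptyCompacts Y)
    {L : NonemptyCompacts W} (hL : L ∈ closure (range (sliceImage he.continuous K)))
    {ε : ℝ} (hε : 0 < ε) : ∃ D : Set W, D.Finite ∧ D ⊆ range e ∧
      (∀ x ∈ D, Metric.infDist x (L : Set W) ≤ ε) ∧ ∀ x ∈ (L : Set W), ∃ d ∈ D, dist x d < ε := by
  obtain ⟨_, ⟨z, rfl⟩, hz⟩ := Metric.mem_closure_iff.1 hL (ε / 2) (half_pos hε)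
  rw [Metric.NonemptyCompacts.dist_eq] at hz
  set J := sliceImage he.continuous K z
  obtain ⟨D, hDJ, hDf, hD⟩ := J.isCompact.finite_cover_balls (half_pos hε)
  have hfin : Metric.hausdorffEDist (L : Set W) J ≠ ⊤ :=
    Metric.hausdorffEDist_ne_top_of_nonempty_of_bounded L.nonempty J.nonempty
      L.isCompact.isBounded J.isCompact.isBounded
  refine ⟨D, hDf, ?_, fun x hx => ?_, fun x hx => ?_⟩
  · intro x hx
    obtain ⟨y, -, rfl⟩ := hDJ hx
    exact mem_range_self _
  · rw [Metric.hausdorffDist_comm] at hz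
    have := Metric.infDist_le_hausdorffDist_of_mem (hDJ hx)
      (by rwa [Metric.hausdorffEDist_comm] at hfin)
    linarith
  · obtain ⟨y, hy, hxy⟩ := Metric.exists_dist_lt_of_hausdorffDist_lt hx hz hfin
    obtain ⟨d, hd, hyd⟩ := mem_iUnion₂.1 (hD hy)
    refine ⟨d, hd, ?_⟩
    have := dist_triangle x y d
    have := Metric.mem_ball.1 hyd
    linarith

end Slice

theorem pi11Hard_F0 {Y Z W : Type*} [TopologicalSpace Y] [MetrizableSpace Y]
    [TopologicalSpace Z] [MetrizableSpace Z] [MetricSpace W] [CompactSpace W] {e : Y × Z → W}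
    (he : IsEmbedding e) {K : Set Y} (hK : IsCompact K) (hKn : ¬ Sep0 K)
    {g : (ℕ → ℕ) → Z} (hg : Continuous g) (hgs : Function.Surjective g)
    (hZ : ¬ SigmaCompactSpace Z) :
    @Pi11Hard _ ((vietoris W).induced fun F : Cl (Y × Z) => closure (e '' F.1))
      (F0 (Y × Z)) := by
  intro A' hA'
  have hne : K.Nonempty :=
    nonempty_iff_ne_empty.2 fun h => hKn (h ▸ sep0_empty)
  let K' : NonemptyCompacts Y := ⟨⟨K, hK⟩, hne⟩
  let j := sliceImage he.continuous K'
  have hj : IsEmbedding j := isEmbedding_sliceImage he K'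
  have hja : MeasureTheory.AnalyticSet (range j) := by
    rw [← hgs.range_comp j]
    exact MeasureTheory.analyticSet_range_of_polishSpace (hj.continuous.comp hg)
  have hjs : ¬ IsSigmaCompact (range j) := by
    rw [← image_univ, ← hj.isSigmaCompact_iff]
    exact fun h => hZ (isSigmaCompact_univ_iff.1 h)
  obtain ⟨H, hH, hHj⟩ := exists_cantor_map_of_not_isSigmaCompact hja hjs
  obtain ⟨R, hR, hRc, hRd, hRA⟩ := exists_closed_rel hA'
  have hcl : ∀ q, H q ∈ closure (range j) := by
    intro q
    refine map_mem_closure hH (mem_closure_frequently_true q) fun β hβ => ?_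
    exact (hHj β).2 hβ
  obtain ⟨P, hPE, hPc, hPsub, hPH, hPo, hPu⟩ := exists_family_of_approximation hH hR hRc hRd
    (E := range e) fun q _ ε hε => exists_finite_approx he K' (hcl q) hε
  have hclos : ∀ α, closure (e '' (e ⁻¹' closure (P α))) = closure (P α) := by
    intro α
    refine subset_antisymm (closure_minimal (image_preimage_subset _ _) isClosed_closure)
      (closure_mono ?_)
    intro x hx
    obtain ⟨p, rfl⟩ := hPE α hx
    exact ⟨p, subset_closure hx, rfl⟩
  refine ⟨fun α => ⟨e ⁻¹' closure (P α), isClosed_closure.preimage he.continuous⟩, ?_, ?_⟩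
  · refine continuous_induced_rng.2 (continuous_generateFrom_iff.2 ?_)
    rintro _ (⟨U, hU, rfl⟩ | ⟨U, hU, rfl⟩)
    · convert hPu U hU using 1
      ext α
      simp [hclos]
    · convert hPo U hU using 1
      ext α
      simp only [Function.comp_def, hclos, mem_preimage, mem_ofPred_eq]
      exact closure_inter_open_nonempty_iff hU
  · ext α
    have hclosed : IsClosed (e ⁻¹' closure (P α)) := isClosed_closure.preimage he.continuous
    change α ∈ A' ↔ DimLE ↥(e ⁻¹' closure (P α)) 0
    rw [hclosed.dimLE_zero_iff]
    constructor
    · intro hα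
      refine Set.Countable.sep0 (((hPc α).preimage he.injective).mono fun p hp => ?_) hclosed
      rcases hPsub α _ hp with h | ⟨θ, hθ, hpθ⟩
      · exact h
      · refine absurd ((hHj θ).1 ?_) ((hRA α).1 hα θ hθ)
        exact ⟨p.2, (eq_sliceImage_of_mem_closure he K' (hcl θ) hpθ).symm⟩
    · intro hS
      rw [hRA]
      intro β hβ hinf
      obtain ⟨z, hz⟩ := (hHj β).2 hinf
      refine hKn (hS.of_prodMk hK.isClosed (z := z) fun y hy => hPH α β hβ ?_)
      rw [← hz]
      exact ⟨y, hy, rfl⟩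

theorem not_dimLE_zero_iff {Y Z : Type*} [TopologicalSpace Y] [MetrizableSpace Y]
    [SigmaCompactSpace Y] [TopologicalSpace Z] [MetrizableSpace Z] [SecondCountableTopology Z]
    (hZ : Sep0 (univ : Set Z)) {F : Set (Y × Z)} (hF : IsClosed F) :
    ¬ DimLE ↥F 0 ↔ ∃ n, ∃ p ∈ F, ∃ q ∈ F, p.2 = q.2 ∧ p.1 ≠ q.1 ∧ p.1 ∈ compactCovering Y n ∧
      q.1 ∈ compactCovering Y n ∧ ∀ U V : Set Y, IsOpen U → IsOpen V → Disjoint U V →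
        p.1 ∈ U → q.1 ∈ V → ∃ y ∈ compactCovering Y n, (y, p.2) ∈ F ∧ y ∉ U ∪ V := by
  rw [hF.dimLE_zero_iff]
  constructor
  · intro h
    by_contra! hc
    refine h ?_
    have hU : F = ⋃ n, F ∩ Prod.fst ⁻¹' compactCovering Y n := by
      rw [← inter_iUnion, ← preimage_iUnion, iUnion_compactCovering, preimage_univ, inter_univ]
    rw [hU]
    refine sep0_of_iUnion (hU ▸ hF) fun n => ?_
    have hK := isCompact_compactCovering Y n
    refine sep0_of_fibers hZ hK hF fun z => IsCompact.sep0 ?_ ?_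
    · exact hK.inter_right (hF.preimage (f := fun y : Y => (y, z)) (by fun_prop))
    · rintro a ⟨ha, haF⟩ b ⟨hb, hbF⟩ hab
      obtain ⟨U, V, hU, hV, hUV, haU, hbV, hy⟩ := hc n (a, z) haF (b, z) hbF rfl hab ha hb
      exact ⟨U, V, hU, hV, hUV, fun y hy' => hy y hy'.1 hy'.2, haU, hbV⟩
  · rintro ⟨n, ⟨a, z⟩, hp, ⟨b, z'⟩, hq, hz, hab, ha, hb, h⟩ hS
    obtain rfl : z = z' := hz
    obtain ⟨U, V, hU, hV, hUV, hFUV, hAU, hBV⟩ := hS.exists_open (A := {(a, z)}) (B := {(b, z)})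
      isClosed_singleton isClosed_singleton (by simpa using hab)
    have hc : Continuous fun y : Y => (y, z) := by fun_prop
    obtain ⟨y, -, hy, hn⟩ := h _ _ (hU.preimage hc) (hV.preimage hc) (hUV.preimage _)
      (hAU ⟨rfl, hp⟩) (hBV ⟨rfl, hq⟩)
    exact hn (hFUV hy)

theorem exists_polish_surjection {Y : Type*} [TopologicalSpace Y] [MetrizableSpace Y]
    [SigmaCompactSpace Y] [Nonempty Y] :
    ∃ f : (ℕ → ℕ) → Y, Continuous f ∧ Function.Surjective f := by
  have h : MeasureTheory.AnalyticSet (univ : Set Y) := by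
    rw [← iUnion_compactCovering]
    refine MeasureTheory.AnalyticSet.iUnion fun n => ?_
    have : CompactSpace (compactCovering Y n) :=
      isCompact_iff_compactSpace.1 (isCompact_compactCovering Y n)
    let _ := metrizableSpaceMetric (compactCovering Y n)
    rw [← Subtype.range_coe (s := compactCovering Y n)]
    exact MeasureTheory.analyticSet_range_of_polishSpace continuous_subtype_val
  rw [MeasureTheory.AnalyticSet] at h
  rcases h with h | ⟨f, hf, hr⟩
  · exact absurd h univ_nonempty.ne_empty
  · exact ⟨f, hf, range_eq_univ.1 hr⟩

theorem isClosed_setOf_mem_nonemptyCompacts {T W : Type*} [TopologicalSpace T] [MetricSpace W]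
    {u : T → W} {L : T → NonemptyCompacts W} (hu : Continuous u) (hL : Continuous L) :
    IsClosed {t | u t ∈ (L t : Set W)} := by
  rw [← isOpen_compl_iff, isOpen_iff_mem_nhds]
  intro t ht
  obtain ⟨U, V, hU, hV, hLU, htV, hUV⟩ := (L t).isCompact.separation_of_notMem ht
  filter_upwards [hu.continuousAt (hV.mem_nhds htV),
    hL.continuousAt ((NonemptyCompacts.isOpen_subsets_of_isOpen hU).mem_nhds hLU)] with s hs hs' h
  exact disjoint_left.1 hUV (hs' h) hs

/-- The space of pairs of a compact set and a coded witness that it is not zero-dimensional. -/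
abbrev WitnessSpace (W P : Type*) [TopologicalSpace W] : Type _ :=
  NonemptyCompacts W × (ℕ → P) × P × P

theorem analyticSet_compl_F0 {Y Z W : Type*} [TopologicalSpace Y] [MetrizableSpace Y]
    [SigmaCompactSpace Y] [TopologicalSpace Z] [MetrizableSpace Z]
    [SecondCountableTopology Z] [MetricSpace W] [CompactSpace W]
    {e : Y × Z → W} (he : IsEmbedding e) (hZ : Sep0 (univ : Set Z))
    {P : Type*} [TopologicalSpace P] [PolishSpace P] {f : P → Y × Z} (hf : Continuous f)
    (hfs : Function.Surjective f) :
    @MeasureTheory.AnalyticSet _ ((vietoris W).induced fun F : Cl (Y × Z) => closure (e '' F.1))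
      (F0 (Y × Z))ᶜ := by
  have : PolishSpace (NonemptyCompacts W) := inferInstance
  have : PolishSpace (WitnessSpace W P) := inferInstance
  let B : ℕ → Set (WitnessSpace W P) := fun n =>
    {t | ∀ i, e (f (t.2.1 i)) ∈ (t.1 : Set W)} ∩
    {t | ∀ U ∈ countableBasis W, ((t.1 : Set W) ∩ U).Nonempty → ∃ i, e (f (t.2.1 i)) ∈ U} ∩
    {t | e (f t.2.2.1) ∈ (t.1 : Set W)} ∩ {t | e (f t.2.2.2) ∈ (t.1 : Set W)} ∩
    {t | (f t.2.2.1).2 = (f t.2.2.2).2} ∩ {t | (f t.2.2.1).1 ≠ (f t.2.2.2).1} ∩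
    {t | (f t.2.2.1).1 ∈ compactCovering Y n} ∩ {t | (f t.2.2.2).1 ∈ compactCovering Y n} ∩
    {t | ∀ U V : Set Y, IsOpen U → IsOpen V → Disjoint U V →
      (f t.2.2.1).1 ∈ U → (f t.2.2.2).1 ∈ V → ∃ y ∈ compactCovering Y n,
        e (y, (f t.2.2.1).2) ∈ (t.1 : Set W) ∧ y ∉ U ∪ V}
  have hB : ∀ n, MeasureTheory.AnalyticSet (B n) := by
    intro n
    let _ : MeasurableSpace (WitnessSpace W P) := borel (WitnessSpace W P)
    have : BorelSpace (WitnessSpace W P) := ⟨rfl⟩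
    have hK := isCompact_compactCovering Y n
    refine MeasurableSet.analyticSet ?_
    refine (((((((MeasurableSet.inter ?_ ?_).inter ?_).inter ?_).inter ?_).inter ?_).inter
      ?_).inter ?_).inter ?_
    · rw [ofPred_forall]
      exact (isClosed_iInter fun i => isClosed_setOf_mem_nonemptyCompacts
        (he.continuous.comp (hf.comp (by fun_prop))) continuous_fst).measurableSet
    · simp only [ofPred_forall]
      refine MeasurableSet.biInter (countable_countableBasis W) fun U hU => ?_
      have hUo := isOpen_of_mem_countableBasis hU
      have h1 : IsOpen {t : WitnessSpace W P | ((t.1 : Set W) ∩ U).Nonempty} :=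
        (NonemptyCompacts.isOpen_inter_nonempty_of_isOpen hUo).preimage continuous_fst
      have h2 : IsOpen {t : WitnessSpace W P | ∃ i, e (f (t.2.1 i)) ∈ U} := by
        rw [ofPred_exists]
        exact isOpen_iUnion fun i => hUo.preimage (he.continuous.comp (hf.comp (by fun_prop)))
      convert h1.measurableSet.compl.union h2.measurableSet using 1
      ext t
      simp only [mem_union, mem_compl_iff, mem_ofPred_eq]
      tauto
    · exact (isClosed_setOf_mem_nonemptyCompacts (he.continuous.comp (hf.comp (by fun_prop)))
        continuous_fst).measurableSet
    · exact (isClosed_setOf_mem_nonemptyCompacts (he.continuous.comp (hf.comp (by fun_prop)))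
        continuous_fst).measurableSet
    · exact (isClosed_eq (by fun_prop) (by fun_prop)).measurableSet
    · exact (isOpen_ne_fun (by fun_prop) (by fun_prop)).measurableSet
    · exact (hK.isClosed.preimage (f := fun t : (WitnessSpace W P) => (f t.2.2.1).1)
        (by fun_prop)).measurableSet
    · exact (hK.isClosed.preimage (f := fun t : (WitnessSpace W P) => (f t.2.2.2).1)
        (by fun_prop)).measurableSet
    · refine IsClosed.measurableSet ?_
      simp only [ofPred_forall]
      refine isClosed_iInter fun U => isClosed_iInter fun V => isClosed_iInter fun hU =>
        isClosed_iInter fun hV => isClosed_iInter fun _ => ?_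
      have h1 : IsClosed {t : WitnessSpace W P | (f t.2.2.1).1 ∈ U}ᶜ :=
        (hU.preimage (f := fun t : (WitnessSpace W P) => (f t.2.2.1).1) (by fun_prop)).isClosed_compl
      have h2 : IsClosed {t : WitnessSpace W P | (f t.2.2.2).1 ∈ V}ᶜ :=
        (hV.preimage (f := fun t : (WitnessSpace W P) => (f t.2.2.2).1) (by fun_prop)).isClosed_compl
      have h3 : IsClosed {t : WitnessSpace W P | ∃ y ∈ compactCovering Y n, (t, y) ∈
          {s : (WitnessSpace W P) × Y | e (s.2, (f s.1.2.2.1).2) ∈ (s.1.1 : Set W) ∧ s.2 ∉ U ∪ V}} := by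
        refine isClosed_setOf_exists_of_compact hK (IsClosed.inter ?_ ?_)
        · exact isClosed_setOf_mem_nonemptyCompacts (he.continuous.comp (by fun_prop))
            (continuous_fst.comp continuous_fst)
        · exact (hU.union hV).isClosed_compl.preimage continuous_snd
      convert (h1.union h2).union h3 using 1
      ext t
      simp only [mem_union, mem_compl_iff, mem_ofPred_eq]
      rw [imp_iff_not_or, imp_iff_not_or, or_assoc]
  let Ψ : (WitnessSpace W P) → Cl (Y × Z) := fun t =>
    ⟨e ⁻¹' (t.1 : Set W), t.1.isCompact.isClosed.preimage he.continuous⟩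
  have hclos : ∀ n, ∀ t ∈ B n, closure (e '' (e ⁻¹' (t.1 : Set W))) = t.1 := by
    rintro n t ⟨⟨⟨⟨⟨⟨⟨⟨h1, h2⟩, -⟩, -⟩, -⟩, -⟩, -⟩, -⟩, -⟩
    refine subset_antisymm (closure_minimal (image_preimage_subset _ _) t.1.isCompact.isClosed) ?_
    intro x hx
    rw [(isBasis_countableBasis W).mem_closure_iff]
    intro U hU hxU
    obtain ⟨i, hi⟩ := h2 U hU ⟨x, hx, hxU⟩
    exact ⟨_, hi, f (t.2.1 i), h1 i, rfl⟩
  have hrange : (F0 (Y × Z))ᶜ = ⋃ n, Ψ '' B n := by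
    ext ⟨F, hF⟩
    change ¬ DimLE ↥F 0 ↔ _
    rw [not_dimLE_zero_iff hZ hF, mem_iUnion]
    refine exists_congr fun n => ?_
    constructor
    · rintro ⟨p, hp, q, hq, hz, hab, ha, hb, h⟩
      obtain ⟨w, rfl⟩ := hfs p
      obtain ⟨w', rfl⟩ := hfs q
      have hFL : e ⁻¹' closure (e '' F) = F := by
        rw [← he.isInducing.closure_eq_preimage_closure_image, hF.closure_eq]
      have : Nonempty F := ⟨⟨_, hp⟩⟩
      have : SecondCountableTopology Y := by
        let _ := metrizableSpaceMetric Y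
        exact EMetric.secondCountable_of_sigmaCompact Y
      obtain ⟨s, hs⟩ := exists_dense_seq F
      choose x hx using fun i => hfs (s i).1
      have hmem : ∀ p, e p ∈ closure (e '' F) ↔ p ∈ F := fun p => Set.ext_iff.1 hFL p
      refine ⟨(⟨⟨closure (e '' F), isClosed_closure.isCompact⟩, _,
        subset_closure (mem_image_of_mem e hp)⟩, x, w, w'), ?_, Subtype.ext hFL⟩
      refine ⟨⟨⟨⟨⟨⟨⟨⟨fun i => ?_, fun U hU hUn => ?_⟩, (hmem _).2 hp⟩, (hmem _).2 hq⟩, hz⟩, hab⟩,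
        ha⟩, hb⟩, fun U V hU hV hd hpU hqV => ?_⟩
      · change e (f (x i)) ∈ closure (e '' F)
        rw [hx, hmem]
        exact (s i).2
      · have hUo := isOpen_of_mem_countableBasis hU
        obtain ⟨_, hpU, p, hpF, rfl⟩ := (closure_inter_open_nonempty_iff hUo).1 hUn |>.imp
          fun _ h => And.intro h.2 h.1
        obtain ⟨i, hi⟩ := hs.exists_mem_open
          (hUo.preimage (he.continuous.comp continuous_subtype_val)) ⟨⟨p, hpF⟩, hpU⟩
        refine ⟨i, ?_⟩
        change e (f (x i)) ∈ U
        rw [hx]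
        exact hi
      · obtain ⟨y, hy, hyF, hn⟩ := h U V hU hV hd hpU hqV
        exact ⟨y, hy, (hmem _).2 hyF, hn⟩
    · rintro ⟨t, ht, hΨ⟩
      obtain rfl : e ⁻¹' (t.1 : Set W) = F := congrArg Subtype.val hΨ
      obtain ⟨⟨⟨⟨⟨⟨⟨-, h3⟩, h4⟩, h5⟩, h6⟩, h7⟩, h8⟩, h9⟩ := ht
      exact ⟨f t.2.2.1, h3, f t.2.2.2, h4, h5, h6, h7, h8, h9⟩
  rw [hrange]
  let _ : TopologicalSpace (Cl (Y × Z)) :=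
    (vietoris W).induced fun F : Cl (Y × Z) => closure (e '' F.1)
  refine MeasureTheory.AnalyticSet.iUnion fun n => (hB n).image_of_continuousOn ?_
  rw [continuousOn_iff_continuous_domRestrict]
  refine continuous_induced_rng.2 (continuous_generateFrom_iff.2 ?_)
  have hcl : ∀ t : B n, closure (e '' (Ψ t.1).1) = t.1.1 := fun t => hclos n t.1 t.2
  have hc : Continuous fun t : B n => (t.1 : WitnessSpace W P).1 :=
    continuous_fst.comp continuous_subtype_val
  rintro _ (⟨U, hU, rfl⟩ | ⟨U, hU, rfl⟩)
  · convert (NonemptyCompacts.isOpen_subsets_of_isOpen hU).preimage hc using 1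
    ext t
    simp [hcl]
  · convert (NonemptyCompacts.isOpen_inter_nonempty_of_isOpen hU).preimage hc using 1
    ext t
    simp [hcl]

theorem sep0_univ_of_exists_isClopen {Z : Type*} [TopologicalSpace Z] [SecondCountableTopology Z]
    (h : ∀ z : Z, ∀ U, IsOpen U → z ∈ U → ∃ O, IsClopen O ∧ z ∈ O ∧ O ⊆ U) :
    Sep0 (univ : Set Z) := by
  intro A B hA hB hAB
  have hO : ∀ z : Z, ∃ O, IsClopen O ∧ z ∈ O ∧ (Disjoint O A ∨ Disjoint O B) := by
    intro z
    by_cases hz : z ∈ A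
    · obtain ⟨O, hO, hzO, hOB⟩ := h z Bᶜ hB.isOpen_compl (disjoint_left.1 hAB hz)
      exact ⟨O, hO, hzO, Or.inr (subset_compl_iff_disjoint_right.1 hOB)⟩
    · obtain ⟨O, hO, hzO, hOA⟩ := h z Aᶜ hA.isOpen_compl hz
      exact ⟨O, hO, hzO, Or.inl (subset_compl_iff_disjoint_right.1 hOA)⟩
  choose O hO hzO hOAB using hO
  obtain ⟨s, hs, hsU⟩ := _root_.countable_cover_nhds fun z => (hO z).isOpen.mem_nhds (hzO z)
  rcases s.eq_empty_or_nonempty with rfl | hne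
  · have : (univ : Set Z) = ∅ := by simpa using hsU.symm
    rw [this]
    exact sep0_empty A B hA hB hAB
  obtain ⟨c, rfl⟩ := hs.exists_eq_range hne
  let Q : ℕ → Set Z := disjointed fun n => O (c n)
  have hQ : ∀ n, IsClopen (Q n) := fun n =>
    disjointedRec (f := fun n => O (c n)) (p := IsClopen) (fun _ _ ht => ht.diff (hO _)) (hO _)
  have hQO : ∀ n, Q n ⊆ O (c n) := fun n => disjointed_subset _ n
  have hQU : ⋃ n, Q n = univ := by
    rw [iUnion_disjointed, ← hsU, biUnion_range]
  let N : Set ℕ := {n | Disjoint (O (c n)) B}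
  have hd : Disjoint (⋃ n ∈ N, Q n) (⋃ n ∈ Nᶜ, Q n) := by
    simp only [disjoint_iUnion_left, disjoint_iUnion_right]
    intro i hi j hj
    refine disjoint_disjointed _ ?_
    rintro rfl
    exact absurd hj hi
  have hu : (⋃ n ∈ N, Q n) ∪ (⋃ n ∈ Nᶜ, Q n) = univ := by
    rw [← biUnion_union, union_compl_self, biUnion_univ, hQU]
  have hc := IsCompl.of_eq (disjoint_iff.1 hd) hu
  refine ⟨⋃ n ∈ N, Q n, ⋃ n ∈ Nᶜ, Q n, ?_, ?_, hd, hu, ?_, ?_⟩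
  · rw [hc.eq_compl]
    exact (isOpen_biUnion fun n _ => (hQ n).isOpen).isClosed_compl
  · rw [hc.symm.eq_compl]
    exact (isOpen_biUnion fun n _ => (hQ n).isOpen).isClosed_compl
  · rintro z ⟨hz, -⟩
    obtain ⟨n, hn⟩ := mem_iUnion.1 (hQU ▸ mem_univ z)
    refine mem_biUnion (x := n) ?_ hn
    exact (hOAB (c n)).resolve_left fun h => disjoint_left.1 h (hQO n hn) hz
  · rintro z ⟨hz, -⟩
    obtain ⟨n, hn⟩ := mem_iUnion.1 (hQU ▸ mem_univ z)
    refine mem_biUnion (x := n) ?_ hn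
    exact fun h => disjoint_left.1 h (hQO n hn) hz

theorem dimLE_irrational : DimLE {x : ℝ // Irrational x} 0 := by
  refine Sep0.dimLE_zero (sep0_univ_of_exists_isClopen fun z U hU hz => ?_)
  obtain ⟨V, hV, rfl⟩ := isOpen_induced_iff.1 hU
  obtain ⟨a, b, hab, hV'⟩ := mem_nhds_iff_exists_Ioo_subset.1 (hV.mem_nhds hz)
  obtain ⟨p, hp, hpz⟩ := exists_rat_btwn hab.1
  obtain ⟨q, hzq, hq⟩ := exists_rat_btwn hab.2
  refine ⟨Subtype.val ⁻¹' Ioo (p : ℝ) q, ⟨?_, isOpen_Ioo.preimage continuous_subtype_val⟩,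
    ⟨hpz, hzq⟩, fun x hx => hV' ⟨hp.trans hx.1, hx.2.trans hq⟩⟩
  have : (Subtype.val ⁻¹' Ioo (p : ℝ) q : Set {x : ℝ // Irrational x}) =
      Subtype.val ⁻¹' Icc (p : ℝ) q := by
    ext x
    exact ⟨fun h => ⟨h.1.le, h.2.le⟩, fun h =>
      ⟨h.1.lt_of_ne (x.2.ne_rat p).symm, h.2.lt_of_ne (x.2.ne_rat q)⟩⟩
  rw [this]
  exact isClosed_Icc.preimage continuous_subtype_val

theorem isAnalyticSpace_irrational : IsAnalyticSpace {x : ℝ // Irrational x} := by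
  refine ⟨inferInstance, inferInstance, Or.inr ?_⟩
  have h : MeasureTheory.AnalyticSet {x : ℝ | Irrational x} :=
    IsGδ.setOfPred_irrational.measurableSet.analyticSet
  rw [MeasureTheory.AnalyticSet] at h
  rcases h with h | ⟨f, hf, hr⟩
  · exact absurd h dense_irrational.nonempty.ne_empty
  · have hmem : ∀ b, Irrational (f b) := fun b => hr.subset (mem_range_self b)
    refine ⟨fun b => ⟨f b, hmem b⟩, hf.subtype_mk hmem, fun x => ?_⟩
    obtain ⟨b, hb⟩ := hr.symm.subset x.2
    exact ⟨b, Subtype.ext hb⟩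

theorem not_sigmaCompactSpace_irrational : ¬ SigmaCompactSpace {x : ℝ // Irrational x} := by
  intro h
  have hr : {x : ℝ | Irrational x} =
      ⋃ n, Subtype.val '' compactCovering {x : ℝ // Irrational x} n := by
    rw [← image_iUnion, iUnion_compactCovering, image_univ, Subtype.range_coe_subtype]
  have hG : IsGδ {x : ℝ | Irrational x}ᶜ := by
    rw [hr, compl_iUnion]
    exact .iInter_of_isOpen fun n =>
      ((isCompact_compactCovering _ n).image continuous_subtype_val).isClosed.isOpen_compl
  have hD : Dense {x : ℝ | Irrational x}ᶜ :=
    Rat.denseRange_cast.mono (by rintro _ ⟨q, rfl⟩; exact q.not_irrational)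
  have := (dense_irrational.inter_of_Gδ .setOfPred_irrational hG hD).nonempty
  rw [inter_compl_self] at this
  exact this.ne_empty rfl

theorem not_dimLE_zero_of_preconnectedSpace {X : Type*} [TopologicalSpace X] [PreconnectedSpace X]
    [T1Space X] [Nontrivial X] : ¬ DimLE X 0 := by
  intro h
  obtain ⟨a, b, hab⟩ := exists_pair_ne X
  obtain ⟨C, D, hC, hD, hCD, hun, hAC, hBD⟩ := h.sep0_univ {a} {b} isClosed_singleton
    isClosed_singleton (disjoint_singleton.2 hab)
  have hc := IsCompl.of_eq (disjoint_iff.1 hCD) hun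
  have hCo : IsClopen C := ⟨hC, by rw [hc.eq_compl]; exact hD.isOpen_compl⟩
  have ha : a ∈ C := hAC ⟨rfl, mem_univ _⟩
  have hb : b ∈ D := hBD ⟨rfl, mem_univ _⟩
  rcases isClopen_iff.1 hCo with rfl | rfl
  · exact ha
  · exact disjoint_left.1 hCD (mem_univ b) hb

theorem F0_pi11_complete_of_sigmaCompact_prod {Y Z : Type*} [TopologicalSpace Y]
    [MetrizableSpace Y] [SigmaCompactSpace Y] [TopologicalSpace Z] (hY : ¬ DimLE Y 0)
    (hZ : IsAnalyticSpace Z) (hZ0 : DimLE Z 0) (hZs : ¬ SigmaCompactSpace Z)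
    {τ : TopologicalSpace (Cl (Y × Z))} (hτ : IsAdmissible (Y × Z) τ) :
    @MeasureTheory.AnalyticSet _ τ ((F0 (Y × Z))ᶜ) ∧ @Pi11Hard _ τ (F0 (Y × Z)) := by
  obtain ⟨W, tW, hWc, hWm, e, he, rfl⟩ := hτ
  obtain ⟨hZm, hZsep, hZe⟩ := hZ
  let _ := metrizableSpaceMetric W
  have : SecondCountableTopology Z := by
    let _ := metrizableSpaceMetric Z
    exact UniformSpace.secondCountable_of_separable Z
  rcases hZe with hZe | ⟨g, hg, hgs⟩
  · exact (hZs inferInstance).elim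
  obtain ⟨K, hK, hKn⟩ := exists_isCompact_not_sep0 hY
  have hne : K.Nonempty :=
    nonempty_iff_ne_empty.2 fun h => hKn (h ▸ sep0_empty)
  have : Nonempty Y := ⟨hne.some⟩
  obtain ⟨u, hu, hus⟩ := exists_polish_surjection (Y := Y)
  exact ⟨analyticSet_compl_F0 he hZ0.sep0_univ (hu.prodMap hg) (hus.prodMap hgs),
    pi11Hard_F0 he hK hKn hg hgs hZs⟩

/-- If `X = Y × Z` is the product of a `σ`-compact non-zero-dimensional separable
metrizable space `Y` and an analytic zero-dimensional non-`σ`-compact space `Z`, then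
`F₀(X)` is `Π¹₁`-complete. In particular `F₀([0,1] × ℙ)` is `Π¹₁`-complete, where `ℙ` is
the space of irrational numbers. -/
theorem F0_pi11_complete_of_prod :
    (∀ (Y Z : Type) [TopologicalSpace Y] [TopologicalSpace.MetrizableSpace Y]
        [TopologicalSpace.SeparableSpace Y] [SigmaCompactSpace Y] [TopologicalSpace Z],
      ¬ DimLE Y 0 → IsAnalyticSpace Z → DimLE Z 0 → ¬ SigmaCompactSpace Z →
      ∀ τ : TopologicalSpace (Cl (Y × Z)), IsAdmissible (Y × Z) τ →
        @MeasureTheory.AnalyticSet _ τ ((F0 (Y × Z))ᶜ) ∧ @Pi11Hard _ τ (F0 (Y × Z))) ∧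
    (∀ τ : TopologicalSpace (Cl (Set.Icc (0:ℝ) 1 × {x : ℝ // Irrational x})),
      IsAdmissible (Set.Icc (0:ℝ) 1 × {x : ℝ // Irrational x}) τ →
        @MeasureTheory.AnalyticSet _ τ ((F0 (Set.Icc (0:ℝ) 1 × {x : ℝ // Irrational x}))ᶜ) ∧
        @Pi11Hard _ τ (F0 (Set.Icc (0:ℝ) 1 × {x : ℝ // Irrational x}))) := by
  refine ⟨?_, ?_⟩
  · intro Y Z _ _ _ _ _ hY hZ hZ0 hZs τ hτ
    exact F0_pi11_complete_of_sigmaCompact_prod hY hZ hZ0 hZs hτ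
  · intro τ hτ
    exact F0_pi11_complete_of_sigmaCompact_prod not_dimLE_zero_of_preconnectedSpace
      isAnalyticSpace_irrational dimLE_irrational not_sigmaCompactSpace_irrational hτ
end

section
/- If H is a hypergraph and E ⊂ H is a subset such that π(E) is a nontrivial interval, then E is connected. In particular, every hypergraph is connected. -/
open Set Filter Topology

/-- `clusterVals f P a` : the set of cluster values of `f` (restricted to `P`) at `a`,
i.e. the limits of sequences `f xⱼ` with `xⱼ ∈ P`, `xⱼ → a`. -/
def clusterVals (f : ℝ → ℝ) (P : Set ℝ) (a : ℝ) : Set ℝ :=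
  {y | MapClusterPt y (nhdsWithin a P) f}

/-- `H` is a hypergraph witnessed by the interval `I`, the countable set `Q ⊆ I` and the
function `f` continuous on `P = I ∖ Q` : `G ⊆ H ⊆ cl G` where `G = graph of f on P`;
at every `a ∈ Q` the cluster-value set of `f` equals both the left and the right
cluster-value sets and is a nontrivial interval; `f` differs from a function continuous on
`I ∖ {a}` by a function having a limit at `a`; and every vertical section `H(a)`, `a ∈ Q`,
is dense in and has empty interior in `Ωf(a) = cl(G)(a)`. -/
def IsHypergraphWith (H : Set (ℝ × ℝ)) (I Q : Set ℝ) (f : ℝ → ℝ) : Prop :=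
  I.OrdConnected ∧ (∃ a ∈ I, ∃ b ∈ I, a < b) ∧ Q ⊆ I ∧ Q.Countable ∧
  ContinuousOn f (I \ Q) ∧
  Set.graphOn f (I \ Q) ⊆ H ∧ H ⊆ closure (Set.graphOn f (I \ Q)) ∧
  ∀ a ∈ Q,
    (clusterVals f (I \ Q) a = clusterVals f ((I \ Q) ∩ Set.Iic a) a ∧
     clusterVals f (I \ Q) a = clusterVals f ((I \ Q) ∩ Set.Ici a) a ∧
     (clusterVals f (I \ Q) a).OrdConnected ∧
     (∃ y ∈ clusterVals f (I \ Q) a, ∃ z ∈ clusterVals f (I \ Q) a, y < z)) ∧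
    (∃ g : ℝ → ℝ, ContinuousOn g (I \ {a}) ∧
      ∃ L : ℝ, Filter.Tendsto (fun x => f x - g x) (nhdsWithin a (I \ Q)) (nhds L)) ∧
    (∀ y ∈ clusterVals f (I \ Q) a, y ∈ closure {y' : ℝ | (a, y') ∈ H}) ∧
    (∀ U : Set ℝ, IsOpen U → (U ∩ clusterVals f (I \ Q) a).Nonempty →
      ¬ (U ∩ clusterVals f (I \ Q) a ⊆ {y' : ℝ | (a, y') ∈ H}))

/-- `H ⊆ ℝ²` is a hypergraph. -/
def IsHypergraph (H : Set (ℝ × ℝ)) : Prop := ∃ I Q f, IsHypergraphWith H I Q f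

/-- A set of the plane over a compact interval is preconnected if, off a countable set of abscissae,
it is locally controlled by its fibres, and over the countable set every point is a limit of points
strictly on the left and strictly on the right. -/
lemma isPreconnected_of_countable_exceptional {E : Set (ℝ × ℝ)} {D : Set ℝ} {c d : ℝ}
    (hcd : c < d) (hD : D.Countable) (hE : Prod.fst '' E = Icc c d)
    (hcont : ∀ p ∈ E, p.1 ∉ D → ∀ W, IsOpen W → p ∈ W →
      ∀ᶠ x in 𝓝 p.1, ∀ q ∈ E, q.1 = x → q ∈ W)
    (hleft : ∀ p ∈ E, p.1 ∈ D → ∀ W, IsOpen W → p ∈ W → c < p.1 → ∃ q ∈ E, q ∈ W ∧ q.1 < p.1)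
    (hright : ∀ p ∈ E, p.1 ∈ D → ∀ W, IsOpen W → p ∈ W → p.1 < d → ∃ q ∈ E, q ∈ W ∧ p.1 < q.1) :
    IsPreconnected E := by
  rw [isPreconnected_iff_subset_of_disjoint]
  intro U V hU hV hEUV hdisj
  have hnot : ∀ q ∈ E, q ∈ U → q ∈ V → False := fun q hq hqU hqV => by
    have : q ∈ E ∩ (U ∩ V) := ⟨hq, hqU, hqV⟩
    simp [hdisj] at this
  have hmem : ∀ q ∈ E, q.1 ∈ Icc c d := fun q hq => hE ▸ mem_image_of_mem _ hq
  have hfib : ∀ x ∈ Icc c d, ∃ q ∈ E, q.1 = x := fun x hx => by rwa [← hE] at hx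
  let S : Set (ℝ × ℝ) → Set ℝ := fun W => {x | ∀ᶠ x' in 𝓝 x, ∀ q ∈ E, q.1 = x' → q ∈ W}
  have hSo : ∀ W, IsOpen (S W) := fun W => isOpen_setOfPred_eventually_nhds
  have hSmem : ∀ W, ∀ q ∈ E, q.1 ∈ S W → q ∈ W := fun W q hq h => h.self_of_nhds q hq rfl
  have hsplit : ∀ K ⊆ Icc c d, K.OrdConnected → K ⊆ S U ∪ S V → K ⊆ S U ∨ K ⊆ S V := by
    intro K hK hKo hKS
    refine isPreconnected_iff_subset_of_disjoint.1 hKo.isPreconnected _ _ (hSo U) (hSo V) hKS ?_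
    rw [eq_empty_iff_forall_notMem]
    rintro x ⟨hxK, hxU, hxV⟩
    obtain ⟨q, hq, rfl⟩ := hfib x (hK hxK)
    exact hnot q hq (hSmem U q hq hxU) (hSmem V q hq hxV)
  let F : Set ℝ := Icc c d \ (S U ∪ S V)
  have hFc : IsClosed F := isClosed_Icc.sdiff ((hSo U).union (hSo V))
  have hFD : F ⊆ D := by
    rintro x ⟨hx, hxS⟩
    by_contra hxD
    obtain ⟨q, hq, rfl⟩ := hfib x hx
    rcases hEUV hq with h | h
    · exact hxS (Or.inl (hcont q hq hxD U hU h))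
    · exact hxS (Or.inr (hcont q hq hxD V hV h))
  rcases F.eq_empty_or_nonempty with hF | hF
  · rcases hsplit (Icc c d) Subset.rfl ordConnected_Icc (sdiff_eq_empty.1 hF) with h | h
    · exact Or.inl fun q hq => hSmem U q hq (h (hmem q hq))
    · exact Or.inr fun q hq => hSmem V q hq (h (hmem q hq))
  exfalso
  obtain ⟨a, haF, ha⟩ : ∃ a ∈ F, ¬ AccPt a (𝓟 F) := by
    by_contra! hacc
    obtain ⟨φ, hφ, -, hinj⟩ := Perfect.exists_nat_bool_injection ⟨hFc, hacc⟩ hF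
    have huncountable : Cardinal.aleph0 < Cardinal.mk (ℕ → Bool) := by
      simpa using Cardinal.cantor Cardinal.aleph0
    have h1 : (range φ).Countable := (hD.mono hFD).mono hφ
    have h2 : Countable (ℕ → Bool) := by
      have := h1.to_subtype
      exact (Equiv.ofInjective φ hinj).injective.countable
    exact (Cardinal.mk_le_aleph0_iff.2 h2).not_gt huncountable
  obtain ⟨l, r, ⟨hla, har⟩, hlr⟩ : ∃ l r, a ∈ Ioo l r ∧ Ioo l r ⊆ {x | x ∈ F → x = a} := by
    rw [accPt_iff_frequently, not_frequently] at ha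
    refine mem_nhds_iff_exists_Ioo_subset.1 (ha.mono fun x hx hxF => ?_)
    by_contra hne
    exact hx ⟨hne, hxF⟩
  have haD : a ∈ D := hFD haF
  have hcover : ∀ x ∈ Ioo l r, x ∈ Icc c d → x ≠ a → x ∈ S U ∪ S V := fun x hx hxc hne => by
    by_contra h
    exact hne (hlr hx ⟨hxc, h⟩)
  have hL : Ioo l a ∩ Icc c d ⊆ S U ∨ Ioo l a ∩ Icc c d ⊆ S V :=
    hsplit _ inter_subset_right (ordConnected_Ioo.inter ordConnected_Icc)
      fun x hx => hcover x ⟨hx.1.1, hx.1.2.trans har⟩ hx.2 hx.1.2.ne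
  have hR : Ioo a r ∩ Icc c d ⊆ S U ∨ Ioo a r ∩ Icc c d ⊆ S V :=
    hsplit _ inter_subset_right (ordConnected_Ioo.inter ordConnected_Icc)
      fun x hx => hcover x ⟨hla.trans hx.1.1, hx.1.2⟩ hx.2 hx.1.1.ne'
  have hstrip : ∀ W, IsOpen W → IsOpen (W ∩ Prod.fst ⁻¹' Ioo l r : Set (ℝ × ℝ)) := fun W hW =>
    hW.inter (isOpen_Ioo.preimage continuous_fst)
  have hleft' : ∀ W, IsOpen W → ∀ p ∈ E, p.1 = a → p ∈ W → c < a →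
      ∃ q ∈ E, q ∈ W ∧ q.1 ∈ Ioo l a ∩ Icc c d := by
    rintro W hW p hp rfl hpW hc
    obtain ⟨q, hq, ⟨hqW, hql⟩, hqa⟩ := hleft p hp haD _ (hstrip W hW) ⟨hpW, hla, har⟩ hc
    exact ⟨q, hq, hqW, ⟨hql.1, hqa⟩, hmem q hq⟩
  have hright' : ∀ W, IsOpen W → ∀ p ∈ E, p.1 = a → p ∈ W → a < d →
      ∃ q ∈ E, q ∈ W ∧ q.1 ∈ Ioo a r ∩ Icc c d := by
    rintro W hW p hp rfl hpW hc
    obtain ⟨q, hq, ⟨hqW, hql⟩, hqa⟩ := hright p hp haD _ (hstrip W hW) ⟨hpW, hla, har⟩ hc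
    exact ⟨q, hq, hqW, ⟨hqa, hql.2⟩, hmem q hq⟩
  have key : ∀ A B, IsOpen A → (∀ q ∈ E, q ∈ A → q ∈ B → False) →
      (Ioo l a ∩ Icc c d ⊆ S A ∨ Ioo l a ∩ Icc c d ⊆ S B) →
      (Ioo a r ∩ Icc c d ⊆ S A ∨ Ioo a r ∩ Icc c d ⊆ S B) →
      ∀ p ∈ E, p.1 = a → p ∈ A → Ioo l a ∩ Icc c d ⊆ S A ∧ Ioo a r ∩ Icc c d ⊆ S A := by
    intro A B hA hAB hLA hRA p hp hpa hpA
    constructor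
    · refine hLA.elim id fun h x hx => ?_
      obtain ⟨q, hq, hqA, hqI⟩ := hleft' A hA p hp hpa hpA (hx.2.1.trans_lt hx.1.2)
      exact (hAB q hq hqA (hSmem B q hq (h hqI))).elim
    · refine hRA.elim id fun h x hx => ?_
      obtain ⟨q, hq, hqA, hqI⟩ := hright' A hA p hp hpa hpA (hx.1.1.trans_le hx.2.2)
      exact (hAB q hq hqA (hSmem B q hq (h hqI))).elim
  have keyU := key U V hU hnot hL hR
  have keyV := key V U hV (fun q hq h h' => hnot q hq h' h) hL.symm hR.symm
  have hfinish : ∀ A, Ioo l a ∩ Icc c d ⊆ S A ∧ Ioo a r ∩ Icc c d ⊆ S A →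
      (∀ q ∈ E, q.1 = a → q ∈ A) → a ∈ S A := by
    rintro A ⟨h1, h2⟩ h3
    filter_upwards [Ioo_mem_nhds hla har] with x hx q hq hqx
    subst hqx
    rcases lt_trichotomy q.1 a with h | h | h
    · exact hSmem A q hq (h1 ⟨⟨hx.1, h⟩, hmem q hq⟩)
    · exact h3 q hq h
    · exact hSmem A q hq (h2 ⟨⟨h, hx.2⟩, hmem q hq⟩)
  have hmixed : ∀ p ∈ E, p.1 = a → p ∈ U → ∀ q ∈ E, q.1 = a → q ∈ V → False := by
    intro p hp hpa hpU q hq hqa hqV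
    obtain ⟨hLU, hRU⟩ := keyU p hp hpa hpU
    obtain ⟨hLV, hRV⟩ := keyV q hq hqa hqV
    rcases haF.1.1.lt_or_eq with h | h
    · obtain ⟨z, hz, -, hzI⟩ := hleft' U hU p hp hpa hpU h
      exact hnot z hz (hSmem U z hz (hLU hzI)) (hSmem V z hz (hLV hzI))
    · obtain ⟨z, hz, -, hzI⟩ := hright' U hU p hp hpa hpU (h ▸ hcd)
      exact hnot z hz (hSmem U z hz (hRU hzI)) (hSmem V z hz (hRV hzI))
  obtain ⟨p, hp, hpa⟩ := hfib a haF.1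
  rcases hEUV hp with hpU | hpV
  · exact haF.2 (Or.inl (hfinish U (keyU p hp hpa hpU) fun q hq hqa =>
      (hEUV hq).resolve_right fun hqV => hmixed p hp hpa hpU q hq hqa hqV))
  · exact haF.2 (Or.inr (hfinish V (keyV p hp hpa hpV) fun q hq hqa =>
      (hEUV hq).resolve_left fun hqU => hmixed q hq hqa hqU p hp hpa hpV))

lemma fst_mem_closure_of_mem_closure_graphOn {f : ℝ → ℝ} {P : Set ℝ} {p : ℝ × ℝ}
    (hp : p ∈ closure (graphOn f P)) : p.1 ∈ closure P :=
  map_mem_closure continuous_fst hp fun q hq => by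
    obtain ⟨x, hx, rfl⟩ := hq
    exact hx

lemma Set.OrdConnected.mem_of_mem_closure {I : Set ℝ} (hI : I.OrdConnected) {x y z : ℝ}
    (hx : x ∈ closure I) (hz : z ∈ closure I) (hxy : x < y) (hyz : y < z) : y ∈ I := by
  obtain ⟨x', hx'y, hx'⟩ := mem_closure_iff.1 hx _ isOpen_Iio hxy
  obtain ⟨z', hyz', hz'⟩ := mem_closure_iff.1 hz _ isOpen_Ioi hyz
  exact hI.out hx' hz' ⟨le_of_lt hx'y, le_of_lt hyz'⟩

lemma mem_clusterVals_of_mem_closure_graphOn {f : ℝ → ℝ} {P : Set ℝ} {a y : ℝ}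
    (h : (a, y) ∈ closure (graphOn f P)) : y ∈ clusterVals f P a := by
  refine mapClusterPt_iff_frequently.2 fun s hs => ?_
  rw [nhdsWithin, frequently_inf_principal, frequently_iff]
  intro t ht
  obtain ⟨q, hq, x, hx, rfl⟩ := mem_closure_iff_nhds.1 h _ (prod_mem_nhds ht hs)
  exact ⟨x, hq.1, hx, hq.2⟩

lemma exists_mem_of_mem_clusterVals {f : ℝ → ℝ} {P : Set ℝ} {a y : ℝ} (h : y ∈ clusterVals f P a)
    {W : Set (ℝ × ℝ)} (hW : W ∈ 𝓝 (a, y)) : ∃ t ∈ P, (t, f t) ∈ W := by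
  obtain ⟨s, hs, t, ht, hst⟩ := mem_nhds_prod_iff.1 hW
  have h1 := mapClusterPt_iff_frequently.1 h t ht
  rw [nhdsWithin, frequently_inf_principal, frequently_iff] at h1
  obtain ⟨x, hx, hxP, hxt⟩ := h1 hs
  exact ⟨x, hxP, hst ⟨hx, hxt⟩⟩

lemma eventually_mem_of_mem_closure_graphOn {f : ℝ → ℝ} {P : Set ℝ} {x : ℝ}
    (hf : ContinuousWithinAt f P x) {W : Set (ℝ × ℝ)} (hW : W ∈ 𝓝 (x, f x)) :
    ∀ᶠ t in 𝓝 x, ∀ q ∈ closure (graphOn f P), q.1 = t → q ∈ W := by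
  obtain ⟨C, hC, hCc, hCW⟩ := exists_mem_nhds_isClosed_subset hW
  have h1 : ∀ᶠ t in 𝓝[P] x, (t, f t) ∈ C :=
    (continuousWithinAt_id.prodMk hf).eventually hC
  filter_upwards [(eventually_nhdsWithin_iff.1 h1).eventually_nhds] with t ht q hq hqt
  subst hqt
  refine hCW (hCc.closure_subset_iff.2 Subset.rfl ?_)
  refine mem_closure_iff_nhds.2 fun N hN => ?_
  obtain ⟨z, ⟨hzN, hz⟩, s, hs, rfl⟩ := mem_closure_iff_nhds.1 hq _
    (inter_mem hN (continuous_fst.continuousAt.eventually ht))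
  exact ⟨_, hzN, hz hs⟩

lemma eq_of_mem_closure_graphOn {f : ℝ → ℝ} {P : Set ℝ} (hf : ContinuousOn f P) {p : ℝ × ℝ}
    (hp : p ∈ closure (graphOn f P)) (hpP : p.1 ∈ P) : p = (p.1, f p.1) := by
  by_contra hne
  exact (eventually_mem_of_mem_closure_graphOn (hf _ hpP)
    (isOpen_compl_singleton.mem_nhds (Ne.symm hne))).self_of_nhds p hp rfl rfl

namespace IsHypergraphWith

variable {H : Set (ℝ × ℝ)} {I Q : Set ℝ} {f : ℝ → ℝ}

lemma fst_mem_closure (hH : IsHypergraphWith H I Q f) {p : ℝ × ℝ} (hp : p ∈ H) :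
    p.1 ∈ closure I := by
  obtain ⟨-, -, -, -, -, -, hcl, -⟩ := hH
  exact closure_mono sdiff_subset (fst_mem_closure_of_mem_closure_graphOn (hcl hp))

lemma subset_image_fst (hH : IsHypergraphWith H I Q f) : I ⊆ Prod.fst '' H := by
  obtain ⟨-, -, -, -, -, hGH, -, hQ⟩ := hH
  intro x hx
  by_cases hxQ : x ∈ Q
  · obtain ⟨⟨-, -, -, y, hy, -⟩, -, hd, -⟩ := hQ x hxQ
    obtain ⟨z, -, hz⟩ := mem_closure_iff.1 (hd y hy) _ isOpen_univ trivial
    exact ⟨(x, z), hz, rfl⟩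
  · exact ⟨(x, f x), hGH ⟨x, ⟨hx, hxQ⟩, rfl⟩, rfl⟩

/-- The part of a hypergraph subset lying over a compact subinterval is preconnected. -/
lemma isPreconnected_inter_Icc (hH : IsHypergraphWith H I Q f) {E : Set (ℝ × ℝ)} (hEH : E ⊆ H)
    {c d : ℝ} (hcd : c < d) (hE : Icc c d ⊆ Prod.fst '' E) :
    IsPreconnected (E ∩ Prod.fst ⁻¹' Icc c d) := by
  have hclI : ∀ x ∈ Icc c d, x ∈ closure I := fun x hx => by
    obtain ⟨p, hp, rfl⟩ := hE hx
    exact hH.fst_mem_closure (hEH hp)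
  obtain ⟨hI, -, -, hQc, hf, -, hcl, hQ⟩ := hH
  have hgraph : ∀ t ∈ Icc c d, t ∈ I \ Q → (t, f t) ∈ E := fun t ht htP => by
    obtain ⟨p, hp, rfl⟩ := hE ht
    exact eq_of_mem_closure_graphOn hf (hcl (hEH hp)) htP ▸ hp
  have hc : c ∈ closure I := hclI c (left_mem_Icc.2 hcd.le)
  have hd : d ∈ closure I := hclI d (right_mem_Icc.2 hcd.le)
  refine isPreconnected_of_countable_exceptional (D := Q ∪ ({c, d} \ I)) hcd
    (hQc.union ((Set.toFinite {c, d}).countable.mono sdiff_subset)) ?_ ?_ ?_ ?_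
  · ext x
    constructor
    · rintro ⟨p, hp, rfl⟩
      exact hp.2
    · intro hx
      obtain ⟨p, hp, rfl⟩ := hE hx
      exact ⟨p, ⟨hp, hx⟩, rfl⟩
  · rintro p ⟨hpE, hpI⟩ hpD W hW hpW
    have hpP : p.1 ∈ I \ Q := by
      refine ⟨?_, fun h => hpD (Or.inl h)⟩
      by_contra hpnI
      have h1 : p.1 ≠ c := fun h => hpD (Or.inr ⟨Or.inl h, hpnI⟩)
      have h2 : p.1 ≠ d := fun h => hpD (Or.inr ⟨Or.inr h, hpnI⟩)
      exact hpnI (hI.mem_of_mem_closure hc hd (hpI.1.lt_of_ne' h1) (hpI.2.lt_of_ne h2))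
    rw [eq_of_mem_closure_graphOn hf (hcl (hEH hpE)) hpP] at hpW
    filter_upwards [eventually_mem_of_mem_closure_graphOn (hf _ hpP) (hW.mem_nhds hpW)]
      with t ht q hq hqt using ht q (hcl (hEH hq.1)) hqt
  · rintro p ⟨hpE, hpI⟩ hpD W hW hpW hcp
    have hW' : W ∩ Prod.fst ⁻¹' Ioi c ∈ 𝓝 p :=
      (hW.inter (isOpen_Ioi.preimage continuous_fst)).mem_nhds ⟨hpW, hcp⟩
    obtain ⟨t, htP, htp, htW, hct⟩ : ∃ t ∈ I \ Q, t < p.1 ∧ (t, f t) ∈ W ∧ c < t := by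
      rcases hpD with hpQ | ⟨-, hpnI⟩
      · have hy := mem_clusterVals_of_mem_closure_graphOn (hcl (hEH hpE))
        rw [(hQ p.1 hpQ).1.1] at hy
        obtain ⟨t, ⟨htP, htp⟩, htW⟩ := exists_mem_of_mem_clusterVals hy hW'
        exact ⟨t, htP, lt_of_le_of_ne htp fun h => htP.2 (h ▸ hpQ), htW⟩
      · obtain ⟨z, hz, t, ht, rfl⟩ := mem_closure_iff_nhds.1 (hcl (hEH hpE)) _ hW'
        refine ⟨t, ht, ?_, hz⟩
        by_contra! hle
        have hlt : p.1 < t := hle.lt_of_ne fun h => hpnI (h ▸ ht.1)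
        exact hpnI (hI.mem_of_mem_closure hc (subset_closure ht.1) hcp hlt)
    have htI : t ∈ Icc c d := ⟨hct.le, htp.le.trans hpI.2⟩
    exact ⟨(t, f t), ⟨hgraph t htI htP, htI⟩, htW, htp⟩
  · rintro p ⟨hpE, hpI⟩ hpD W hW hpW hpd
    have hW' : W ∩ Prod.fst ⁻¹' Iio d ∈ 𝓝 p :=
      (hW.inter (isOpen_Iio.preimage continuous_fst)).mem_nhds ⟨hpW, hpd⟩
    obtain ⟨t, htP, hpt, htW, htd⟩ : ∃ t ∈ I \ Q, p.1 < t ∧ (t, f t) ∈ W ∧ t < d := by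
      rcases hpD with hpQ | ⟨-, hpnI⟩
      · have hy := mem_clusterVals_of_mem_closure_graphOn (hcl (hEH hpE))
        rw [(hQ p.1 hpQ).1.2.1] at hy
        obtain ⟨t, ⟨htP, hpt⟩, htW⟩ := exists_mem_of_mem_clusterVals hy hW'
        exact ⟨t, htP, lt_of_le_of_ne hpt fun h => htP.2 (h ▸ hpQ), htW⟩
      · obtain ⟨z, hz, t, ht, rfl⟩ := mem_closure_iff_nhds.1 (hcl (hEH hpE)) _ hW'
        refine ⟨t, ht, ?_, hz⟩
        by_contra! hle
        have hlt : t < p.1 := hle.lt_of_ne fun h => hpnI (h ▸ ht.1)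
        exact hpnI (hI.mem_of_mem_closure (subset_closure ht.1) hd hlt hpd)
    have htI : t ∈ Icc c d := ⟨hpI.1.trans hpt.le, htd.le⟩
    exact ⟨(t, f t), ⟨hgraph t htI htP, htI⟩, htW, hpt⟩

lemma isConnected_of_subset (hH : IsHypergraphWith H I Q f) {E : Set (ℝ × ℝ)} (hEH : E ⊆ H)
    (hE : (Prod.fst '' E).OrdConnected) (hne : (Prod.fst '' E).Nontrivial) : IsConnected E := by
  refine ⟨hne.nonempty.of_image, isPreconnected_of_forall_pair fun p hp q hq => ?_⟩
  obtain ⟨c, d, hcd, hsub, hpI, hqI⟩ : ∃ c d, c < d ∧ Icc c d ⊆ Prod.fst '' E ∧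
      p.1 ∈ Icc c d ∧ q.1 ∈ Icc c d := by
    by_cases hpq : p.1 = q.1
    · obtain ⟨x, hx, hxp⟩ := hne.exists_ne p.1
      refine ⟨_, _, inf_lt_sup.2 hxp.symm, hE.uIcc_subset (mem_image_of_mem _ hp) hx,
        left_mem_uIcc, ?_⟩
      rw [← hpq]
      exact left_mem_uIcc
    · exact ⟨_, _, inf_lt_sup.2 hpq,
        hE.uIcc_subset (mem_image_of_mem _ hp) (mem_image_of_mem _ hq),
        left_mem_uIcc, right_mem_uIcc⟩
  exact ⟨_, inter_subset_left, ⟨hp, hpI⟩, ⟨hq, hqI⟩, hH.isPreconnected_inter_Icc hEH hcd hsub⟩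

lemma ordConnected_image_fst (hH : IsHypergraphWith H I Q f) : (Prod.fst '' H).OrdConnected := by
  refine ⟨?_⟩
  rintro _ ⟨p, hp, rfl⟩ _ ⟨q, hq, rfl⟩ y ⟨hpy, hyq⟩
  rcases hpy.eq_or_lt with rfl | hpy
  · exact mem_image_of_mem _ hp
  rcases hyq.eq_or_lt with rfl | hyq
  · exact mem_image_of_mem _ hq
  exact hH.subset_image_fst
    (hH.1.mem_of_mem_closure (hH.fst_mem_closure hp) (hH.fst_mem_closure hq) hpy hyq)

end IsHypergraphWith

/-- If `H` is a hypergraph and `E ⊆ H` is such that `π(E)` is a nontrivial interval,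
then `E` is connected. In particular, every hypergraph is connected. -/
theorem hypergraph_subset_connected :
    (∀ H : Set (ℝ × ℝ), IsHypergraph H → ∀ E : Set (ℝ × ℝ), E ⊆ H →
      (Prod.fst '' E).OrdConnected →
      (∃ a ∈ Prod.fst '' E, ∃ b ∈ Prod.fst '' E, a < b) →
      IsConnected E) ∧
    (∀ H : Set (ℝ × ℝ), IsHypergraph H → IsConnected H) := by
  constructor
  · rintro H ⟨I, Q, f, hH⟩ E hEH hE ⟨a, ha, b, hb, hab⟩
    exact hH.isConnected_of_subset hEH hE ⟨a, ha, b, hb, hab.ne⟩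
  · rintro H ⟨I, Q, f, hH⟩
    obtain ⟨a, ha, b, hb, hab⟩ := hH.2.1
    exact hH.isConnected_of_subset Subset.rfl hH.ordConnected_image_fst
      ⟨a, hH.subset_image_fst ha, b, hH.subset_image_fst hb, hab.ne⟩
end
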